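/- Let n, r, s be positive integers with r ≤ n, and let I^1,…,I^s be subsets of [n]={1,…,n}, each of cardinality r, satisfying Σ_{j=1}^{s} Σ_{a=1}^{r} (n−r+a−i^j_a) = r(n−r). Then the following are equivalent: (1) the cup product ∏_{j=1}^{s} ω_{I^j} is a nonzero multiple of the class of a point in H*(Gr(r,n)); (2) for every 1 ≤ d < r and every choice of subsets K^1,…,K^s of [r], each of cardinality d, such that ∏_{j=1}^{s} ω_{K^j} is a nonzero multiple of the class of a point in H*(Gr(d,r)), the inequality Σ_{j=1}^{s} Σ_{a∈K^j} (n−r+a−i^j_a) ≤ d(n−r) holds. -/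

import Mathlib

noncomputable section

open Module Submodule

/-! ### Polynomial functions and the Zariski topology on a vector space -/

/-- Evaluation of a polynomial in linear functionals at a point of a vector space.
These are exactly the polynomial functions on a finite-dimensional vector space. -/
def mEval (k : Type*) {M : Type*} [Field k] [AddCommGroup M] [Module k M]
    (x : M) (p : MvPolynomial (Module.Dual k M) k) : k :=
  MvPolynomial.eval (fun l : Module.Dual k M => l x) p

/-- The Zariski topology on a (finite-dimensional) vector space, generated by the
complements of zero sets of polynomial functions. -/
def mZariski (k M : Type*) [Field k] [AddCommGroup M] [Module k M] :
    TopologicalSpace M :=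
  TopologicalSpace.generateFrom
    {U : Set M | ∃ p : MvPolynomial (Module.Dual k M) k, U = {x : M | mEval k x p ≠ 0}}

/-- The Zariski tangent space at a point `x` to a subset `A` of a vector space:
the common kernel of the differentials at `x` of all polynomial functions vanishing on `A`. -/
def mTangent (k : Type*) {M : Type*} [Field k] [AddCommGroup M] [Module k M]
    (A : Set M) (x : M) : Submodule k M :=
  letI := Classical.decEq (Module.Dual k M)
  ⨅ p ∈ {p : MvPolynomial (Module.Dual k M) k | ∀ a ∈ A, mEval k a p = 0},
    LinearMap.ker (∑ l ∈ p.vars, mEval k x (MvPolynomial.pderiv l p) • (l : Module.Dual k M))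

/-- `f : M → N` is a polynomial map on a subset `A ⊆ M`. -/
def IsPolyOn (k : Type*) {M N : Type*} [Field k] [AddCommGroup M] [Module k M]
    [AddCommGroup N] [Module k N] (A : Set M) (f : M → N) : Prop :=
  ∀ l : Module.Dual k N, ∃ p : MvPolynomial (Module.Dual k M) k, ∀ x ∈ A, l (f x) = mEval k x p

/-- Dimension (topological Krull dimension) of a subset of a topological space. -/
def subDim {α : Type*} (t : TopologicalSpace α) (C : Set α) : WithBot ℕ∞ :=
  @topologicalKrullDim C (TopologicalSpace.induced (Subtype.val : C → α) t)

/-- The irreducible components of a subset `A` of a topological space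
(for the subspace topology). -/
def subComponents {α : Type*} (t : TopologicalSpace α) (A : Set α) : Set (Set ↥A) :=
  @irreducibleComponents A (TopologicalSpace.induced (Subtype.val : A → α) t)

/-- Dimension of a subset `C` of a subspace `A` of a topological space. -/
def compDim {α : Type*} (t : TopologicalSpace α) (A : Set α) (C : Set ↥A) : WithBot ℕ∞ :=
  subDim (TopologicalSpace.induced (Subtype.val : A → α) t) C

/-! ### Flags, Schubert cells and Schubert varieties -/

/-- A complete flag on a finite-dimensional vector space, recorded as the increasing
function sending `m` to the `m`-th member (of dimension `m`) of the flag. -/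
def IsFlag {k M : Type*} [Field k] [AddCommGroup M] [Module k M]
    (E : ℕ → Submodule k M) : Prop :=
  Monotone E ∧ ∀ m : ℕ, finrank k ↥(E m) = min m (finrank k M)

/-- Membership of `V` in the (open) Schubert cell `Ω°_I(E_•) ⊆ Gr(r, M)` attached to the
subset `I ⊆ [n]` recorded by the strictly increasing tuple `i : Fin r → Fin n`
(`0`-indexed: the `1`-based subset is `{i a + 1}`): `dim (V ∩ E_u) = #{a | i_a ≤ u}`. -/
def cellMem {k M : Type*} [Field k] [AddCommGroup M] [Module k M] {n r : ℕ}
    (i : Fin r → Fin n) (E : ℕ → Submodule k M) (V : Submodule k M) : Prop :=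
  finrank k ↥V = r ∧
    ∀ u : ℕ, u ≤ n →
      finrank k ↥(V ⊓ E u) =
        (Finset.univ.filter (fun a : Fin r => (i a : ℕ) + 1 ≤ u)).card

/-- Membership of `V` in the (closed) Schubert variety `Ω_I(E_•) ⊆ Gr(r, M)`:
`dim (V ∩ E_{i_a}) ≥ a` for `a = 1, …, r`. -/
def varMem {k M : Type*} [Field k] [AddCommGroup M] [Module k M] {n r : ℕ}
    (i : Fin r → Fin n) (E : ℕ → Submodule k M) (V : Submodule k M) : Prop :=
  finrank k ↥V = r ∧ ∀ a : Fin r, (a : ℕ) + 1 ≤ finrank k ↥(V ⊓ E ((i a : ℕ) + 1))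

/-- The flag induced on a subspace `V` by a flag `E` on `M`: its `a`-th member is the
smallest subspace of the form `V ∩ E_u` of dimension `≥ a`. -/
def indSub {k M : Type*} [Field k] [AddCommGroup M] [Module k M]
    (E : ℕ → Submodule k M) (V : Submodule k M) : ℕ → Submodule k ↥V := fun a =>
  ⨅ u ∈ {u : ℕ | a ≤ finrank k ↥(Submodule.comap V.subtype (E u))},
    Submodule.comap V.subtype (E u)

/-- The flag induced on the quotient `M ⧸ V` by a flag `E` on `M`: its `b`-th member is
the smallest subspace of the form `(E_u + V)/V` of dimension `≥ b`. -/
def indQuot {k M : Type*} [Field k] [AddCommGroup M] [Module k M]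
    (E : ℕ → Submodule k M) (V : Submodule k M) : ℕ → Submodule k (M ⧸ V) := fun b =>
  ⨅ u ∈ {u : ℕ | b ≤ finrank k ↥(Submodule.map V.mkQ (E u))},
    Submodule.map V.mkQ (E u)

/-- The flag spanned by a tuple of vectors (a complete flag when the tuple is a basis). -/
def spanFlag (k : Type*) {M : Type*} [Field k] [AddCommGroup M] [Module k M] {r : ℕ}
    (b : Fin r → M) : ℕ → Submodule k M := fun m =>
  Submodule.span k (b '' {a : Fin r | (a : ℕ) < m})

/-- `P` holds for a generic point of `Fl(M)^s` (`r = dim M`): there is a nonempty Zariski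
open set of `s`-tuples of bases of `M` on which the associated tuples of complete flags
satisfy `P`. -/
def GenericFlags (k : Type*) {M : Type*} [Field k] [AddCommGroup M] [Module k M]
    (s r : ℕ) (P : (Fin s → ℕ → Submodule k M) → Prop) : Prop :=
  ∃ U : Set (Fin s → Fin r → M),
    @IsOpen _ (mZariski k (Fin s → Fin r → M)) U ∧
    (∃ b ∈ U, ∀ j, LinearIndependent k (b j)) ∧
    ∀ b ∈ U, (∀ j, LinearIndependent k (b j)) → P (fun j => spanFlag k (b j))

/-- `P` holds for a generic point of `Fl(M)^s × Fl(Q)^s` (`r = dim M`, `q = dim Q`). -/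
def GenericFlagPairs (k : Type*) {M Q : Type*} [Field k] [AddCommGroup M] [Module k M]
    [AddCommGroup Q] [Module k Q] (s r q : ℕ)
    (P : (Fin s → ℕ → Submodule k M) → (Fin s → ℕ → Submodule k Q) → Prop) : Prop :=
  ∃ U : Set ((Fin s → Fin r → M) × (Fin s → Fin q → Q)),
    @IsOpen _ (mZariski k ((Fin s → Fin r → M) × (Fin s → Fin q → Q))) U ∧
    (∃ b ∈ U, (∀ j, LinearIndependent k (b.1 j)) ∧ ∀ j, LinearIndependent k (b.2 j)) ∧
    ∀ b ∈ U, ((∀ j, LinearIndependent k (b.1 j)) ∧ ∀ j, LinearIndependent k (b.2 j)) →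
      P (fun j => spanFlag k (b.1 j)) (fun j => spanFlag k (b.2 j))

/-! ### The spaces `Hom_𝓘(V, Q, 𝓕, 𝓖)` -/

/-- The subspace `{φ : M →ₗ Q | φ(p) ⊆ q}` of `Hom(M, Q)`. -/
def homConstraint {k M Q : Type*} [Field k] [AddCommGroup M] [Module k M]
    [AddCommGroup Q] [Module k Q] (p : Submodule k M) (q : Submodule k Q) :
    Submodule k (M →ₗ[k] Q) :=
  LinearMap.ker ((LinearMap.llcomp k ↥p Q (Q ⧸ q) q.mkQ).comp (LinearMap.lcomp k Q p.subtype))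

/-- `Hom_𝓘(M, Q, F, G) = {φ | φ(F^j_a) ⊆ G^j_{i^j_a - a} for all a = 1, …, r, j = 1, …, s}`. -/
def homSpace {k M Q : Type*} [Field k] [AddCommGroup M] [Module k M]
    [AddCommGroup Q] [Module k Q] {n r s : ℕ} (I : Fin s → Fin r → Fin n)
    (F : Fin s → ℕ → Submodule k M) (G : Fin s → ℕ → Submodule k Q) :
    Submodule k (M →ₗ[k] Q) :=
  ⨅ j : Fin s, ⨅ a : Fin r,
    homConstraint (F j ((a : ℕ) + 1)) (G j ((I j a : ℕ) - (a : ℕ)))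

/-! ### Charts on the Grassmannian, tangent spaces to Schubert cells -/

/-- The graph of `ψ : V →ₗ C`, a point of the Grassmannian chart around `V`
determined by a complement `C` of `V`. -/
def graphMap {k M : Type*} [Field k] [AddCommGroup M] [Module k M]
    (V C : Submodule k M) (ψ : ↥V →ₗ[k] ↥C) : Submodule k M :=
  LinearMap.range (V.subtype + C.subtype ∘ₗ ψ)

/-- The canonical identification `Hom(V, C) ≃ Hom(V, M/V)` (derivative of the chart). -/
def conjMap {k M : Type*} [Field k] [AddCommGroup M] [Module k M]
    (V C : Submodule k M) : (↥V →ₗ[k] ↥C) →ₗ[k] (↥V →ₗ[k] M ⧸ V) :=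
  LinearMap.llcomp k ↥V ↥C (M ⧸ V) (V.mkQ ∘ₗ C.subtype)

/-- The tangent space at `V` to a set `S` of points of the Grassmannian `Gr(r, M)`,
computed in the chart determined by a complement `C` of `V` and viewed inside
`Hom(V, M/V)` via the canonical identification. -/
def grTangent {k M : Type*} [Field k] [AddCommGroup M] [Module k M]
    (S : Set (Submodule k M)) (V C : Submodule k M) :
    Submodule k (↥V →ₗ[k] (M ⧸ V)) :=
  Submodule.map (conjMap V C)
    (mTangent k {ψ : ↥V →ₗ[k] ↥C | graphMap V C ψ ∈ S} 0)

/-- The Zariski topology on the Grassmannian of `r`-dimensional subspaces of `M`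
(as a topology on `Submodule k M`), coinduced from the Stiefel parameterization by
spanning `r`-tuples. -/
def grTop (k : Type*) {M : Type*} [Field k] [AddCommGroup M] [Module k M] (r : ℕ) :
    TopologicalSpace (Submodule k M) :=
  TopologicalSpace.coinduced (fun b : Fin r → M => Submodule.span k (Set.range b))
    (mZariski k (Fin r → M))

/-! ### Numerical quantities -/

/-- `codim ω_I = ∑_{a=1}^r (n - r + a - i_a)` (as an integer). -/
def codimZ (n r : ℕ) (i : Fin r → Fin n) : ℤ :=
  ∑ a : Fin r, ((n : ℤ) - (r : ℤ) + ((a : ℕ) : ℤ) - ((i a : ℕ) : ℤ))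

/-- The quantity `∑_j ∑_{a ∈ K^j} (n - r + a - i^j_a) - d(n - r)` of Inequality `(†^𝓘_𝓚)`. -/
def daggerZ (n r d : ℕ) {s : ℕ} (I : Fin s → Fin r → Fin n)
    (K : Fin s → Fin d → Fin r) : ℤ :=
  (∑ j : Fin s, ∑ t : Fin d,
      ((n : ℤ) - (r : ℤ) + ((K j t : ℕ) : ℤ) - ((I j (K j t) : ℕ) : ℤ)))
    - (d : ℤ) * ((n : ℤ) - (r : ℤ))

/-- The expected dimension `dim(S, M, 𝓕) = d(m - d) - ∑_j ∑_{t=1}^d (m - d + t - k^j_t)`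
of an intersection of Schubert cells `Ω°_{K^j}` in `Gr(d, m)`. -/
def eDimZ {s : ℕ} (m d : ℕ) (K : Fin s → Fin d → Fin m) : ℤ :=
  (d : ℤ) * ((m : ℤ) - (d : ℤ)) -
    ∑ j : Fin s, ∑ t : Fin d,
      ((m : ℤ) - (d : ℤ) + ((t : ℕ) : ℤ) - ((K j t : ℕ) : ℤ))

/-- `codim ω_I` as a natural number. -/
def codimN (n r : ℕ) (i : Fin r → Fin n) : ℕ :=
  ∑ a : Fin r, ((n - r + (a : ℕ)) - (i a : ℕ))

/-! ### The cohomology ring of the Grassmannian, Schubert classes -/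

/-- The ideal `(h_{n-r+1}, …, h_n)` of the polynomial ring in `r` variables
(`h_m` the complete homogeneous symmetric polynomials). -/
def grassIdeal (r n : ℕ) : Ideal (MvPolynomial (Fin r) ℤ) :=
  Ideal.span ((fun m : ℕ => MvPolynomial.hsymm (Fin r) ℤ m) '' Set.Icc (n - r + 1) n)

/-- A presentation of the cohomology (Chow) ring `H^*(Gr(r,n))`: products of Schubert
classes vanish here exactly when they vanish in `H^*(Gr(r,n))`. -/
abbrev grassRing (r n : ℕ) : Type :=
  MvPolynomial (Fin r) ℤ ⧸ grassIdeal r n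

/-- `h_m` for an integer `m` (zero for negative `m`). -/
def hkZ (r : ℕ) (m : ℤ) : MvPolynomial (Fin r) ℤ :=
  if 0 ≤ m then MvPolynomial.hsymm (Fin r) ℤ m.toNat else 0

/-- The Schur polynomial (Jacobi–Trudi determinant) of the partition
`λ_a = n - r + a - i_a` attached to the subset `I ⊆ [n]` recorded by `i`. -/
def schurI {n r : ℕ} (i : Fin r → Fin n) : MvPolynomial (Fin r) ℤ :=
  Matrix.det (Matrix.of fun a b : Fin r =>
    hkZ r ((n : ℤ) - (r : ℤ) + ((b : ℕ) : ℤ) - ((i a : ℕ) : ℤ)))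

/-- The Schubert class `ω_I ∈ H^*(Gr(r,n))` of the subset `I ⊆ [n]` recorded by the
strictly increasing tuple `i : Fin r → Fin n`. -/
def omegaCls {n r : ℕ} (i : Fin r → Fin n) : grassRing r n :=
  Ideal.Quotient.mk (grassIdeal r n) (schurI i)

/-- The class of a point in `H^*(Gr(r,n))`: the Schubert class of `I = {1, …, r}`. -/
def pointCls (r n : ℕ) (h : r ≤ n) : grassRing r n :=
  omegaCls (fun a : Fin r => Fin.castLE h a)

/-! ### Schur polynomials of partitions, Littlewood–Richardson coefficients -/

/-- The Schur polynomial of a partition with at most `r` parts, via Jacobi–Trudi. -/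
def schurP {r : ℕ} (lam : Fin r → ℕ) : MvPolynomial (Fin r) ℤ :=
  Matrix.det (Matrix.of fun a b : Fin r =>
    hkZ r (((lam a : ℕ) : ℤ) - ((a : ℕ) : ℤ) + ((b : ℕ) : ℤ)))

/-- The Vandermonde alternant `a_δ = det(x_a^{r-1-b})`. -/
def alternant (r : ℕ) : MvPolynomial (Fin r) ℤ :=
  Matrix.det (Matrix.of fun a b : Fin r => (MvPolynomial.X a) ^ (r - 1 - (b : ℕ)))

/-- The coefficient of the Schur polynomial `s_δ` in a symmetric polynomial `f`
(in `r` variables): the coefficient of the monomial `x^{δ + (r-1, …, 1, 0)}` in `f ⬝ a_δ`. -/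
def schurCoeff (r : ℕ) (f : MvPolynomial (Fin r) ℤ) (δ : Fin r → ℕ) : ℤ :=
  MvPolynomial.coeff
    (Finsupp.equivFunOnFinite.symm (fun a : Fin r => δ a + (r - 1 - (a : ℕ))))
    (f * alternant r)

/-- The Littlewood–Richardson coefficient `c^λ_{μ,ν}` (partitions with at most `r` parts):
the multiplicity of `V_λ` in `V_μ ⊗ V_ν`, i.e. of `s_λ` in `s_μ s_ν`. -/
def lrCoeff (r : ℕ) (lam mu nu : Fin r → ℕ) : ℤ :=
  schurCoeff r (schurP mu * schurP nu) lam

/-- The multiplicity of `V_δ` in `V_{Λ 1} ⊗ ⋯ ⊗ V_{Λ t}` (as `GL(r)`-representations),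
i.e. of `s_δ` in `∏_j s_{Λ j}`. -/
def multiCoeff (r : ℕ) {t : ℕ} (Λ : Fin t → Fin r → ℕ) (δ : Fin r → ℕ) : ℤ :=
  schurCoeff r (∏ j : Fin t, schurP (Λ j)) δ


section

theorem coeff_hsymm (r n : ℕ) (m : Fin r →₀ ℕ) :
    MvPolynomial.coeff m (MvPolynomial.hsymm (Fin r) ℤ n) = if m.degree = n then 1 else 0 := by
  classical
  have h1 : ∀ s : Sym (Fin r) n, (s.1.map (MvPolynomial.X (R := ℤ))).prod
      = MvPolynomial.monomial (Multiset.toFinsupp s.1) 1 := by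
    intro s
    rw [← MvPolynomial.prod_X_pow_eq_monomial]
    rw [Finset.prod_multiset_map_count]
    simp [Multiset.toFinsupp_support, Multiset.toFinsupp_apply]
  unfold MvPolynomial.hsymm
  rw [MvPolynomial.coeff_sum]
  simp_rw [h1, MvPolynomial.coeff_monomial]
  have hcard : ∀ m : Fin r →₀ ℕ, Multiset.card (Finsupp.toMultiset m) = m.degree := by
    intro m
    simp [Finsupp.card_toMultiset, Finsupp.degree_eq_sum, Finsupp.sum_fintype]
  split_ifs with h
  · let s₀ : Sym (Fin r) n := Sym.mk _ ((hcard m).trans h)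
    have hs₀ : s₀.1 = Finsupp.toMultiset m := rfl
    refine (Finset.sum_eq_single_of_mem s₀ (Finset.mem_univ s₀) ?_).trans ?_
    · intro b _ hb
      rw [if_neg]
      intro hbm
      apply hb
      apply Subtype.ext
      rw [hs₀, ← hbm, Multiset.toFinsupp_toMultiset]
    · rw [hs₀]
      simp
  · apply Finset.sum_eq_zero
    intro s _
    rw [if_neg]
    intro hs
    apply h
    rw [← hcard, ← hs, Multiset.toFinsupp_toMultiset]
    exact s.2

open PowerSeries in
theorem mk_hsymm_eq_prod (r : ℕ) :
    (PowerSeries.mk fun m => MvPolynomial.hsymm (Fin r) ℤ m)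
      = ∏ i : Fin r, PowerSeries.mk fun m => (MvPolynomial.X i : MvPolynomial (Fin r) ℤ) ^ m := by
  classical
  ext N m
  rw [PowerSeries.coeff_mk, PowerSeries.coeff_prod, coeff_hsymm]
  simp only [PowerSeries.coeff_mk]
  rw [MvPolynomial.coeff_sum]
  have : ∀ l : Fin r →₀ ℕ, ∏ i, (MvPolynomial.X i : MvPolynomial (Fin r) ℤ) ^ l i
      = MvPolynomial.monomial l 1 := by
    intro l
    rw [← MvPolynomial.prod_X_pow_eq_monomial]
    symm
    apply Finset.prod_subset (Finset.subset_univ _)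
    intro i _ hi
    simp at hi; simp [hi]
  simp_rw [this, MvPolynomial.coeff_monomial]
  rw [Finset.sum_ite_eq']
  congr 1
  simp [Finset.mem_finsuppAntidiag, Finsupp.degree_eq_sum]

theorem mk_pow_mul_one_sub {A : Type*} [CommRing A] (x : A) :
    (PowerSeries.mk fun m => x ^ m) * (1 - PowerSeries.C x * PowerSeries.X) = 1 := by
  ext n
  rw [mul_sub, mul_one, mul_comm (PowerSeries.C x), ← mul_assoc]
  cases n with
  | zero => simp
  | succ n => simp [PowerSeries.coeff_succ_mul_X, PowerSeries.coeff_one, pow_succ]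

/-- The power series `∏_{i ∈ s} (1 - x_i t)`, as a polynomial. -/
def ePoly {r : ℕ} (s : Finset (Fin r)) : Polynomial (MvPolynomial (Fin r) ℤ) :=
  ∏ i ∈ s, (1 - Polynomial.C (MvPolynomial.X i) * Polynomial.X)

theorem natDegree_ePoly {r : ℕ} (s : Finset (Fin r)) : (ePoly s).natDegree ≤ s.card := by
  refine (Polynomial.natDegree_prod_le _ _).trans ?_
  rw [Finset.card_eq_sum_ones]
  apply Finset.sum_le_sum
  intro i _
  refine (Polynomial.natDegree_sub_le _ _).trans ?_
  simp only [Polynomial.natDegree_one, zero_le, sup_of_le_right]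
  exact (Polynomial.natDegree_C_mul_le _ _).trans Polynomial.natDegree_X_le

theorem mk_hsymm_mul_ePoly {r : ℕ} (s : Finset (Fin r)) :
    (PowerSeries.mk fun m => MvPolynomial.hsymm (Fin r) ℤ m) * (ePoly s : PowerSeries _)
      = ∏ i ∈ sᶜ, PowerSeries.mk fun m => (MvPolynomial.X i : MvPolynomial (Fin r) ℤ) ^ m := by
  rw [mk_hsymm_eq_prod, ← Finset.prod_mul_prod_compl s, mul_right_comm]
  have : ((ePoly s : Polynomial _) : PowerSeries (MvPolynomial (Fin r) ℤ))
      = ∏ i ∈ s, (1 - PowerSeries.C (MvPolynomial.X i) * PowerSeries.X) := by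
    unfold ePoly
    rw [← Polynomial.coeToPowerSeries.ringHom_apply, map_prod]
    simp
  rw [this, ← Finset.prod_mul_distrib]
  simp_rw [mk_pow_mul_one_sub]
  simp

theorem hkZ_of_neg {r : ℕ} {m : ℤ} (h : m < 0) : hkZ r m = 0 := by
  unfold hkZ; rw [if_neg (by omega)]

theorem hkZ_natCast (r m : ℕ) : hkZ r (m : ℤ) = MvPolynomial.hsymm (Fin r) ℤ m := by
  unfold hkZ; simp

theorem hkZ_zero (r : ℕ) : hkZ r 0 = 1 := by
  have := hkZ_natCast r 0
  simpa using this

theorem sum_hkZ_mul_coeff_ePoly {r : ℕ} (s : Finset (Fin r)) (N D : ℕ) (hD : s.card < D) :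
    ∑ q ∈ Finset.range D, hkZ r ((N : ℤ) - q) * (ePoly s).coeff q
      = PowerSeries.coeff N (∏ i ∈ sᶜ, PowerSeries.mk
          fun m => (MvPolynomial.X i : MvPolynomial (Fin r) ℤ) ^ m) := by
  rw [← mk_hsymm_mul_ePoly, mul_comm, PowerSeries.coeff_mul,
    Finset.Nat.sum_antidiagonal_eq_sum_range_succ_mk]
  have e1 : ∀ q, (ePoly s).coeff q ≠ 0 → q < D := fun q hq =>
    ((Polynomial.le_natDegree_of_ne_zero hq).trans (natDegree_ePoly s)).trans_lt hD
  have key : ∀ q : ℕ, hkZ r ((N : ℤ) - q) * (ePoly s).coeff q ≠ 0 → q < D ∧ q < N + 1 := by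
    intro q hq
    refine ⟨e1 q (right_ne_zero_of_mul hq), ?_⟩
    by_contra h
    exact left_ne_zero_of_mul hq (hkZ_of_neg (by omega))
  trans ∑ q ∈ Finset.range (N + 1), hkZ r ((N : ℤ) - q) * (ePoly s).coeff q
  · trans ∑ q ∈ Finset.range (max D (N+1)), hkZ r ((N : ℤ) - q) * (ePoly s).coeff q
    · apply Finset.sum_subset (by simp)
      intro q _ hq
      by_contra h
      exact hq (by simpa using (key q h).1)
    · symm
      apply Finset.sum_subset (by simp)
      intro q _ hq
      by_contra h
      exact hq (by simpa using (key q h).2)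
  · apply Finset.sum_congr rfl
    intro q hq
    simp only [Finset.mem_range] at hq
    have : (N : ℤ) - q = ((N - q : ℕ) : ℤ) := by omega
    rw [this, hkZ_natCast]
    simp [mul_comm]

/-- The alternant attached to an exponent vector. -/
def altDet (r : ℕ) (γ : Fin r → ℕ) : MvPolynomial (Fin r) ℤ :=
  Matrix.det (Matrix.of fun a i : Fin r => (MvPolynomial.X i : MvPolynomial (Fin r) ℤ) ^ γ a)

/-- The Jacobi-Trudi determinant attached to an exponent vector. -/
def jtDet (r : ℕ) (γ : Fin r → ℕ) : MvPolynomial (Fin r) ℤ :=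
  Matrix.det (Matrix.of fun a b : Fin r => hkZ r ((γ a : ℤ) - (r - 1) + (b : ℕ)))

theorem sum_hkZ_mul_coeff_compl {r : ℕ} (N : ℕ) (k : Fin r) :
    ∑ b : Fin r, hkZ r ((N : ℤ) - (r - 1) + (b : ℕ)) * (ePoly {k}ᶜ).coeff (r - 1 - b)
      = (MvPolynomial.X k : MvPolynomial (Fin r) ℤ) ^ N := by
  have hr : 0 < r := k.pos
  have h := sum_hkZ_mul_coeff_ePoly ({k}ᶜ : Finset (Fin r)) N r
    (by rw [Finset.card_compl]; simp; omega)
  rw [compl_compl, Finset.prod_singleton, PowerSeries.coeff_mk] at h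
  rw [← h, ← Finset.sum_range_reflect, Finset.sum_range]
  apply Finset.sum_congr rfl
  intro b _
  have := b.2
  congr 2
  omega

theorem jtDet_mul_coeff {r : ℕ} (γ : Fin r → ℕ) :
    jtDet r γ * Matrix.det (Matrix.of fun b k : Fin r => (ePoly {k}ᶜ).coeff (r - 1 - (b : ℕ)))
      = altDet r γ := by
  unfold jtDet altDet
  rw [← Matrix.det_mul]
  congr 1
  ext1 a k
  rw [Matrix.mul_apply]
  simpa using sum_hkZ_mul_coeff_compl (γ a) k

theorem alternant_eq (r : ℕ) : alternant r = altDet r (fun b => r - 1 - b) := by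
  unfold alternant altDet
  rw [← Matrix.det_transpose]
  rfl

theorem det_of_upper {r : ℕ} (M : Matrix (Fin r) (Fin r) (MvPolynomial (Fin r) ℤ))
    (h : ∀ a b, b < a → M a b = 0) : M.det = ∏ a, M a a :=
  Matrix.det_of_isUpperTriangular (fun a b hab => h a b hab)

theorem jtDet_rho (r : ℕ) : jtDet r (fun b => r - 1 - b) = 1 := by
  unfold jtDet
  rw [det_of_upper]
  · apply Finset.prod_eq_one
    intro a _
    have := a.2
    rw [Matrix.of_apply, ← hkZ_zero r]
    congr 1
    dsimp only
    omega
  · intro a b hab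
    have := a.2
    have : (b : ℕ) < a := hab
    rw [Matrix.of_apply]
    apply hkZ_of_neg
    dsimp only
    omega

theorem jtDet_mul_alternant (r : ℕ) (γ : Fin r → ℕ) :
    jtDet r γ * alternant r = altDet r γ := by
  have := jtDet_mul_coeff (fun b : Fin r => r - 1 - b)
  rw [jtDet_rho, one_mul, ← alternant_eq] at this
  rw [← this, jtDet_mul_coeff]

theorem schurI_eq_jtDet {n r : ℕ} (i : Fin r → Fin n) :
    schurI i = jtDet r (fun a => n - 1 - i a) := by
  unfold schurI jtDet
  congr 1
  ext1 a b
  have := (i a).2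
  have := a.2
  rw [Matrix.of_apply, Matrix.of_apply]
  congr 1
  dsimp only
  omega

theorem hsymm_mem_grassIdeal {r n : ℕ} (hr : r ≤ n) (m : ℕ) (hm : n - r + 1 ≤ m) :
    MvPolynomial.hsymm (Fin r) ℤ m ∈ grassIdeal r n := by
  induction m using Nat.strong_induction_on with
  | _ m ih =>
    by_cases hmn : m ≤ n
    · exact Ideal.subset_span ⟨m, ⟨hm, hmn⟩, rfl⟩
    · have h := sum_hkZ_mul_coeff_ePoly (Finset.univ : Finset (Fin r)) m (r + 1) (by simp)
      rw [Finset.compl_univ, Finset.prod_empty, PowerSeries.coeff_one, if_neg (by omega),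
        Finset.sum_range_succ'] at h
      have h0 : (ePoly (Finset.univ : Finset (Fin r))).coeff 0 = 1 := by
        unfold ePoly
        rw [Polynomial.coeff_zero_prod]
        simp
      rw [h0, mul_one, Nat.cast_zero, sub_zero, hkZ_natCast] at h
      rw [eq_neg_of_add_eq_zero_right h]
      apply neg_mem
      apply sum_mem
      intro q hq
      simp only [Finset.mem_range] at hq
      apply Ideal.mul_mem_right
      have : (m : ℤ) - ((q + 1 : ℕ) : ℤ) = ((m - (q + 1) : ℕ) : ℤ) := by omega
      rw [this, hkZ_natCast]
      exact ih _ (by omega) (by omega)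

end

section

/-- The exponent vector of a function, as a finitely supported function. -/
abbrev expo {r : ℕ} (γ : Fin r → ℕ) : Fin r →₀ ℕ := Finsupp.equivFunOnFinite.symm γ

theorem prod_X_pow_eq_monomial_expo {r : ℕ} (γ : Fin r → ℕ) :
    ∏ i, (MvPolynomial.X i : MvPolynomial (Fin r) ℤ) ^ γ i = MvPolynomial.monomial (expo γ) 1 := by
  rw [← MvPolynomial.prod_X_pow_eq_monomial]
  symm
  apply Finset.prod_subset (Finset.subset_univ _)
  intro i _ hi
  simp at hi; simp [hi]

theorem altDet_eq_sum {r : ℕ} (γ : Fin r → ℕ) :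
    altDet r γ = ∑ σ : Equiv.Perm (Fin r),
      Equiv.Perm.sign σ • MvPolynomial.monomial (expo fun i => γ (σ i)) (1 : ℤ) := by
  unfold altDet
  rw [Matrix.det_apply]
  apply Finset.sum_congr rfl
  intro σ _
  rw [← prod_X_pow_eq_monomial_expo]
  simp

theorem expo_comp_injective {r : ℕ} {γ δ : Fin r → ℕ} (hγ : StrictAnti γ) (hδ : StrictAnti δ)
    (σ : Equiv.Perm (Fin r)) (h : ∀ i, γ (σ i) = δ i) : γ = δ ∧ σ = 1 := by
  have h1 : StrictMono σ := by
    intro a b hab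
    have h2 := hδ hab
    rw [← h, ← h] at h2
    exact hγ.lt_iff_gt.1 h2
  have h3 : σ = 1 := (Equiv.Perm.monotone_iff σ).1 h1.monotone
  refine ⟨?_, h3⟩
  ext a
  simpa [h3] using h a

theorem coeff_altDet {r : ℕ} {γ δ : Fin r → ℕ} (hγ : StrictAnti γ) (hδ : StrictAnti δ) :
    MvPolynomial.coeff (expo δ) (altDet r γ) = if γ = δ then 1 else 0 := by
  rw [altDet_eq_sum, MvPolynomial.coeff_sum]
  simp_rw [MvPolynomial.coeff_smul, MvPolynomial.coeff_monomial]
  rw [Finset.sum_eq_single 1]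
  · simp
  · intro σ _ hσ
    rw [if_neg, smul_zero]
    intro h
    apply hσ
    refine (expo_comp_injective hγ hδ σ ?_).2
    intro i
    exact DFunLike.congr_fun h i
  · simp

theorem alternating_eq_sum {r : ℕ} (f : MvPolynomial (Fin r) ℤ)
    (hf : ∀ (σ : Equiv.Perm (Fin r)) (m : Fin r →₀ ℕ),
      MvPolynomial.coeff (m.mapDomain σ) f = Equiv.Perm.sign σ • MvPolynomial.coeff m f)
    (h0 : ∀ γ : Fin r → ℕ, StrictAnti γ → MvPolynomial.coeff (expo γ) f = 0) : f = 0 := by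
  ext m
  rw [MvPolynomial.coeff_zero]
  by_cases hm : Function.Injective m
  · let σ := Tuple.sort (fun i => OrderDual.toDual (m i))
    have hs := Tuple.monotone_sort (fun i => OrderDual.toDual (m i))
    have h1 : StrictAnti (fun i => m (σ i)) := by
      have : Antitone (fun i => m (σ i)) := fun a b hab => hs hab
      exact this.strictAnti_of_injective (hm.comp σ.injective)
    have h2 := h0 _ h1
    have h3 : expo (fun i => m (σ i)) = m.mapDomain σ.symm := by
      ext i
      rw [Finsupp.mapDomain_equiv_apply]
      simp
    rw [h3, hf] at h2
    exact (smul_eq_zero_iff_eq _).1 h2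
  · simp only [Function.Injective, not_forall] at hm
    obtain ⟨a, b, hab, hne⟩ := hm
    have h1 := hf (Equiv.swap a b) m
    have h2 : m.mapDomain (Equiv.swap a b) = m := by
      ext i
      rw [Finsupp.mapDomain_equiv_apply, Equiv.symm_swap]
      by_cases hia : i = a
      · rw [hia, Equiv.swap_apply_left, hab]
      · by_cases hib : i = b
        · rw [hib, Equiv.swap_apply_right, hab]
        · rw [Equiv.swap_apply_of_ne_of_ne hia hib]
    rw [h2, Equiv.Perm.sign_swap hne] at h1
    have h3 : MvPolynomial.coeff m f = - MvPolynomial.coeff m f := by simpa using h1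
    omega

theorem coeff_of_mem_span_altDet {r n : ℕ} {f : MvPolynomial (Fin r) ℤ}
    {μ : Fin r → ℕ} (hμ : ∀ i, μ i < n) {γ : Fin r → ℕ} {a : Fin r} (ha : n ≤ γ a) :
    MvPolynomial.coeff (expo μ) (f * altDet r γ) = 0 := by
  rw [altDet_eq_sum, Finset.mul_sum, MvPolynomial.coeff_sum]
  apply Finset.sum_eq_zero
  intro σ _
  rw [mul_smul_comm, MvPolynomial.coeff_smul, MvPolynomial.coeff_mul_monomial', if_neg, smul_zero]
  intro h
  have := h (σ.symm a)
  simp at this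
  have := hμ (σ.symm a)
  omega

theorem hsymm_mul_alternant {r : ℕ} (hr : 0 < r) (m : ℕ) :
    MvPolynomial.hsymm (Fin r) ℤ m * alternant r
      = altDet r (fun b => if (b : ℕ) = 0 then m + r - 1 else r - 1 - b) := by
  rw [← jtDet_mul_alternant]
  congr 1
  unfold jtDet
  rw [det_of_upper]
  · rw [Finset.prod_eq_single (⟨0, hr⟩ : Fin r)]
    · rw [Matrix.of_apply, ← hkZ_natCast]
      congr 1
      dsimp only
      simp
      omega
    · intro b _ hb
      have : (b : ℕ) ≠ 0 := fun h => hb (Fin.ext h)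
      rw [Matrix.of_apply, ← hkZ_zero r]
      congr 1
      dsimp only
      rw [if_neg this]
      omega
    · simp
  · intro a b hab
    have := a.2
    have : (b : ℕ) < a := hab
    rw [Matrix.of_apply]
    apply hkZ_of_neg
    dsimp only
    rw [if_neg (by omega)]
    omega

theorem coeff_mul_alternant_of_mem {r n : ℕ} (hr : 0 < r) {g : MvPolynomial (Fin r) ℤ}
    (hg : g ∈ grassIdeal r n) {μ : Fin r → ℕ} (hμ : ∀ i, μ i < n) :
    MvPolynomial.coeff (expo μ) (g * alternant r) = 0 := by
  unfold grassIdeal at hg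
  induction hg using Submodule.span_induction with
  | mem x hx =>
    obtain ⟨m, hm, rfl⟩ := hx
    have hm1 := hm.1
    dsimp only
    rw [hsymm_mul_alternant hr, ← one_mul (altDet _ _)]
    refine coeff_of_mem_span_altDet hμ (a := ⟨0, hr⟩) ?_
    simp
    omega
  | zero => simp
  | add x y _ _ hx hy => rw [add_mul, MvPolynomial.coeff_add, hx, hy, add_zero]
  | smul a x hx ih =>
    clear ih
    rw [smul_eq_mul]
    induction hx using Submodule.span_induction generalizing a with
    | mem x hx =>
      obtain ⟨m, hm, rfl⟩ := hx
      have hm1 := hm.1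
      dsimp only
      rw [mul_assoc, hsymm_mul_alternant hr]
      refine coeff_of_mem_span_altDet hμ (a := ⟨0, hr⟩) ?_
      simp
      omega
    | zero => simp
    | add x y _ _ hx hy => rw [mul_add, add_mul, MvPolynomial.coeff_add, hx, hy, add_zero]
    | smul b x _ hx => rw [smul_eq_mul, ← mul_assoc]; exact hx _

theorem jtDet_mem_grassIdeal {r n : ℕ} (hrn : r ≤ n) {γ : Fin r → ℕ} {a : Fin r} (ha : n ≤ γ a) :
    jtDet r γ ∈ grassIdeal r n := by
  unfold jtDet
  rw [Matrix.det_apply]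
  apply sum_mem
  intro σ _
  apply Submodule.smul_of_tower_mem
  rw [← Finset.mul_prod_erase _ _ (Finset.mem_univ (σ.symm a))]
  apply Ideal.mul_mem_right
  simp only [Equiv.apply_symm_apply, Matrix.of_apply]
  have h : (γ a : ℤ) - (r - 1) + (σ.symm a : ℕ) = ((γ a + 1 + (σ.symm a : ℕ) - r : ℕ) : ℤ) := by
    omega
  rw [h, hkZ_natCast]
  exact hsymm_mem_grassIdeal hrn _ (by omega)

/-- All exponents in the support of `p` have degree `d`. -/
def HomogZ {r : ℕ} (p : MvPolynomial (Fin r) ℤ) (d : ℤ) : Prop :=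
  ∀ m, MvPolynomial.coeff m p ≠ 0 → ((m.degree : ℕ) : ℤ) = d

theorem HomogZ.mul {r : ℕ} {p q : MvPolynomial (Fin r) ℤ} {d e : ℤ} (hp : HomogZ p d)
    (hq : HomogZ q e) : HomogZ (p * q) (d + e) := by
  classical
  intro m hm
  rw [MvPolynomial.coeff_mul] at hm
  obtain ⟨x, hx, hx0⟩ := Finset.exists_ne_zero_of_sum_ne_zero hm
  rw [Finset.HasAntidiagonal.mem_antidiagonal] at hx
  rw [← hx, map_add, Nat.cast_add, hp _ (left_ne_zero_of_mul hx0), hq _ (right_ne_zero_of_mul hx0)]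

theorem HomogZ.one {r : ℕ} : HomogZ (1 : MvPolynomial (Fin r) ℤ) 0 := by
  classical
  intro m hm
  rw [MvPolynomial.coeff_one] at hm
  split_ifs at hm with h
  · simp [← h]
  · simp at hm

theorem HomogZ.prod {r : ℕ} {ι : Type*} (s : Finset ι) {p : ι → MvPolynomial (Fin r) ℤ}
    {d : ι → ℤ} (h : ∀ i ∈ s, HomogZ (p i) (d i)) : HomogZ (∏ i ∈ s, p i) (∑ i ∈ s, d i) := by
  classical
  induction s using Finset.induction_on with
  | empty => simpa using HomogZ.one
  | insert a s ha ih =>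
    rw [Finset.prod_insert ha, Finset.sum_insert ha]
    exact (h a (Finset.mem_insert_self _ _)).mul
      (ih fun i hi => h i (Finset.mem_insert_of_mem hi))

theorem HomogZ.sum {r : ℕ} {ι : Type*} (s : Finset ι) {p : ι → MvPolynomial (Fin r) ℤ}
    {d : ℤ} (h : ∀ i ∈ s, HomogZ (p i) d) : HomogZ (∑ i ∈ s, p i) d := by
  intro m hm
  rw [MvPolynomial.coeff_sum] at hm
  obtain ⟨i, hi, hi0⟩ := Finset.exists_ne_zero_of_sum_ne_zero hm
  exact h i hi m hi0

theorem HomogZ.units_smul {r : ℕ} {p : MvPolynomial (Fin r) ℤ} {d : ℤ} (u : ℤˣ)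
    (h : HomogZ p d) : HomogZ (u • p) d := by
  intro m hm
  rw [MvPolynomial.coeff_smul] at hm
  exact h m (fun h0 => hm (by rw [h0, smul_zero]))

theorem HomogZ.hkZ {r : ℕ} (m : ℤ) : HomogZ (hkZ r m) m := by
  rcases lt_or_ge m 0 with h | h
  · intro x hx
    rw [hkZ_of_neg h] at hx
    simp at hx
  · lift m to ℕ using h
    intro x hx
    rw [hkZ_natCast, coeff_hsymm] at hx
    split_ifs at hx with h
    · rw [h]
    · simp at hx

theorem homogZ_schurI {n r : ℕ} (i : Fin r → Fin n) : HomogZ (schurI i) (codimZ n r i) := by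
  unfold schurI codimZ
  rw [Matrix.det_apply]
  apply HomogZ.sum
  intro σ _
  apply HomogZ.units_smul
  have : ∑ a : Fin r, ((n : ℤ) - (r : ℤ) + ((a : ℕ) : ℤ) - ((i a : ℕ) : ℤ))
      = ∑ a : Fin r, ((n : ℤ) - (r : ℤ) + ((a : ℕ) : ℤ) - ((i (σ a) : ℕ) : ℤ)) := by
    rw [Finset.sum_sub_distrib, Finset.sum_sub_distrib,
      Equiv.sum_comp σ (fun a => ((i a : ℕ) : ℤ))]
  rw [this]
  exact HomogZ.prod _ fun a _ => HomogZ.hkZ _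

theorem homogZ_altDet {r : ℕ} (γ : Fin r → ℕ) : HomogZ (altDet r γ) (∑ a, (γ a : ℤ)) := by
  unfold altDet
  rw [Matrix.det_apply]
  apply HomogZ.sum
  intro σ _
  apply HomogZ.units_smul
  rw [← Equiv.sum_comp σ]
  apply HomogZ.prod
  intro i _ m hm
  rw [Matrix.of_apply, MvPolynomial.coeff_X_pow] at hm
  split_ifs at hm with h
  · simp [← h]
  · simp at hm

theorem isSymmetric_hkZ (r : ℕ) (m : ℤ) : (hkZ r m).IsSymmetric := by
  unfold hkZ
  split_ifs
  · exact MvPolynomial.hsymm_isSymmetric _ _ _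
  · exact MvPolynomial.IsSymmetric.zero

theorem isSymmetric_schurI {n r : ℕ} (i : Fin r → Fin n) : (schurI i).IsSymmetric := by
  intro σ
  unfold schurI
  rw [AlgHom.map_det]
  congr 1
  ext1 a b
  exact isSymmetric_hkZ r _ σ

theorem rename_alternant {r : ℕ} (σ : Equiv.Perm (Fin r)) :
    MvPolynomial.rename σ (alternant r) = Equiv.Perm.sign σ • alternant r := by
  unfold alternant
  rw [AlgHom.map_det]
  have := Matrix.det_permute σ (Matrix.of fun a b : Fin r =>
    (MvPolynomial.X a : MvPolynomial (Fin r) ℤ) ^ (r - 1 - (b : ℕ)))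
  rw [Units.smul_def, zsmul_eq_mul, ← this]
  congr 1
  ext1 a b
  simp

theorem alternant_ne_zero (r : ℕ) : alternant r ≠ 0 := by
  intro h
  have hs : StrictAnti (fun b : Fin r => r - 1 - (b : ℕ)) := by
    intro a b hab
    have : (a : ℕ) < b := hab
    have := b.2
    dsimp only
    omega
  have := coeff_altDet hs hs
  rw [← alternant_eq, h] at this
  simp at this

theorem strictAnti_add_le {r : ℕ} {γ : Fin r → ℕ} (hγ : StrictAnti γ) {n : ℕ} (hn : ∀ a, γ a < n)
    (a : Fin r) : γ a + a + 1 ≤ n := by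
  obtain ⟨a, ha⟩ := a
  induction a with
  | zero => simpa using hn _
  | succ a ih =>
    have h1 := ih (by omega)
    have h2 : γ ⟨a + 1, ha⟩ < γ ⟨a, by omega⟩ := hγ (Nat.lt_succ_self a)
    dsimp only at *
    omega

/-- The intersection number of the Schubert classes: the coefficient of the point class. -/
def interNum {n r s : ℕ} (I : Fin s → Fin r → Fin n) : ℤ :=
  MvPolynomial.coeff (expo fun a => n - 1 - a) ((∏ j, schurI (I j)) * alternant r)

theorem prod_schurI_sub_mem {n r s : ℕ} (hrn : r ≤ n) (I : Fin s → Fin r → Fin n)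
    (hcodim : ∑ j : Fin s, codimZ n r (I j) = (r : ℤ) * ((n : ℤ) - (r : ℤ))) :
    (∏ j, schurI (I j)) - interNum I • schurI (fun a : Fin r => Fin.castLE hrn a)
      ∈ grassIdeal r n := by
  classical
  set g := ∏ j, schurI (I j) with hg
  set f := g * alternant r with hf
  have hsym : g.IsSymmetric := by
    rw [hg]
    exact Finset.prod_induction _ MvPolynomial.IsSymmetric (fun _ _ => MvPolynomial.IsSymmetric.mul)
      MvPolynomial.IsSymmetric.one (fun j _ => isSymmetric_schurI (I j))
  let S : Finset (Fin r → ℕ) := (f.support.image (fun m : Fin r →₀ ℕ => (⇑m : Fin r → ℕ))).filter StrictAnti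
  have hS : ∀ γ ∈ S, StrictAnti γ := fun γ h => (Finset.mem_filter.1 h).2
  have anti : ∀ p : MvPolynomial (Fin r) ℤ, p.IsSymmetric → 
      ∀ (σ : Equiv.Perm (Fin r)) (m : Fin r →₀ ℕ),
      MvPolynomial.coeff (m.mapDomain σ) (p * alternant r)
        = Equiv.Perm.sign σ • MvPolynomial.coeff m (p * alternant r) := by
    intro p hp σ m
    have h1 : MvPolynomial.rename σ (p * alternant r) = Equiv.Perm.sign σ • (p * alternant r) := by
      rw [map_mul, hp σ, rename_alternant, mul_smul_comm]
    have h2 := MvPolynomial.coeff_rename_mapDomain σ σ.injective (p * alternant r) m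
    rw [h1, MvPolynomial.coeff_smul] at h2
    rw [← h2, smul_smul, Int.units_mul_self, one_smul]
  have hjsym : ∀ γ, (jtDet r γ).IsSymmetric := by
    intro γ σ
    unfold jtDet
    rw [AlgHom.map_det]
    congr 1
    ext1 a b
    exact isSymmetric_hkZ r _ σ
  have hexp : g = ∑ γ ∈ S, MvPolynomial.coeff (expo γ) f • jtDet r γ := by
    apply mul_right_cancel₀ (alternant_ne_zero r)
    rw [← sub_eq_zero, ← sub_mul]
    apply alternating_eq_sum
    · apply anti
      apply MvPolynomial.IsSymmetric.sub hsym
      refine Finset.sum_induction _ MvPolynomial.IsSymmetric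
        (fun _ _ => MvPolynomial.IsSymmetric.add) MvPolynomial.IsSymmetric.zero ?_
      intro γ _ σ
      rw [map_zsmul, hjsym γ σ]
    · intro δ hδ
      rw [sub_mul, MvPolynomial.coeff_sub, ← hf, Finset.sum_mul, MvPolynomial.coeff_sum]
      simp_rw [smul_mul_assoc, jtDet_mul_alternant, MvPolynomial.coeff_smul]
      rw [sub_eq_zero]
      by_cases h : δ ∈ S
      · rw [Finset.sum_eq_single δ]
        · rw [coeff_altDet hδ hδ]; simp
        · intro γ hγ hne
          rw [coeff_altDet (hS γ hγ) hδ, if_neg hne, smul_zero]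
        · exact fun h' => absurd h h'
      · have h0 : MvPolynomial.coeff (expo δ) f = 0 := by
          by_contra hc
          apply h
          rw [Finset.mem_filter, Finset.mem_image]
          exact ⟨⟨expo δ, MvPolynomial.mem_support_iff.2 hc, rfl⟩, hδ⟩
        rw [h0, Finset.sum_eq_zero]
        intro γ hγ
        rw [coeff_altDet (hS γ hγ) hδ, if_neg, smul_zero]
        rintro rfl
        exact h hγ
  have hhom : HomogZ f ((r : ℤ) * ((n : ℤ) - (r : ℤ)) + ∑ a : Fin r, ((r - 1 - (a : ℕ) : ℕ) : ℤ)) := by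
    rw [hf, alternant_eq]
    refine HomogZ.mul ?_ (homogZ_altDet _)
    rw [← hcodim, hg]
    exact HomogZ.prod _ fun j _ => homogZ_schurI _
  have hγ0 : ∀ γ ∈ S, (∀ a, γ a < n) → γ = fun a : Fin r => n - 1 - (a : ℕ) := by
    intro γ hγ hlt
    have hle := strictAnti_add_le (hS γ hγ) hlt
    obtain ⟨m, hm, hmγ⟩ := Finset.mem_image.1 (Finset.mem_filter.1 hγ).1
    have hd := hhom m (MvPolynomial.mem_support_iff.1 hm)
    have hd2 : ∑ a, (γ a : ℤ) = ∑ a : Fin r, ((n - 1 - (a : ℕ) : ℕ) : ℤ) := by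
      trans ((m.degree : ℕ) : ℤ)
      · rw [Finsupp.degree_eq_sum, ← hmγ]; push_cast; rfl
      · rw [hd]
        have : (r : ℤ) * ((n : ℤ) - r) = ∑ a : Fin r, ((n : ℤ) - r) := by simp [mul_sub]
        rw [this, ← Finset.sum_add_distrib]
        apply Finset.sum_congr rfl
        intro a _
        have := a.2
        omega
    rw [← sub_eq_zero, ← Finset.sum_sub_distrib, Finset.sum_eq_zero_iff_of_nonpos] at hd2
    · ext a
      have := hd2 a (Finset.mem_univ a)
      omega
    · intro a _
      have := hle a
      omega
  have hpt : schurI (fun a : Fin r => Fin.castLE hrn a) = jtDet r fun a => n - 1 - (a : ℕ) := by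
    rw [schurI_eq_jtDet]
    rfl
  have hN : interNum I = MvPolynomial.coeff (expo fun a : Fin r => n - 1 - (a : ℕ)) f := rfl
  rw [hexp, hpt, hN]
  rw [← Finset.sum_filter_add_sum_filter_not S (fun γ => ∀ a, γ a < n), add_sub_right_comm]
  apply add_mem
  · have : S.filter (fun γ => ∀ a, γ a < n) ⊆ {fun a : Fin r => n - 1 - (a : ℕ)} := by
      intro γ hγ
      rw [Finset.mem_singleton]
      exact hγ0 γ (Finset.mem_filter.1 hγ).1 (Finset.mem_filter.1 hγ).2
    rw [Finset.sum_subset this, Finset.sum_singleton, sub_self]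
    · exact zero_mem _
    · intro γ hγ hγ2
      have hst : StrictAnti γ := by
        rw [Finset.mem_singleton.1 hγ]
        intro a b hab
        have : (a : ℕ) < b := hab
        have := b.2
        dsimp only
        omega
      by_cases hc : MvPolynomial.coeff (expo γ) f = 0
      · rw [hc, zero_smul]
      · exfalso
        apply hγ2
        rw [Finset.mem_filter, Finset.mem_filter, Finset.mem_image]
        refine ⟨⟨⟨expo γ, MvPolynomial.mem_support_iff.2 hc, rfl⟩, hst⟩, ?_⟩
        rw [Finset.mem_singleton.1 hγ]
        intro a
        have := a.2
        dsimp only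
        omega
  · apply sum_mem
    intro γ hγ
    have := (Finset.mem_filter.1 hγ).2
    push Not at this
    obtain ⟨a, ha⟩ := this
    exact zsmul_mem (jtDet_mem_grassIdeal hrn ha) _

theorem interNum_ne_zero_of_prod {n r s : ℕ} (hr : 0 < r) (hrn : r ≤ n) (I : Fin s → Fin r → Fin n)
    (h : ∃ c : ℤ, c ≠ 0 ∧ (∏ j : Fin s, omegaCls (I j)) = c • pointCls r n hrn) :
    interNum I ≠ 0 := by
  obtain ⟨c, hc, h⟩ := h
  have hprod : (∏ j : Fin s, omegaCls (I j))
      = Ideal.Quotient.mk (grassIdeal r n) (∏ j, schurI (I j)) := by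
    rw [map_prod]; rfl
  rw [hprod, pointCls, omegaCls, ← map_zsmul, Ideal.Quotient.eq] at h
  have h1 := coeff_mul_alternant_of_mem hr h (μ := fun a : Fin r => n - 1 - (a : ℕ))
    (by intro i; have := i.2; omega)
  rw [sub_mul, MvPolynomial.coeff_sub, smul_mul_assoc, schurI_eq_jtDet, jtDet_mul_alternant,
    MvPolynomial.coeff_smul, sub_eq_zero] at h1
  have hst : StrictAnti fun a : Fin r => n - 1 - (a : ℕ) := by
    intro a b hab
    have : (a : ℕ) < b := hab
    have := b.2
    dsimp only
    omega
  have h2 := coeff_altDet hst hst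
  simp only [Fin.val_castLE] at h1
  rw [h2] at h1
  unfold interNum
  rw [h1]
  simpa using hc

theorem prod_omegaCls_iff {n r s : ℕ} (hr : 0 < r) (hrn : r ≤ n) (I : Fin s → Fin r → Fin n)
    (hcodim : ∑ j : Fin s, codimZ n r (I j) = (r : ℤ) * ((n : ℤ) - (r : ℤ))) :
    (∃ c : ℤ, c ≠ 0 ∧ (∏ j : Fin s, omegaCls (I j)) = c • pointCls r n hrn) ↔ interNum I ≠ 0 := by
  have hprod : (∏ j : Fin s, omegaCls (I j))
      = Ideal.Quotient.mk (grassIdeal r n) (∏ j, schurI (I j)) := by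
    rw [map_prod]; rfl
  constructor
  · exact interNum_ne_zero_of_prod hr hrn I
  · intro h
    refine ⟨interNum I, h, ?_⟩
    rw [hprod, pointCls, omegaCls, ← map_zsmul, Ideal.Quotient.eq]
    exact prod_schurI_sub_mem hrn I hcodim

end

section

section PowerSeriesEuler

variable {ι : Type*}

/-- The Euler operator `x_p ∂/∂x_p` on power series. -/
def eul (p : ι) : MvPowerSeries ι ℝ →ₗ[ℝ] MvPowerSeries ι ℝ where
  toFun f := fun μ => (μ p : ℝ) * MvPowerSeries.coeff μ f
  map_add' f g := by ext μ; simp only [map_add, mul_add]; rfl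
  map_smul' c f := by
    ext μ
    change (μ p : ℝ) * MvPowerSeries.coeff μ (c • f) = c * ((μ p : ℝ) * MvPowerSeries.coeff μ f)
    rw [MvPowerSeries.coeff_smul]; ring

theorem coeff_eul (p : ι) (f : MvPowerSeries ι ℝ) (μ : ι →₀ ℕ) :
    MvPowerSeries.coeff μ (eul p f) = (μ p : ℝ) * MvPowerSeries.coeff μ f := rfl

variable [DecidableEq ι]

theorem eul_mul (p : ι) (f g : MvPowerSeries ι ℝ) :
    eul p (f * g) = eul p f * g + f * eul p g := by
  ext μ
  rw [map_add, coeff_eul, MvPowerSeries.coeff_mul, MvPowerSeries.coeff_mul,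
    MvPowerSeries.coeff_mul, ← Finset.sum_add_distrib, Finset.mul_sum]
  apply Finset.sum_congr rfl
  intro x hx
  rw [Finset.HasAntidiagonal.mem_antidiagonal] at hx
  rw [coeff_eul, coeff_eul, ← hx]
  simp only [Finsupp.add_apply, Nat.cast_add]
  ring

theorem eul_X (p q : ι) : eul p (MvPowerSeries.X q) = if p = q then MvPowerSeries.X q else 0 := by
  ext μ
  rw [coeff_eul, MvPowerSeries.coeff_X]
  split_ifs with h1 h2 h2
  · subst h1 h2; simp [MvPowerSeries.coeff_X]
  · subst h1; rw [Finsupp.single_eq_of_ne h2]; simp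
  · subst h2; simp [MvPowerSeries.coeff_X, h1]
  · simp

theorem eul_one (p : ι) : eul p (1 : MvPowerSeries ι ℝ) = 0 := by
  ext μ
  rw [coeff_eul, MvPowerSeries.coeff_one]
  split_ifs with h
  · simp [h]
  · simp

theorem eul_prod {κ : Type*} [DecidableEq κ] (p : ι) (s : Finset κ) (f : κ → MvPowerSeries ι ℝ) :
    eul p (∏ k ∈ s, f k) = ∑ k ∈ s, (∏ l ∈ s.erase k, f l) * eul p (f k) := by
  induction s using Finset.induction_on with
  | empty => simp [eul_one]
  | insert a s ha ih =>
    rw [Finset.prod_insert ha, eul_mul, ih, Finset.sum_insert ha, Finset.erase_insert ha, mul_comm,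
      Finset.mul_sum]
    congr 1
    apply Finset.sum_congr rfl
    intro k hk
    have hak : a ≠ k := fun h => ha (h ▸ hk)
    rw [Finset.erase_insert_of_ne hak, Finset.prod_insert (by simp [ha]), mul_assoc]

variable {β : Type*} [Fintype β] [DecidableEq β] {r : ℕ}

/-- The pairs of indices in the same block, in increasing order. -/
def posPairs (β : Type*) [Fintype β] [DecidableEq β] (r : ℕ) :
    Finset ((β × Fin r) × (β × Fin r)) :=
  Finset.univ.filter fun x => x.1.1 = x.2.1 ∧ x.1.2 < x.2.2

/-- The product of Vandermonde determinants over the blocks. -/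
def vdm (β : Type*) [Fintype β] [DecidableEq β] (r : ℕ) : MvPowerSeries (β × Fin r) ℝ :=
  ∏ x ∈ posPairs β r, (MvPowerSeries.X x.1 - MvPowerSeries.X x.2)

theorem sum_posPairs {M : Type*} [AddCommMonoid M] (f : β × Fin r → β × Fin r → M) :
    ∑ x ∈ posPairs β r, f x.1 x.2
      = ∑ b, ∑ i, ∑ j ∈ Finset.Ioi i, f (b, i) (b, j) := by
  have h : ∀ x : (β × Fin r) × (β × Fin r), (x.1.1 = x.2.1 ∧ x.1.2 < x.2.2) ↔ 
      (x.2.1 = x.1.1 ∧ x.1.2 < x.2.2) := fun x => by rw [eq_comm]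
  unfold posPairs
  rw [Finset.sum_filter, Fintype.sum_prod_type, Fintype.sum_prod_type]
  apply Finset.sum_congr rfl
  intro b _
  apply Finset.sum_congr rfl
  intro i _
  rw [Fintype.sum_prod_type, Finset.sum_eq_single b]
  · rw [← Finset.filter_lt_eq_Ioi, Finset.sum_filter]
    simp
  · intro c _ hc
    apply Finset.sum_eq_zero
    intro j _
    rw [if_neg]
    exact fun h => hc h.1.symm
  · simp

theorem sum_posPairs_add {M : Type*} [AddCommGroup M] [Module ℝ M] (f : β × Fin r → M) :
    ∑ x ∈ posPairs β r, (f x.1 + f x.2) = ((r : ℝ) - 1) • ∑ p, f p := by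
  rw [sum_posPairs (fun p q => f p + f q), Fintype.sum_prod_type, Finset.smul_sum]
  apply Finset.sum_congr rfl
  intro b _
  simp_rw [Finset.sum_add_distrib, Finset.sum_const, Fin.card_Ioi]
  have : ∑ i : Fin r, ∑ j ∈ Finset.Ioi i, f (b, j) = ∑ j : Fin r, (j : ℕ) • f (b, j) := by
    rw [Finset.sum_comm' (t' := Finset.univ) (s' := fun j => Finset.Iio j) (by simp)]
    simp [Fin.card_Iio]
  rw [this, ← Finset.sum_add_distrib, Finset.smul_sum]
  apply Finset.sum_congr rfl
  intro i _
  rw [← add_smul, ← Nat.cast_smul_eq_nsmul ℝ]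
  congr 1
  have := i.2
  have h2 : r - 1 - (i : ℕ) + i + 1 = r := by omega
  have h3 : ((r - 1 - (i : ℕ) + i : ℕ) : ℝ) + 1 = r := by exact_mod_cast h2
  linarith

theorem sum_eul_vdm_mul (A : MvPowerSeries (β × Fin r) ℝ) :
    ∑ s, eul s (vdm β r) * eul s A = ∑ x ∈ posPairs β r,
      (∏ y ∈ (posPairs β r).erase x, (MvPowerSeries.X y.1 - MvPowerSeries.X y.2 :
        MvPowerSeries (β × Fin r) ℝ)) *
      (MvPowerSeries.X x.1 * eul x.1 A - MvPowerSeries.X x.2 * eul x.2 A) := by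
  unfold vdm
  simp_rw [eul_prod, Finset.sum_mul]
  rw [Finset.sum_comm]
  apply Finset.sum_congr rfl
  intro x _
  simp_rw [mul_assoc]
  rw [← Finset.mul_sum]
  congr 1
  simp_rw [map_sub, eul_X, sub_mul, Finset.sum_sub_distrib, ite_mul, zero_mul]
  simp

theorem laplace_identity (A A' : MvPowerSeries (β × Fin r) ℝ)
    (F : β × Fin r → β × Fin r → MvPowerSeries (β × Fin r) ℝ)
    (hF : ∀ x ∈ posPairs β r, (MvPowerSeries.X x.1 - MvPowerSeries.X x.2) * F x.1 x.2
      = MvPowerSeries.X x.2 * (eul x.1 A - eul x.2 A))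
    (hA : A' = ∑ s, eul s (eul s A) + ∑ x ∈ posPairs β r, (eul x.1 A - eul x.2 A)
      + 2 * ∑ x ∈ posPairs β r, F x.1 x.2 + ((r : ℝ) - 1) • ∑ s, eul s A) :
    ∑ s, eul s (eul s (vdm β r * A)) = vdm β r * A' + (∑ s, eul s (eul s (vdm β r))) * A := by
  have h1 : ∀ s, eul s (eul s (vdm β r * A)) = eul s (eul s (vdm β r)) * A
      + 2 * (eul s (vdm β r) * eul s A) + vdm β r * eul s (eul s A) := by
    intro s
    rw [eul_mul, map_add, eul_mul, eul_mul]
    ring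
  simp_rw [h1, Finset.sum_add_distrib]
  rw [← Finset.mul_sum, sum_eul_vdm_mul, ← Finset.sum_mul, ← Finset.mul_sum, hA,
    ← sum_posPairs_add (fun s => eul s A)]
  have h2 : ∀ x ∈ posPairs β r, vdm β r
      = (∏ y ∈ (posPairs β r).erase x, (MvPowerSeries.X y.1 - MvPowerSeries.X y.2 :
        MvPowerSeries (β × Fin r) ℝ)) * (MvPowerSeries.X x.1 - MvPowerSeries.X x.2) := by
    intro x hx
    unfold vdm
    rw [mul_comm, Finset.mul_prod_erase _ (fun y => (MvPowerSeries.X y.1 - MvPowerSeries.X y.2 :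
        MvPowerSeries (β × Fin r) ℝ)) hx]
  have h3 : 2 * ∑ x ∈ posPairs β r,
      (∏ y ∈ (posPairs β r).erase x, (MvPowerSeries.X y.1 - MvPowerSeries.X y.2 :
        MvPowerSeries (β × Fin r) ℝ)) *
      (MvPowerSeries.X x.1 * eul x.1 A - MvPowerSeries.X x.2 * eul x.2 A)
      = vdm β r * (∑ x ∈ posPairs β r, (eul x.1 A - eul x.2 A)
      + 2 * ∑ x ∈ posPairs β r, F x.1 x.2 + ∑ x ∈ posPairs β r, (eul x.1 A + eul x.2 A)) := by
    rw [Finset.mul_sum, Finset.mul_sum, ← Finset.sum_add_distrib, ← Finset.sum_add_distrib,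
      Finset.mul_sum]
    apply Finset.sum_congr rfl
    intro x hx
    have := hF x hx
    rw [h2 x hx]
    linear_combination (-2 * ∏ y ∈ (posPairs β r).erase x,
      (MvPowerSeries.X y.1 - MvPowerSeries.X y.2 : MvPowerSeries (β × Fin r) ℝ)) * this
  rw [h3]
  ring

/-- The staircase exponent vector permuted by `w` in each block. -/
def rhoW (w : β → Equiv.Perm (Fin r)) : (β × Fin r) →₀ ℕ :=
  Finsupp.equivFunOnFinite.symm fun p => r - 1 - (w p.1 p.2 : ℕ)

theorem prod_posPairs {M : Type*} [CommMonoid M] (f : β × Fin r → β × Fin r → M) :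
    ∏ x ∈ posPairs β r, f x.1 x.2
      = ∏ b, ∏ i, ∏ j ∈ Finset.Ioi i, f (b, i) (b, j) :=
  sum_posPairs (M := Additive M) f

theorem vdm_eq_sum : vdm β r = ∑ w : β → Equiv.Perm (Fin r),
    MvPowerSeries.monomial (rhoW w) (∏ b, ((Equiv.Perm.sign (w b) : ℤ) : ℝ)) := by
  unfold vdm
  rw [prod_posPairs (fun p q => (MvPowerSeries.X p - MvPowerSeries.X q :
    MvPowerSeries (β × Fin r) ℝ))]
  have h1 : ∀ b : β, ∏ i : Fin r, ∏ j ∈ Finset.Ioi i,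
      (MvPowerSeries.X (b, i) - MvPowerSeries.X (b, j) : MvPowerSeries (β × Fin r) ℝ)
      = ∑ w : Equiv.Perm (Fin r), ((Equiv.Perm.sign w : ℤ) : MvPowerSeries (β × Fin r) ℝ) *
        ∏ i, (MvPowerSeries.X (b, i) : MvPowerSeries (β × Fin r) ℝ) ^ (r - 1 - (w i : ℕ)) := by
    intro b
    have h := Matrix.det_projVandermonde (1 : Fin r → MvPowerSeries (β × Fin r) ℝ)
      (fun i => MvPowerSeries.X (b, i))
    simp only [Pi.one_apply, one_mul] at h
    rw [← h, ← Matrix.det_transpose, Matrix.det_apply']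
    apply Finset.sum_congr rfl
    intro w _
    congr 1
    apply Finset.prod_congr rfl
    intro i _
    simp [Matrix.projVandermonde_apply, Fin.val_rev, Nat.sub_sub, add_comm]
  simp_rw [h1]
  rw [Finset.prod_univ_sum]
  simp only [Fintype.piFinset_univ]
  apply Finset.sum_congr rfl
  intro w _
  rw [Finset.prod_mul_distrib]
  have h2 : ∏ b, ∏ i, (MvPowerSeries.X (b, i) : MvPowerSeries (β × Fin r) ℝ) ^ (r - 1 - (w b i : ℕ))
      = MvPowerSeries.monomial (rhoW w) 1 := by
    rw [← Fintype.prod_prod_type' (f := fun b i =>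
      (MvPowerSeries.X (b, i) : MvPowerSeries (β × Fin r) ℝ) ^ (r - 1 - (w b i : ℕ)))]
    simp_rw [MvPowerSeries.X_pow_eq]
    rw [MvPowerSeries.prod_monomial]
    congr 1
    · rw [rhoW, ← Finsupp.univ_sum_single (Finsupp.equivFunOnFinite.symm _)]
      simp
    · simp
  rw [h2]
  ext m
  have h3 : (∏ b, ((Equiv.Perm.sign (w b) : ℤ) : MvPowerSeries (β × Fin r) ℝ))
      = MvPowerSeries.C (∏ b, ((Equiv.Perm.sign (w b) : ℤ) : ℝ)) := by
    simp [map_prod]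
  rw [h3, MvPowerSeries.coeff_C_mul, MvPowerSeries.coeff_monomial, MvPowerSeries.coeff_monomial]
  split_ifs <;> simp

theorem sum_eul_eul_vdm : ∑ s, eul s (eul s (vdm β r))
    = (∑ s : β × Fin r, ((r - 1 - (s.2 : ℕ) : ℕ) : ℝ) ^ 2) • vdm β r := by
  ext m
  rw [map_sum, MvPowerSeries.coeff_smul]
  simp_rw [coeff_eul, ← mul_assoc]
  rw [← Finset.sum_mul]
  by_cases h : MvPowerSeries.coeff m (vdm β r) = 0
  · simp [h]
  · congr 1
    rw [vdm_eq_sum, map_sum] at h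
    obtain ⟨w, _, hw⟩ := Finset.exists_ne_zero_of_sum_ne_zero h
    rw [MvPowerSeries.coeff_monomial] at hw
    split_ifs at hw with hm
    · rw [hm, Fintype.sum_prod_type, Fintype.sum_prod_type]
      apply Finset.sum_congr rfl
      intro b _
      rw [← Equiv.sum_comp (w b) (fun i : Fin r => ((r - 1 - (i : ℕ) : ℕ) : ℝ) ^ 2)]
      apply Finset.sum_congr rfl
      intro i _
      simp [rhoW, sq]
    · simp at hw

theorem coeff_vdm_mul (A : MvPowerSeries (β × Fin r) ℝ) (m : (β × Fin r) →₀ ℕ) :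
    MvPowerSeries.coeff m (vdm β r * A) = ∑ w : β → Equiv.Perm (Fin r),
      (∏ b, ((Equiv.Perm.sign (w b) : ℤ) : ℝ)) *
        if rhoW w ≤ m then MvPowerSeries.coeff (m - rhoW w) A else 0 := by
  rw [vdm_eq_sum, Finset.sum_mul, map_sum]
  apply Finset.sum_congr rfl
  intro w _
  rw [MvPowerSeries.coeff_monomial_mul]
  split_ifs <;> simp

theorem coeff_laplace (A : MvPowerSeries (β × Fin r) ℝ) (A' : MvPowerSeries (β × Fin r) ℝ)
    (h : ∑ s, eul s (eul s (vdm β r * A)) = vdm β r * A' + (∑ s, eul s (eul s (vdm β r))) * A)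
    (m : (β × Fin r) →₀ ℕ) :
    MvPowerSeries.coeff m (vdm β r * A') = (∑ s, (m s : ℝ) ^ 2 -
      ∑ s : β × Fin r, ((r - 1 - (s.2 : ℕ) : ℕ) : ℝ) ^ 2) * MvPowerSeries.coeff m (vdm β r * A) := by
  have h1 := congrArg (MvPowerSeries.coeff m) h
  rw [sum_eul_eul_vdm, map_add, smul_mul_assoc, MvPowerSeries.coeff_smul, map_sum] at h1
  simp_rw [coeff_eul, ← mul_assoc] at h1
  rw [← Finset.sum_mul] at h1
  simp_rw [sq]
  simp only [sq] at h1
  linarith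

end PowerSeriesEuler

end

section

section TraceOn
variable {W : Type*} [AddCommGroup W] [Module ℝ W]

open Classical in
/-- The trace of an endomorphism on an invariant subspace (zero if not invariant). -/
def trOn (U : Submodule ℝ W) (T : Module.End ℝ W) : ℝ :=
  if h : ∀ x ∈ U, T x ∈ U then LinearMap.trace ℝ U (T.restrict h) else 0

theorem trOn_eq {U : Submodule ℝ W} {T : Module.End ℝ W} (h : ∀ x ∈ U, T x ∈ U) :
    trOn U T = LinearMap.trace ℝ U (T.restrict h) := dif_pos h

theorem trOn_add {U : Submodule ℝ W} {S T : Module.End ℝ W} (hS : ∀ x ∈ U, S x ∈ U)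
    (hT : ∀ x ∈ U, T x ∈ U) : trOn U (S + T) = trOn U S + trOn U T := by
  rw [trOn_eq hS, trOn_eq hT, trOn_eq (fun x hx => U.add_mem (hS x hx) (hT x hx)), ← map_add]
  rfl

theorem trOn_smul {U : Submodule ℝ W} (c : ℝ) {T : Module.End ℝ W} (hT : ∀ x ∈ U, T x ∈ U) :
    trOn U (c • T) = c * trOn U T := by
  rw [trOn_eq hT, trOn_eq (fun x hx => U.smul_mem c (hT x hx)), ← smul_eq_mul, ← map_smul]
  rfl

theorem trOn_congr {U : Submodule ℝ W} {S T : Module.End ℝ W} (hT : ∀ x ∈ U, T x ∈ U)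
    (h : ∀ x ∈ U, S x = T x) : trOn U S = trOn U T := by
  have hS : ∀ x ∈ U, S x ∈ U := fun x hx => (h x hx).symm ▸ hT x hx
  rw [trOn_eq hT, trOn_eq hS]
  congr 1
  ext x
  exact h x x.2

theorem trOn_zero_of {U : Submodule ℝ W} {S : Module.End ℝ W} (h : ∀ x ∈ U, S x = 0) :
    trOn U S = 0 := by
  have h0 : ∀ x ∈ U, (0 : Module.End ℝ W) x ∈ U := fun x _ => U.zero_mem
  rw [trOn_congr h0 h, trOn_eq h0]
  exact map_zero _

theorem trOn_sum {U : Submodule ℝ W} {κ : Type*} (s : Finset κ) {T : κ → Module.End ℝ W}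
    (hT : ∀ k ∈ s, ∀ x ∈ U, T k x ∈ U) : trOn U (∑ k ∈ s, T k) = ∑ k ∈ s, trOn U (T k) := by
  classical
  induction s using Finset.induction_on with
  | empty => rw [Finset.sum_empty, Finset.sum_empty]; exact trOn_zero_of (by simp)
  | insert a s ha ih =>
    rw [Finset.sum_insert ha, Finset.sum_insert ha, trOn_add, ih]
    · exact fun k hk => hT k (Finset.mem_insert_of_mem hk)
    · exact hT a (Finset.mem_insert_self _ _)
    · intro x hx
      rw [LinearMap.sum_apply]
      exact U.sum_mem fun k hk => hT k (Finset.mem_insert_of_mem hk) x hx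

theorem trOn_one (U : Submodule ℝ W) [FiniteDimensional ℝ U] :
    trOn U (1 : Module.End ℝ W) = finrank ℝ U := by
  rw [trOn_eq (fun x hx => hx)]
  exact LinearMap.trace_id ℝ U

theorem trOn_cyclic {U V : Submodule ℝ W} [FiniteDimensional ℝ U] [FiniteDimensional ℝ V]
    {R S : Module.End ℝ W} (hR : ∀ x ∈ U, R x ∈ V) (hS : ∀ x ∈ V, S x ∈ U) :
    trOn U (S * R) = trOn V (R * S) := by
  rw [trOn_eq (T := S * R) (fun x hx => hS _ (hR x hx)),
    trOn_eq (T := R * S) (fun x hx => hR _ (hS x hx))]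
  exact LinearMap.trace_comp_comm' (R.restrict hR) (S.restrict hS)

end TraceOn

/-- The joint weight space of commuting operators `E p p`. -/
def jointWt {ι W : Type*} [AddCommGroup W] [Module ℝ W] (E : ι → ι → Module.End ℝ W)
    (μ : ι →₀ ℕ) : Submodule ℝ W := ⨅ p, LinearMap.ker (E p p - (μ p : ℝ) • 1)

theorem mem_jointWt {ι W : Type*} [AddCommGroup W] [Module ℝ W] {E : ι → ι → Module.End ℝ W}
    {μ : ι →₀ ℕ} {v : W} : v ∈ jointWt E μ ↔ ∀ p, E p p v = (μ p : ℝ) • v := by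
  simp [jointWt, sub_eq_zero]

/-- A polynomial, unitarizable representation of a product of general linear Lie algebras. -/
structure GLRep (β : Type*) [Fintype β] [DecidableEq β] (r : ℕ) (W : Type*) [AddCommGroup W]
    [Module ℝ W] where
  E : β × Fin r → β × Fin r → Module.End ℝ W
  comm : ∀ p q s t, p.1 = q.1 → s.1 = t.1 → E p q * E s t - E s t * E p q =
    (if q = s then E p t else 0) - (if t = p then E s q else 0)
  form : W →ₗ[ℝ] W →ₗ[ℝ] ℝ
  nonneg : ∀ v, 0 ≤ form v v
  definite : ∀ v, form v v = 0 → v = 0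
  adj : ∀ p q, p.1 = q.1 → ∀ v w, form (E p q v) w = form v (E q p w)
  fin : ∀ μ, FiniteDimensional ℝ (jointWt E μ)
  kill : ∀ p q, p.1 = q.1 → p ≠ q → ∀ μ : β × Fin r →₀ ℕ, μ q = 0 → ∀ v ∈ jointWt E μ, E p q v = 0

namespace GLRep
variable {β : Type*} [Fintype β] [DecidableEq β] {r : ℕ} {W : Type*} [AddCommGroup W]
    [Module ℝ W] (G : GLRep β r W)

/-- Weight spaces. -/
abbrev wt (μ : β × Fin r →₀ ℕ) : Submodule ℝ W := jointWt G.E μ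

instance (μ : β × Fin r →₀ ℕ) : FiniteDimensional ℝ (G.wt μ) := G.fin μ

theorem E_mem {p q : β × Fin r} (hpq : p.1 = q.1) (μ : β × Fin r →₀ ℕ) {v : W}
    (hv : v ∈ G.wt (μ + Finsupp.single q 1)) : G.E p q v ∈ G.wt (μ + Finsupp.single p 1) := by
  rw [mem_jointWt] at hv ⊢
  intro s
  have h := LinearMap.congr_fun (G.comm s s p q rfl hpq) v
  simp only [LinearMap.sub_apply, Module.End.mul_apply, hv s, map_smul] at h
  rw [sub_eq_iff_eq_add] at h
  rw [h]
  rcases eq_or_ne s p with rfl | h1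
  · rcases eq_or_ne q s with rfl | h2
    · simp
    · simp [h2, add_smul, add_comm]
  · rcases eq_or_ne q s with rfl | h2
    · simp [h1, add_smul]
    · simp [h1, h2]

/-- Endomorphisms commuting with all the operators of the representation. -/
def Comm (T : Module.End ℝ W) : Prop := ∀ p q : β × Fin r, p.1 = q.1 → T * G.E p q = G.E p q * T

variable {G}

theorem Comm.mem {T : Module.End ℝ W} (hT : G.Comm T) {μ : β × Fin r →₀ ℕ} {v : W}
    (hv : v ∈ G.wt μ) : T v ∈ G.wt μ := by
  rw [mem_jointWt] at hv ⊢
  intro p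
  have := LinearMap.congr_fun (hT p p rfl) v
  simp only [Module.End.mul_apply, hv p, map_smul] at this
  exact this.symm

theorem Comm.mul {S T : Module.End ℝ W} (hS : G.Comm S) (hT : G.Comm T) : G.Comm (S * T) := by
  intro p q h
  rw [mul_assoc, hT p q h, ← mul_assoc, hS p q h, mul_assoc]

theorem Comm.one : G.Comm 1 := fun p q _ => by rw [one_mul, mul_one]

theorem Comm.add {S T : Module.End ℝ W} (hS : G.Comm S) (hT : G.Comm T) : G.Comm (S + T) := by
  intro p q h
  rw [add_mul, mul_add, hS p q h, hT p q h]

theorem Comm.smul {T : Module.End ℝ W} (c : ℝ) (hT : G.Comm T) : G.Comm (c • T) := by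
  intro p q h
  rw [smul_mul_assoc, mul_smul_comm, hT p q h]

theorem Comm.pow {T : Module.End ℝ W} (hT : G.Comm T) (n : ℕ) : G.Comm (T ^ n) := by
  induction n with
  | zero => rw [pow_zero]; exact Comm.one
  | succ n ih => rw [pow_succ]; exact ih.mul hT

theorem Comm.aeval {T : Module.End ℝ W} (hT : G.Comm T) (f : Polynomial ℝ) :
    G.Comm (Polynomial.aeval T f) := by
  induction f using Polynomial.induction_on' with
  | add f g hf hg => rw [map_add]; exact hf.add hg
  | monomial n a =>
    rw [Polynomial.aeval_monomial, Algebra.algebraMap_eq_smul_one, smul_mul_assoc, one_mul]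
    exact (hT.pow n).smul a

theorem EE_mem {p q : β × Fin r} (hpq : p.1 = q.1) (hne : p ≠ q) {μ : β × Fin r →₀ ℕ} {v : W}
    (hv : v ∈ G.wt μ) : (G.E q p * G.E p q) v ∈ G.wt μ := by
  rw [Module.End.mul_apply]
  by_cases h : μ q = 0
  · rw [G.kill p q hpq hne μ h v hv, map_zero]
    exact zero_mem _
  · obtain ⟨ν, rfl⟩ : ∃ ν, μ = ν + Finsupp.single q 1 := by
      refine ⟨μ - Finsupp.single q 1, (tsub_add_cancel_of_le ?_).symm⟩
      rw [Finsupp.single_le_iff]; omega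
    exact G.E_mem hpq.symm _ (G.E_mem hpq _ hv)

variable (G) in
/-- The generating series of traces of `T` on weight spaces. -/
def trSer (T : Module.End ℝ W) : MvPowerSeries (β × Fin r) ℝ := fun μ => trOn (G.wt μ) T

theorem coeff_trSer (T : Module.End ℝ W) (μ : β × Fin r →₀ ℕ) :
    MvPowerSeries.coeff μ (G.trSer T) = trOn (G.wt μ) T := rfl

theorem trOn_shift {T : Module.End ℝ W} (hT : G.Comm T) {p q : β × Fin r} (hpq : p.1 = q.1)
    (μ : β × Fin r →₀ ℕ) :
    trOn (G.wt (μ + Finsupp.single q 1)) (T * (G.E q p * G.E p q))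
      = trOn (G.wt (μ + Finsupp.single p 1)) (T * (G.E p q * G.E q p)) := by
  rw [← mul_assoc, trOn_cyclic (U := G.wt (μ + Finsupp.single q 1))
    (V := G.wt (μ + Finsupp.single p 1))]
  · rw [← mul_assoc, ← hT p q hpq, mul_assoc]
  · exact fun x hx => G.E_mem hpq _ hx
  · intro x hx
    rw [Module.End.mul_apply]
    exact hT.mem (G.E_mem hpq.symm _ hx)

theorem trOn_swap {T : Module.End ℝ W} (hT : G.Comm T) {p q : β × Fin r} (hpq : p.1 = q.1)
    (hne : p ≠ q) (μ : β × Fin r →₀ ℕ) :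
    trOn (G.wt μ) (T * (G.E p q * G.E q p))
      = trOn (G.wt μ) (T * (G.E q p * G.E p q)) + ((μ p : ℝ) - μ q) * trOn (G.wt μ) T := by
  have h1 : ∀ x ∈ G.wt μ, T x ∈ G.wt μ := fun x hx => hT.mem hx
  have h2 : ∀ x ∈ G.wt μ, (T * (G.E q p * G.E p q)) x ∈ G.wt μ := fun x hx =>
    hT.mem (EE_mem hpq hne hx)
  rw [← trOn_smul _ h1, ← trOn_add h2 (fun x hx => (G.wt μ).smul_mem _ (h1 x hx))]
  apply trOn_congr (fun x hx => add_mem (h2 x hx) ((G.wt μ).smul_mem _ (h1 x hx)))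
  intro x hx
  have h := LinearMap.congr_fun (G.comm p q q p hpq hpq.symm) x
  rw [mem_jointWt] at hx
  simp only [if_true, LinearMap.sub_apply, Module.End.mul_apply, hx] at h
  rw [sub_eq_iff_eq_add] at h
  rw [LinearMap.add_apply, LinearMap.smul_apply]
  simp only [Module.End.mul_apply, h, map_add, map_sub, map_smul, sub_smul]
  abel

theorem X_sub_mul_trSer {T : Module.End ℝ W} (hT : G.Comm T) {p q : β × Fin r} (hpq : p.1 = q.1)
    (hne : p ≠ q) :
    (MvPowerSeries.X p - MvPowerSeries.X q) * G.trSer (T * (G.E q p * G.E p q))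
      = MvPowerSeries.X q * (eul p (G.trSer T) - eul q (G.trSer T)) := by
  ext κ
  rw [sub_mul, map_sub, MvPowerSeries.X_def, MvPowerSeries.X_def]
  simp only [MvPowerSeries.coeff_monomial_mul, one_mul, map_sub, coeff_eul, coeff_trSer,
    Finsupp.single_le_iff]
  by_cases hp : 1 ≤ κ p
  · by_cases hq : 1 ≤ κ q
    · rw [if_pos hp, if_pos hq, if_pos hq]
      obtain ⟨μ, rfl⟩ : ∃ μ, κ = μ + Finsupp.single p 1 + Finsupp.single q 1 := by
        refine ⟨κ - Finsupp.single q 1 - Finsupp.single p 1, ?_⟩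
        rw [tsub_add_cancel_of_le, tsub_add_cancel_of_le]
        · rwa [Finsupp.single_le_iff]
        · rw [Finsupp.single_le_iff, Finsupp.tsub_apply, Finsupp.single_eq_of_ne hne]
          exact hp
      rw [add_tsub_cancel_right, add_right_comm, add_tsub_cancel_right, trOn_shift hT hpq,
        trOn_swap hT hpq hne]
      ring
    · rw [if_pos hp, if_neg hq, if_neg hq, sub_zero]
      apply trOn_zero_of
      intro x hx
      rw [Module.End.mul_apply, Module.End.mul_apply, G.kill p q hpq hne _ _ x hx, map_zero,
        map_zero]
      rw [Finsupp.tsub_apply]; omega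
  · by_cases hq : 1 ≤ κ q
    · rw [if_neg hp, if_pos hq, if_pos hq]
      have h := trOn_swap hT hpq hne (κ - Finsupp.single q 1)
      rw [trOn_zero_of (S := T * (G.E p q * G.E q p))] at h
      · linarith
      · intro x hx
        rw [Module.End.mul_apply, Module.End.mul_apply, G.kill q p hpq.symm hne.symm _ _ x hx,
          map_zero, map_zero]
        rw [Finsupp.tsub_apply]; omega
    · rw [if_neg hp, if_neg hq, if_neg hq, sub_zero]

variable (G) in
/-- The (shifted) Casimir operator. -/
def cas : Module.End ℝ W := ∑ p, G.E p p * G.E p p +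
  ∑ x ∈ posPairs β r, (G.E x.1 x.2 * G.E x.2 x.1 + G.E x.2 x.1 * G.E x.1 x.2)
    + ((r : ℝ) - 1) • ∑ p, G.E p p

theorem cas_eq : G.cas = (∑ p, ∑ q, if p.1 = q.1 then G.E p q * G.E q p else 0)
    + ((r : ℝ) - 1) • ∑ p, G.E p p := by
  unfold cas
  congr 1
  rw [sum_posPairs (fun p q => G.E p q * G.E q p + G.E q p * G.E p q)]
  simp_rw [Fintype.sum_prod_type]
  rw [← Finset.sum_add_distrib]
  apply Finset.sum_congr rfl
  intro b _
  have := Finset.sum_sum_Ioi_add_eq_sum_sum_off_diag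
    (fun i j : Fin r => G.E (b, j) (b, i) * G.E (b, i) (b, j))
  have h2 : ∀ i : Fin r, (∑ b' : β, ∑ j : Fin r,
      if b = b' then G.E (b, i) (b', j) * G.E (b', j) (b, i) else 0)
      = ∑ j : Fin r, G.E (b, i) (b, j) * G.E (b, j) (b, i) := by
    intro i
    rw [Finset.sum_eq_single b]
    · simp
    · intro b' _ hb
      simp [hb.symm]
    · simp
  rw [Finset.sum_congr rfl fun i _ => h2 i]
  rw [Finset.sum_congr rfl fun i _ => Fintype.sum_eq_add_sum_compl i
    (fun j => G.E (b, i) (b, j) * G.E (b, j) (b, i)), Finset.sum_add_distrib, this]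

theorem cas_comm : G.Comm G.cas := by
  intro s t hst
  rw [cas_eq]
  have key : ∀ p q : β × Fin r, (if p.1 = q.1 then G.E p q * G.E q p else 0) * G.E s t
      - G.E s t * (if p.1 = q.1 then G.E p q * G.E q p else 0)
      = (if p = s then (if s.1 = q.1 then G.E s q * G.E q t else 0) else 0)
      - (if q = t then (if p.1 = t.1 then G.E p t * G.E s p else 0) else 0)
      + (if q = s then (if p.1 = s.1 then G.E p t * G.E s p else 0) else 0)
      - (if p = t then (if t.1 = q.1 then G.E s q * G.E q t else 0) else 0) := by
    intro p q
    by_cases hpq : p.1 = q.1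
    · have e : G.E p q * G.E q p * G.E s t - G.E s t * (G.E p q * G.E q p)
          = G.E p q * (G.E q p * G.E s t - G.E s t * G.E q p)
            + (G.E p q * G.E s t - G.E s t * G.E p q) * G.E q p := by noncomm_ring
      rw [if_pos hpq, e, G.comm q p s t hpq.symm hst, G.comm p q s t hpq hst]
      simp only [eq_comm (a := t), mul_sub, sub_mul, mul_ite, ite_mul, mul_zero, zero_mul,
        add_sub_assoc]
      congr 1 <;> congr 1
      · split_ifs with h1 h2
        · rw [h1]
        · exact absurd (h1 ▸ hpq) h2
        · rfl
      · split_ifs with h1 h2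
        · rw [h1]
        · exact absurd (h1 ▸ hpq) h2
        · rfl
      · split_ifs with h1 h2
        · rw [h1]
        · exact absurd (h1 ▸ hpq) h2
        · rfl
      · split_ifs with h1 h2
        · rw [h1]
        · exact absurd (h1 ▸ hpq) h2
        · rfl
    · rw [if_neg hpq]
      by_cases h1 : p = s <;> by_cases h2 : q = t <;> by_cases h3 : q = s <;>
        by_cases h4 : p = t <;> simp_all
  have key2 : ∀ p : β × Fin r, G.E p p * G.E s t - G.E s t * G.E p p
      = (if p = s then G.E s t else 0) - (if p = t then G.E s t else 0) := by
    intro p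
    rw [G.comm p p s t rfl hst]
    simp only [eq_comm (a := t)]
    congr 1
    · split_ifs with h1
      · rw [h1]
      · rfl
    · split_ifs with h1
      · rw [h1]
      · rfl
  have aux1 : ∀ (s : β × Fin r) (g : β × Fin r → Module.End ℝ W),
      (∑ p, ∑ q, if p = s then g q else 0) = ∑ q, g q := fun s g => by
    rw [Finset.sum_comm]
    simp
  have aux2 : ∀ (s : β × Fin r) (g : β × Fin r → Module.End ℝ W),
      (∑ p, ∑ q, if q = s then g p else 0) = ∑ q, g q := fun s g => by simp
  have h1 : (∑ p, ∑ q, if p.1 = q.1 then G.E p q * G.E q p else 0) * G.E s t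
      - G.E s t * (∑ p, ∑ q, if p.1 = q.1 then G.E p q * G.E q p else 0) = 0 := by
    rw [Finset.sum_mul, Finset.mul_sum, ← Finset.sum_sub_distrib]
    rw [Finset.sum_congr rfl fun p _ => by
      rw [Finset.sum_mul, Finset.mul_sum, ← Finset.sum_sub_distrib,
        Finset.sum_congr rfl fun q _ => key p q, Finset.sum_sub_distrib, Finset.sum_add_distrib,
        Finset.sum_sub_distrib]]
    rw [Finset.sum_sub_distrib, Finset.sum_add_distrib, Finset.sum_sub_distrib, aux1, aux1, aux2,
      aux2]
    simp only [hst]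
    abel
  have h2 : (∑ p, G.E p p) * G.E s t - G.E s t * ∑ p, G.E p p = 0 := by
    rw [Finset.sum_mul, Finset.mul_sum, ← Finset.sum_sub_distrib,
      Finset.sum_congr rfl fun p _ => key2 p, Finset.sum_sub_distrib, Finset.sum_ite_eq',
      Finset.sum_ite_eq', if_pos (Finset.mem_univ _), if_pos (Finset.mem_univ _), sub_self]
  rw [← sub_eq_zero, add_mul, mul_add, add_sub_add_comm, smul_mul_assoc, mul_smul_comm,
    ← smul_sub, h1, h2, smul_zero, add_zero]

theorem cas_scalar (μ : β × Fin r →₀ ℕ) : (∑ s, ((μ s : ℝ) + ((r - 1 - s.2 : ℕ) : ℝ)) ^ 2)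
      - ∑ s : β × Fin r, ((r - 1 - s.2 : ℕ) : ℝ) ^ 2 = ∑ p, (μ p : ℝ) * μ p +
      (∑ x ∈ posPairs β r, ((μ x.1 : ℝ) - μ x.2) + ((r : ℝ) - 1) * ∑ p, (μ p : ℝ)) := by
  have h2 : ∑ x ∈ posPairs β r, ((μ x.1 : ℝ) - μ x.2) + ((r : ℝ) - 1) * ∑ p, (μ p : ℝ)
      = 2 * ∑ p : β × Fin r, (μ p : ℝ) * ((r - 1 - p.2 : ℕ) : ℝ) := by
    have h3 := sum_posPairs_add (r := r) (fun p : β × Fin r => (μ p : ℝ))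
    rw [smul_eq_mul] at h3
    rw [← h3, ← Finset.sum_add_distrib]
    have h4 := sum_posPairs (r := r) (fun (p _ : β × Fin r) => 2 * (μ p : ℝ))
    rw [Finset.sum_congr rfl fun x _ => show ((μ x.1 : ℝ) - μ x.2) + (μ x.1 + μ x.2)
      = 2 * (μ x.1 : ℝ) by ring, h4, Fintype.sum_prod_type, Finset.mul_sum]
    refine Finset.sum_congr rfl fun b _ => ?_
    rw [Finset.mul_sum]
    refine Finset.sum_congr rfl fun i _ => ?_
    rw [Finset.sum_const, Fin.card_Ioi, nsmul_eq_mul]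
    ring
  rw [h2, Finset.mul_sum, ← Finset.sum_add_distrib, ← Finset.sum_sub_distrib]
  exact Finset.sum_congr rfl fun p _ => by ring

theorem cas_apply {μ : β × Fin r →₀ ℕ} {v : W} (hv : v ∈ G.wt μ) :
    G.cas v = ((∑ s, ((μ s : ℝ) + ((r - 1 - s.2 : ℕ) : ℝ)) ^ 2)
        - ∑ s : β × Fin r, ((r - 1 - s.2 : ℕ) : ℝ) ^ 2) • v
      + (2 : ℝ) • ∑ x ∈ posPairs β r, G.E x.2 x.1 (G.E x.1 x.2 v) := by
  rw [mem_jointWt] at hv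
  have h1 : ∀ x ∈ posPairs β r, (G.E x.1 x.2 * G.E x.2 x.1 + G.E x.2 x.1 * G.E x.1 x.2) v
      = ((μ x.1 : ℝ) - μ x.2) • v + (2 : ℝ) • G.E x.2 x.1 (G.E x.1 x.2 v) := by
    intro x hx
    have hx1 : x.1.1 = x.2.1 := ((Finset.mem_filter.1 hx).2).1
    have h := LinearMap.congr_fun (G.comm x.1 x.2 x.2 x.1 hx1 hx1.symm) v
    simp only [if_true, LinearMap.sub_apply, Module.End.mul_apply, hv] at h
    rw [sub_eq_iff_eq_add] at h
    rw [LinearMap.add_apply, Module.End.mul_apply, Module.End.mul_apply, h, two_smul, sub_smul]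
    abel
  unfold cas
  rw [LinearMap.add_apply, LinearMap.add_apply, LinearMap.smul_apply, LinearMap.sum_apply,
    LinearMap.sum_apply, LinearMap.sum_apply, Finset.sum_congr rfl h1, Finset.sum_add_distrib,
    ← Finset.sum_smul, ← Finset.smul_sum]
  simp only [Module.End.mul_apply, hv, map_smul, smul_smul, ← Finset.sum_smul]
  rw [cas_scalar, add_smul, add_smul]
  abel

end GLRep

end

section

namespace GLRep
variable {β : Type*} [Fintype β] [DecidableEq β] {r : ℕ} {W : Type*} [AddCommGroup W]
    [Module ℝ W] {G : GLRep β r W}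

theorem posPairs_fst {x : (β × Fin r) × (β × Fin r)} (hx : x ∈ posPairs β r) : x.1.1 = x.2.1 :=
  ((Finset.mem_filter.1 hx).2).1

theorem posPairs_ne {x : (β × Fin r) × (β × Fin r)} (hx : x ∈ posPairs β r) : x.1 ≠ x.2 :=
  fun h => ((Finset.mem_filter.1 hx).2).2.ne (congrArg Prod.snd h)

theorem trSer_cas_mul {T : Module.End ℝ W} (hT : G.Comm T) :
    G.trSer (G.cas * T) = ∑ s, eul s (eul s (G.trSer T))
      + ∑ x ∈ posPairs β r, (eul x.1 (G.trSer T) - eul x.2 (G.trSer T))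
      + 2 * ∑ x ∈ posPairs β r, G.trSer (T * (G.E x.2 x.1 * G.E x.1 x.2))
      + ((r : ℝ) - 1) • ∑ s, eul s (G.trSer T) := by
  ext μ
  have h2 : ∀ x ∈ posPairs β r, ∀ v ∈ G.wt μ, (T * (G.E x.2 x.1 * G.E x.1 x.2)) v ∈ G.wt μ :=
    fun x hx v hv => hT.mem (EE_mem (posPairs_fst hx) (posPairs_ne hx) hv)
  have h1 : ∀ v ∈ G.wt μ, T v ∈ G.wt μ := fun v hv => hT.mem hv
  have h3 : ∀ v ∈ G.wt μ, (∑ x ∈ posPairs β r, T * (G.E x.2 x.1 * G.E x.1 x.2)) v ∈ G.wt μ := by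
    intro v hv
    rw [LinearMap.sum_apply]
    exact sum_mem fun x hx => h2 x hx v hv
  set c := (∑ s, ((μ s : ℝ) + ((r - 1 - s.2 : ℕ) : ℝ)) ^ 2)
        - ∑ s : β × Fin r, ((r - 1 - s.2 : ℕ) : ℝ) ^ 2 with hc
  have h4 : trOn (G.wt μ) (G.cas * T) = c * trOn (G.wt μ) T
      + 2 * ∑ x ∈ posPairs β r, trOn (G.wt μ) (T * (G.E x.2 x.1 * G.E x.1 x.2)) := by
    have h5 : ∀ v ∈ G.wt μ, (c • T) v ∈ G.wt μ := fun v hv => (G.wt μ).smul_mem _ (h1 v hv)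
    have h6 : ∀ v ∈ G.wt μ, ((2 : ℝ) • ∑ x ∈ posPairs β r, T * (G.E x.2 x.1 * G.E x.1 x.2)) v
        ∈ G.wt μ := fun v hv => (G.wt μ).smul_mem _ (h3 v hv)
    rw [← trOn_sum _ h2, ← trOn_smul _ h1, ← trOn_smul _ h3, ← trOn_add h5 h6]
    apply trOn_congr (fun v hv => add_mem (h5 v hv) (h6 v hv))
    intro v hv
    rw [Module.End.mul_apply, cas_apply (h1 v hv), LinearMap.add_apply, LinearMap.smul_apply,
      LinearMap.smul_apply, LinearMap.sum_apply]
    congr 2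
    apply Finset.sum_congr rfl
    intro x hx
    have e1 := LinearMap.congr_fun (hT _ _ (posPairs_fst hx)) v
    have e2 := LinearMap.congr_fun (hT _ _ (posPairs_fst hx).symm) (G.E x.1 x.2 v)
    simp only [Module.End.mul_apply] at e1 e2 ⊢
    rw [← e1, ← e2]
  have h7 : (2 : MvPowerSeries (β × Fin r) ℝ) * ∑ x ∈ posPairs β r,
      G.trSer (T * (G.E x.2 x.1 * G.E x.1 x.2))
      = (2 : ℝ) • ∑ x ∈ posPairs β r, G.trSer (T * (G.E x.2 x.1 * G.E x.1 x.2)) := by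
    rw [two_mul, two_smul]
  rw [h7, coeff_trSer, h4, hc, cas_scalar]
  simp only [map_add, map_sum, map_sub, coeff_eul, MvPowerSeries.coeff_smul, coeff_trSer]
  simp only [← Finset.sum_mul, ← sub_mul, ← mul_assoc]
  ring

variable (G) in
/-- The coefficient of the product of the Vandermonde and the trace series. -/
def alt (m : β × Fin r →₀ ℕ) (T : Module.End ℝ W) : ℝ :=
  MvPowerSeries.coeff m (vdm β r * G.trSer T)

theorem alt_eq (m : β × Fin r →₀ ℕ) (T : Module.End ℝ W) :
    G.alt m T = ∑ w : β → Equiv.Perm (Fin r), (∏ b, ((Equiv.Perm.sign (w b) : ℤ) : ℝ)) *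
        if rhoW w ≤ m then trOn (G.wt (m - rhoW w)) T else 0 := coeff_vdm_mul _ _

theorem alt_cas_mul (m : β × Fin r →₀ ℕ) {T : Module.End ℝ W} (hT : G.Comm T) :
    G.alt m (G.cas * T) = (∑ s, (m s : ℝ) ^ 2 -
      ∑ s : β × Fin r, ((r - 1 - (s.2 : ℕ) : ℕ) : ℝ) ^ 2) * G.alt m T :=
  coeff_laplace _ _ (laplace_identity _ _ (fun p q => G.trSer (T * (G.E q p * G.E p q)))
    (fun _ hx => X_sub_mul_trSer hT (posPairs_fst hx) (posPairs_ne hx)) (trSer_cas_mul hT)) _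

theorem alt_add (m : β × Fin r →₀ ℕ) {S T : Module.End ℝ W} (hS : G.Comm S) (hT : G.Comm T) :
    G.alt m (S + T) = G.alt m S + G.alt m T := by
  simp only [alt]
  rw [← map_add, ← mul_add]
  congr 2
  ext μ
  exact trOn_add (fun x hx => hS.mem hx) (fun x hx => hT.mem hx)

theorem alt_smul (m : β × Fin r →₀ ℕ) (c : ℝ) {T : Module.End ℝ W} (hT : G.Comm T) :
    G.alt m (c • T) = c * G.alt m T := by
  simp only [alt]
  rw [← MvPowerSeries.coeff_smul, ← mul_smul_comm]
  congr 2
  ext μ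
  exact trOn_smul _ (fun x hx => hT.mem hx)

theorem alt_aeval (m : β × Fin r →₀ ℕ) (f : Polynomial ℝ) :
    G.alt m (Polynomial.aeval G.cas f) = f.eval (∑ s, (m s : ℝ) ^ 2 -
      ∑ s : β × Fin r, ((r - 1 - (s.2 : ℕ) : ℕ) : ℝ) ^ 2) * G.alt m 1 := by
  induction f using Polynomial.induction_on' with
  | add f g hf hg =>
    rw [map_add, alt_add m (cas_comm.aeval f) (cas_comm.aeval g), hf, hg, Polynomial.eval_add,
      add_mul]
  | monomial n a =>
    rw [Polynomial.aeval_monomial, Algebra.algebraMap_eq_smul_one, smul_mul_assoc, one_mul,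
      alt_smul m a (cas_comm.pow n), Polynomial.eval_monomial, mul_assoc]
    congr 1
    induction n with
    | zero => simp
    | succ n ih => rw [pow_succ', alt_cas_mul m (cas_comm.pow n), ih, pow_succ']; ring

theorem exists_poly {T : Module.End ℝ W} {U : Submodule ℝ W} [FiniteDimensional ℝ U]
    (hU : ∀ v ∈ U, T v ∈ U) (c : ℝ)
    (h : ∀ v ∈ U, (T - c • 1) ((T - c • 1) v) = 0 → (T - c • 1) v = 0) :
    ∃ f : Polynomial ℝ, f.eval c ≠ 0 ∧ ∀ v ∈ U, (T - c • 1) (Polynomial.aeval T f v) = 0 := by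
  have hres : ∀ (f : Polynomial ℝ) (v : U),
      ((Polynomial.aeval (T.restrict hU) f v : U) : W) = Polynomial.aeval T f v := by
    intro f
    induction f using Polynomial.induction_on' with
    | add f g hf hg => intro v; simp [hf, hg]
    | monomial n a =>
      intro v
      rw [Polynomial.aeval_monomial, Polynomial.aeval_monomial, Algebra.algebraMap_eq_smul_one,
        Algebra.algebraMap_eq_smul_one, smul_mul_assoc, one_mul, smul_mul_assoc, one_mul,
        LinearMap.smul_apply, LinearMap.smul_apply, Submodule.coe_smul]
      congr 1
      induction n with
      | zero => rfl
      | succ n ih => rw [pow_succ', pow_succ', Module.End.mul_apply, Module.End.mul_apply, ← ih]; rfl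
  set g := minpoly ℝ (T.restrict hU)
  have hg0 : g ≠ 0 := minpoly.ne_zero (Algebra.IsIntegral.isIntegral _)
  obtain ⟨f, hf, hnd⟩ := g.exists_eq_pow_rootMultiplicity_mul_and_not_dvd hg0 c
  refine ⟨f, fun h0 => hnd (Polynomial.dvd_iff_isRoot.2 h0), fun v hv => ?_⟩
  have hfU : Polynomial.aeval T f v ∈ U := by rw [← hres f ⟨v, hv⟩]; exact Subtype.coe_prop _
  have hsub : ∀ u ∈ U, (T - c • 1) u ∈ U := fun u hu => sub_mem (hU u hu) (U.smul_mem c hu)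
  have key : ∀ (k : ℕ) (u : W), u ∈ U → ((T - c • 1) ^ k) u = 0 → (T - c • 1) u = 0 := by
    intro k
    induction k with
    | zero => intro u _ h0; rw [pow_zero, Module.End.one_apply] at h0; rw [h0, map_zero]
    | succ k ih =>
      intro u hu h0
      rw [pow_succ, Module.End.mul_apply] at h0
      exact h u hu (ih _ (hsub u hu) h0)
  apply key (g.rootMultiplicity c) _ hfU
  have h1 : Polynomial.aeval T g v = 0 := by
    rw [← hres g ⟨v, hv⟩, minpoly.aeval]; rfl
  rw [hf, map_mul, map_pow, map_sub, Polynomial.aeval_X, Polynomial.aeval_C,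
    Algebra.algebraMap_eq_smul_one, Module.End.mul_apply] at h1
  exact h1

theorem cas_adj (v w : W) : G.form (G.cas v) w = G.form v (G.cas w) := by
  rw [cas_eq]
  have h1 : ∀ p, G.form (G.E p p v) w = G.form v (G.E p p w) := fun p => G.adj p p rfl v w
  have h2 : ∀ p q, G.form ((if p.1 = q.1 then G.E p q * G.E q p else 0 : Module.End ℝ W) v) w
      = G.form v ((if p.1 = q.1 then G.E p q * G.E q p else 0 : Module.End ℝ W) w) := by
    intro p q
    split_ifs with h
    · rw [Module.End.mul_apply, Module.End.mul_apply, G.adj p q h, G.adj q p h.symm]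
    · simp
  simp only [LinearMap.add_apply, LinearMap.smul_apply, LinearMap.sum_apply, map_add, map_smul,
    map_sum, h1, h2]

theorem cas_sub_sq (c : ℝ) (v : W) (h : (G.cas - c • 1) ((G.cas - c • 1) v) = 0) :
    (G.cas - c • 1) v = 0 := by
  apply G.definite
  have : ∀ x y, G.form ((G.cas - c • 1) x) y = G.form x ((G.cas - c • 1) y) := by
    intro x y
    simp [cas_adj]
  rw [this, h, map_zero]

/-- Highest weight vectors. -/
def HW (G : GLRep β r W) (lam : β × Fin r →₀ ℕ) : Submodule ℝ W :=
  G.wt lam ⊓ ⨅ x ∈ posPairs β r, LinearMap.ker (G.E x.1 x.2)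

theorem mem_HW {lam : β × Fin r →₀ ℕ} {v : W} : v ∈ G.HW lam ↔
    v ∈ G.wt lam ∧ ∀ x ∈ posPairs β r, G.E x.1 x.2 v = 0 := by
  simp only [HW, Submodule.mem_inf, Submodule.mem_iInf, LinearMap.mem_ker]

theorem eigen_eq {μ : β × Fin r →₀ ℕ} {v : W} (hv : v ∈ G.wt μ) {c : ℝ} (h : G.cas v = c • v) :
    (((∑ s, ((μ s : ℝ) + ((r - 1 - s.2 : ℕ) : ℝ)) ^ 2)
        - ∑ s : β × Fin r, ((r - 1 - s.2 : ℕ) : ℝ) ^ 2) - c) * G.form v v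
      + 2 * ∑ x ∈ posPairs β r, G.form (G.E x.1 x.2 v) (G.E x.1 x.2 v) = 0 := by
  have h1 := congrArg (G.form v) (cas_apply hv)
  rw [h, map_add, map_smul, map_smul, map_smul, map_sum] at h1
  rw [Finset.sum_congr rfl fun x hx => (G.adj x.1 x.2 (posPairs_fst hx) v _)]
  simp only [smul_eq_mul] at h1
  linarith

theorem aeval_apply_of_eigen {T : Module.End ℝ W} {c : ℝ} {v : W} (h : T v = c • v)
    (f : Polynomial ℝ) : Polynomial.aeval T f v = f.eval c • v := by
  induction f using Polynomial.induction_on' with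
  | add f g hf hg => rw [map_add, LinearMap.add_apply, hf, hg, Polynomial.eval_add, add_smul]
  | monomial n a =>
    rw [Polynomial.aeval_monomial, Algebra.algebraMap_eq_smul_one, smul_mul_assoc, one_mul,
      LinearMap.smul_apply, Polynomial.eval_monomial, mul_smul]
    congr 1
    induction n with
    | zero => simp
    | succ n ih => rw [pow_succ', Module.End.mul_apply, ih, map_smul, h, smul_smul, pow_succ]

theorem rhoW_pos {m : β × Fin r →₀ ℕ} (hm : ∀ b, Antitone fun i => m (b, i))
    {w : β → Equiv.Perm (Fin r)} (hw : w ≠ 1) (hle : rhoW w ≤ m) :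
    0 < (∑ s, (((m - rhoW w) s : ℝ) + ((r - 1 - s.2 : ℕ) : ℝ)) ^ 2)
        - ∑ s : β × Fin r, ((r - 1 - s.2 : ℕ) : ℝ) ^ 2 -
        (∑ s, (m s : ℝ) ^ 2 - ∑ s : β × Fin r, ((r - 1 - (s.2 : ℕ) : ℕ) : ℝ) ^ 2) := by
  have h1 : ∀ s : β × Fin r, (((m - rhoW w) s : ℕ) : ℝ)
      = m s - ((r - 1 - (w s.1 s.2 : ℕ) : ℕ) : ℝ) := by
    intro s
    rw [Finsupp.tsub_apply, Nat.cast_sub (hle s)]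
    rfl
  have h2 : 0 ≤ ∑ s : β × Fin r, (m s : ℝ) * (((r - 1 - (s.2 : ℕ) : ℕ) : ℝ)
      - ((r - 1 - (w s.1 s.2 : ℕ) : ℕ) : ℝ)) := by
    rw [Fintype.sum_prod_type]
    apply Finset.sum_nonneg
    intro b _
    simp only [mul_sub, Finset.sum_sub_distrib, sub_nonneg]
    apply Monovary.sum_mul_comp_perm_le_sum_mul (f := fun i => (m (b, i) : ℝ))
      (g := fun i : Fin r => ((r - 1 - (i : ℕ) : ℕ) : ℝ)) (σ := w b)
    intro i j hij
    have : j ≤ i := by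
      by_contra hlt
      push Not at hlt
      rw [Nat.cast_lt] at hij
      have : (i : ℕ) < j := hlt
      omega
    exact Nat.cast_le.2 (hm b this)
  have h3 : 0 < ∑ s : β × Fin r, (((r - 1 - (s.2 : ℕ) : ℕ) : ℝ)
      - ((r - 1 - (w s.1 s.2 : ℕ) : ℕ) : ℝ)) ^ 2 := by
    obtain ⟨b, hb⟩ := Function.ne_iff.1 hw
    obtain ⟨i, hi⟩ := DFunLike.ne_iff.1 hb
    apply Finset.sum_pos' (fun s _ => sq_nonneg _) ⟨(b, i), Finset.mem_univ _, ?_⟩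
    apply sq_pos_of_ne_zero
    rw [sub_ne_zero, Ne, Nat.cast_inj]
    have h4 : (w b i : ℕ) ≠ i := fun h => hi (Fin.ext h)
    have := (w b i).2
    have := i.2
    dsimp only
    omega
  have h5 : (∑ s, (((m - rhoW w) s : ℝ) + ((r - 1 - s.2 : ℕ) : ℝ)) ^ 2)
        - ∑ s : β × Fin r, ((r - 1 - s.2 : ℕ) : ℝ) ^ 2 -
        (∑ s, (m s : ℝ) ^ 2 - ∑ s : β × Fin r, ((r - 1 - (s.2 : ℕ) : ℕ) : ℝ) ^ 2)
      = 2 * ∑ s : β × Fin r, (m s : ℝ) * (((r - 1 - (s.2 : ℕ) : ℕ) : ℝ)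
        - ((r - 1 - (w s.1 s.2 : ℕ) : ℕ) : ℝ)) + ∑ s : β × Fin r, (((r - 1 - (s.2 : ℕ) : ℕ) : ℝ)
        - ((r - 1 - (w s.1 s.2 : ℕ) : ℕ) : ℝ)) ^ 2 := by
    rw [sub_sub_sub_cancel_right, ← Finset.sum_sub_distrib, Finset.mul_sum,
      ← Finset.sum_add_distrib]
    refine Finset.sum_congr rfl fun s _ => ?_
    rw [h1]
    ring
  rw [h5]
  linarith

theorem finrank_HW (lam : β × Fin r →₀ ℕ) (hlam : ∀ b, Antitone fun i => lam (b, i)) :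
    (finrank ℝ (G.HW lam) : ℝ) = ∑ w : β → Equiv.Perm (Fin r),
      (∏ b, ((Equiv.Perm.sign (w b) : ℤ) : ℝ)) *
        if rhoW w ≤ lam + rhoW 1 then (finrank ℝ (G.wt (lam + rhoW 1 - rhoW w)) : ℝ) else 0 := by
  classical
  set m := lam + rhoW 1 with hm
  have hms : ∀ s : β × Fin r, (m s : ℝ) = lam s + ((r - 1 - s.2 : ℕ) : ℝ) := by
    intro s; simp [hm, rhoW]
  set c := ∑ s, (m s : ℝ) ^ 2 - ∑ s : β × Fin r, ((r - 1 - (s.2 : ℕ) : ℕ) : ℝ) ^ 2 with hc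
  have hpol : ∀ w : β → Equiv.Perm (Fin r), ∃ f : Polynomial ℝ, f.eval c ≠ 0 ∧
      ∀ v ∈ G.wt (m - rhoW w), (G.cas - c • 1) (Polynomial.aeval G.cas f v) = 0 := fun w =>
    exists_poly (fun v hv => cas_comm.mem hv) c (fun v _ => cas_sub_sq c v)
  choose f hfc hf using hpol
  set F := ∏ w, f w with hF
  have hFc : F.eval c ≠ 0 := by
    rw [hF, Polynomial.eval_prod]; exact Finset.prod_ne_zero_iff.2 fun w _ => hfc w
  have hkill : ∀ w, ∀ v ∈ G.wt (m - rhoW w), G.cas (Polynomial.aeval G.cas F v)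
      = c • Polynomial.aeval G.cas F v := by
    intro w v hv
    have e : Polynomial.aeval G.cas F v = Polynomial.aeval G.cas (f w)
        (Polynomial.aeval G.cas (∏ w' ∈ Finset.univ.erase w, f w') v) := by
      rw [← Module.End.mul_apply, ← map_mul, Finset.mul_prod_erase _ _ (Finset.mem_univ w)]
    have := hf w _ ((cas_comm.aeval (∏ w' ∈ Finset.univ.erase w, f w')).mem hv)
    rw [← e, LinearMap.sub_apply, sub_eq_zero] at this
    exact this
  have h1 := alt_eq (G := G) m (Polynomial.aeval G.cas F)
  rw [alt_aeval, ← hc, Finset.sum_eq_single 1] at h1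
  · have e1 : m - rhoW 1 = lam := add_tsub_cancel_right _ _
    have hle : rhoW (1 : β → Equiv.Perm (Fin r)) ≤ m := le_add_self
    have hcl : (∑ s, ((lam s : ℝ) + ((r - 1 - s.2 : ℕ) : ℝ)) ^ 2)
        - ∑ s : β × Fin r, ((r - 1 - s.2 : ℕ) : ℝ) ^ 2 = c := by
      rw [hc]; congr 1; exact Finset.sum_congr rfl fun s _ => by rw [hms]
    rw [if_pos hle, e1] at h1
    have : FiniteDimensional ℝ (G.HW lam) := Submodule.finiteDimensional_of_le inf_le_left
    have hmap : ∀ v ∈ G.wt lam, Polynomial.aeval G.cas F v ∈ G.HW lam := by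
      intro v hv
      rw [mem_HW]
      have hv' := (cas_comm (G := G)).aeval F |>.mem hv
      refine ⟨hv', fun x hx => G.definite _ ?_⟩
      have h2 := eigen_eq hv' (hkill 1 v (by rwa [e1]))
      rw [hcl, sub_self, zero_mul, zero_add, mul_eq_zero, or_iff_right two_ne_zero,
        Finset.sum_eq_zero_iff_of_nonneg fun x _ => G.nonneg _] at h2
      exact h2 x hx
    have hHWc : ∀ v ∈ G.HW lam, G.cas v = c • v := by
      intro v hv
      rw [mem_HW] at hv
      rw [cas_apply hv.1, hcl, Finset.sum_eq_zero fun x hx => by rw [hv.2 x hx, map_zero],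
        smul_zero, add_zero]
    have hHWF : ∀ v ∈ G.HW lam, Polynomial.aeval G.cas F v = F.eval c • v :=
      fun v hv => aeval_apply_of_eigen (hHWc v hv) F
    have h3 := trOn_cyclic (U := G.wt lam) (V := G.HW lam) (R := Polynomial.aeval G.cas F)
      (S := 1) hmap (fun x hx => (mem_HW.1 hx).1)
    rw [one_mul, mul_one, trOn_congr (S := Polynomial.aeval G.cas F) (T := F.eval c • 1)
      (fun x hx => (G.HW lam).smul_mem _ hx) hHWF, trOn_smul _ (fun x hx => hx), trOn_one] at h3
    rw [h3] at h1
    simp only [Pi.one_apply, Equiv.Perm.sign_one, Units.val_one, Int.cast_one,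
      Finset.prod_const_one, one_mul] at h1
    have h4 := mul_left_cancel₀ hFc h1
    rw [← h4, alt_eq]
    simp only [trOn_one]
  · intro w _ hw
    split_ifs with hle
    · rw [trOn_zero_of, mul_zero]
      intro v hv
      have hv' := (cas_comm (G := G)).aeval F |>.mem hv
      have h2 := eigen_eq hv' (hkill w v hv)
      set u := Polynomial.aeval G.cas F v
      apply G.definite
      have hpos : 0 < (∑ s, (((m - rhoW w) s : ℝ) + ((r - 1 - s.2 : ℕ) : ℝ)) ^ 2)
        - ∑ s : β × Fin r, ((r - 1 - s.2 : ℕ) : ℝ) ^ 2 - c := by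
        refine rhoW_pos (fun b i j hij => ?_) hw hle
        have h7 := hlam b hij
        have h8 : (i : ℕ) ≤ j := hij
        simp only [hm, Finsupp.add_apply, rhoW, Finsupp.equivFunOnFinite_symm_apply_apply,
          Pi.one_apply, Equiv.Perm.one_apply] at h7 ⊢
        omega
      have h5 : 0 ≤ ∑ x ∈ posPairs β r, G.form (G.E x.1 x.2 u) (G.E x.1 x.2 u) :=
        Finset.sum_nonneg fun x _ => G.nonneg _
      have h6 := G.nonneg u
      nlinarith
    · rw [mul_zero]
  · simp

end GLRep

end

section

section Polarization
open MvPolynomial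
variable {C A : Type*}

/-- Polarization operators in the rows. -/
def rowD (C : Type*) {A : Type*} [Fintype C] (i j : A) :
    Derivation ℝ (MvPolynomial (C × A) ℝ) (MvPolynomial (C × A) ℝ) :=
  ∑ c, (X (c, i) : MvPolynomial (C × A) ℝ) • pderiv (c, j)

/-- Polarization operators in the columns. -/
def colD {C : Type*} (A : Type*) [Fintype A] (c d : C) :
    Derivation ℝ (MvPolynomial (C × A) ℝ) (MvPolynomial (C × A) ℝ) :=
  ∑ i, (X (c, i) : MvPolynomial (C × A) ℝ) • pderiv (d, i)

theorem rowD_apply [Fintype C] (i j : A) (f : MvPolynomial (C × A) ℝ) :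
    rowD C i j f = ∑ c, X (c, i) * pderiv (c, j) f := by
  rw [rowD, ← Derivation.coeFnAddMonoidHom_apply, map_sum, Finset.sum_apply]
  rfl

theorem colD_apply [Fintype A] (c d : C) (f : MvPolynomial (C × A) ℝ) :
    colD A c d f = ∑ i, X (c, i) * pderiv (d, i) f := by
  rw [colD, ← Derivation.coeFnAddMonoidHom_apply, map_sum, Finset.sum_apply]
  rfl

theorem rowD_X [Fintype C] [DecidableEq C] [DecidableEq A] (i j : A) (x : C × A) :
    rowD C i j (X x) = if x.2 = j then (X (x.1, i) : MvPolynomial (C × A) ℝ) else 0 := by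
  rw [rowD_apply]
  simp only [pderiv_X, Pi.single_apply, mul_ite, mul_one, mul_zero]
  split_ifs with h
  · subst h
    rw [Finset.sum_eq_single x.1]
    · simp
    · intro b _ hb
      rw [if_neg]
      intro h'
      exact hb (congrArg Prod.fst h').symm
    · simp
  · apply Finset.sum_eq_zero
    rintro c -
    rw [if_neg]
    rintro rfl
    exact h rfl

theorem colD_X [Fintype A] [DecidableEq C] [DecidableEq A] (c d : C) (x : C × A) :
    colD A c d (X x) = if x.1 = d then (X (c, x.2) : MvPolynomial (C × A) ℝ) else 0 := by
  rw [colD_apply]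
  simp only [pderiv_X, Pi.single_apply, mul_ite, mul_one, mul_zero]
  split_ifs with h
  · subst h
    rw [Finset.sum_eq_single x.2]
    · simp
    · intro b _ hb
      rw [if_neg]
      intro h'
      exact hb (congrArg Prod.snd h').symm
    · simp
  · apply Finset.sum_eq_zero
    rintro c -
    rw [if_neg]
    rintro rfl
    exact h rfl

theorem rowD_comm [Fintype C] [DecidableEq C] [DecidableEq A] (i j k l : A) :
    ⁅rowD C i j, rowD C k l⁆ =
    (if j = k then rowD C i l else 0) - (if l = i then rowD C k j else 0) := by
  apply MvPolynomial.derivation_ext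
  intro x
  rw [Derivation.commutator_apply, rowD_X, rowD_X, Derivation.sub_apply,
    apply_ite (fun D : Derivation ℝ (MvPolynomial (C × A) ℝ) _ => D (X x)),
    apply_ite (fun D : Derivation ℝ (MvPolynomial (C × A) ℝ) _ => D (X x)), rowD_X, rowD_X,
    apply_ite (rowD C i j), apply_ite (rowD C k l), rowD_X, rowD_X]
  simp only [map_zero, Derivation.zero_apply]
  by_cases h1 : x.2 = l <;> by_cases h2 : x.2 = j <;> by_cases h3 : j = k <;>
    by_cases h4 : l = i <;> simp_all [eq_comm]

theorem colD_comm [Fintype A] [DecidableEq C] [DecidableEq A] (i j k l : C) :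
    ⁅colD A i j, colD A k l⁆ =
    (if j = k then colD A i l else 0) - (if l = i then colD A k j else 0) := by
  apply MvPolynomial.derivation_ext
  intro x
  rw [Derivation.commutator_apply, colD_X, colD_X, Derivation.sub_apply,
    apply_ite (fun D : Derivation ℝ (MvPolynomial (C × A) ℝ) _ => D (X x)),
    apply_ite (fun D : Derivation ℝ (MvPolynomial (C × A) ℝ) _ => D (X x)), colD_X, colD_X,
    apply_ite (colD A i j), apply_ite (colD A k l), colD_X, colD_X]
  simp only [map_zero, Derivation.zero_apply]
  by_cases h1 : x.1 = l <;> by_cases h2 : x.1 = j <;> by_cases h3 : j = k <;>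
    by_cases h4 : l = i <;> simp_all [eq_comm]

theorem rowD_colD_comm [Fintype C] [Fintype A] [DecidableEq C] [DecidableEq A] (i j : A) (c d : C) :
    ⁅rowD C i j, colD A c d⁆ = 0 := by
  apply MvPolynomial.derivation_ext
  intro x
  rw [Derivation.commutator_apply, rowD_X, colD_X, apply_ite (rowD C i j), apply_ite (colD A c d),
    rowD_X, colD_X]
  by_cases h1 : x.2 = j <;> by_cases h2 : x.1 = d <;> simp_all

/-- The factorial of a multi-exponent. -/
def mfact {σ : Type*} [Fintype σ] (m : σ →₀ ℕ) : ℝ := ∏ u, ((m u).factorial : ℝ)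

theorem mfact_pos {σ : Type*} [Fintype σ] (m : σ →₀ ℕ) : 0 < mfact m :=
  Finset.prod_pos fun _ _ => by exact_mod_cast Nat.factorial_pos _

theorem mfact_add_single {σ : Type*} [Fintype σ] [DecidableEq σ] (m : σ →₀ ℕ) (u : σ) :
    mfact (m + Finsupp.single u 1) = (m u + 1) * mfact m := by
  unfold mfact
  rw [← Finset.mul_prod_erase _ _ (Finset.mem_univ u),
    ← Finset.mul_prod_erase Finset.univ (fun u => ((m u).factorial : ℝ)) (Finset.mem_univ u),
    ← mul_assoc]
  congr 1
  · simp [Nat.factorial_succ]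
  · refine Finset.prod_congr rfl fun v hv => ?_
    rw [Finsupp.add_apply, Finsupp.single_eq_of_ne (Finset.ne_of_mem_erase hv), add_zero]

/-- The apolar (Fischer) inner product. -/
def fischer (σ : Type*) [Fintype σ] :
    MvPolynomial σ ℝ →ₗ[ℝ] MvPolynomial σ ℝ →ₗ[ℝ] ℝ :=
  (basisMonomials σ ℝ).constr ℝ fun m => mfact m • lcoeff ℝ m

theorem fischer_monomial {σ : Type*} [Fintype σ] (m : σ →₀ ℕ) (a : ℝ) (g : MvPolynomial σ ℝ) :
    fischer σ (monomial m a) g = a * (mfact m * coeff m g) := by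
  have h : (monomial m a : MvPolynomial σ ℝ) = a • basisMonomials σ ℝ m := by
    rw [coe_basisMonomials, smul_monomial, smul_eq_mul, mul_one]
  rw [h, map_smul, fischer, Basis.constr_basis]
  rfl

theorem fischer_eq {σ : Type*} [Fintype σ] (f g : MvPolynomial σ ℝ) :
    fischer σ f g = ∑ m ∈ f.support, coeff m f * (mfact m * coeff m g) := by
  conv_lhs => rw [f.as_sum]
  rw [map_sum, LinearMap.sum_apply]
  simp_rw [fischer_monomial]

theorem fischer_comm {σ : Type*} [Fintype σ] (f g : MvPolynomial σ ℝ) :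
    fischer σ f g = fischer σ g f := by
  classical
  have h : ∀ f g : MvPolynomial σ ℝ, fischer σ f g
      = ∑ m ∈ f.support ∪ g.support, coeff m f * (mfact m * coeff m g) := by
    intro f g
    rw [fischer_eq]
    apply Finset.sum_subset Finset.subset_union_left
    intro m _ hm
    rw [notMem_support_iff.1 hm, zero_mul]
  rw [h, h, Finset.union_comm]
  exact Finset.sum_congr rfl fun m _ => by ring

theorem fischer_X_mul {σ : Type*} [Fintype σ] [DecidableEq σ] (u : σ) (f g : MvPolynomial σ ℝ) :
    fischer σ (X u * f) g = fischer σ f (pderiv u g) := by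
  induction f using MvPolynomial.induction_on' with
  | add p q hp hq => rw [mul_add, map_add, map_add, LinearMap.add_apply, LinearMap.add_apply, hp, hq]
  | monomial m a =>
    rw [X, monomial_mul, one_mul, add_comm, fischer_monomial, fischer_monomial, mfact_add_single,
      coeff_pderiv]
    ring

theorem fischer_X_pderiv {σ : Type*} [Fintype σ] [DecidableEq σ] (u v : σ)
    (f g : MvPolynomial σ ℝ) :
    fischer σ (X u * pderiv v f) g = fischer σ f (X v * pderiv u g) := by
  rw [fischer_X_mul, fischer_comm f, fischer_X_mul, fischer_comm]

theorem coeff_X_mul_pderiv {σ : Type*} [DecidableEq σ] (u : σ) (f : MvPolynomial σ ℝ)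
    (m : σ →₀ ℕ) : coeff m (X u * pderiv u f) = m u * coeff m f := by
  rw [coeff_X_mul']
  split_ifs with h
  · rw [Finsupp.mem_support_iff] at h
    rw [coeff_pderiv, tsub_add_cancel_of_le (Finsupp.single_le_iff.2 (by omega)),
      Finsupp.tsub_apply, Finsupp.single_eq_same, Nat.cast_sub (by omega)]
    push_cast
    ring
  · rw [Finsupp.notMem_support_iff] at h
    rw [h, Nat.cast_zero, zero_mul]

end Polarization

section PolRep
open MvPolynomial

/-- The operators of the polarization representation. -/
def polE (r s : ℕ) : Option (Fin s) × Fin r → Option (Fin s) × Fin r →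
    Module.End ℝ (MvPolynomial ((Fin s × Fin r) × Fin r) ℝ)
  | (none, i), (none, j) => (rowD (Fin s × Fin r) i j : Derivation ℝ _ _)
  | (some t, a), (some u, b) => (colD (Fin r) (t, a) (u, b) : Derivation ℝ _ _)
  | (none, _), (some _, _) => 0
  | (some _, _), (none, _) => 0

theorem pos_of_mem_polWt {r s : ℕ} {μ : Option (Fin s) × Fin r →₀ ℕ}
    {f : MvPolynomial ((Fin s × Fin r) × Fin r) ℝ} :
    f ∈ jointWt (polE r s) μ ↔ ∀ m, coeff m f ≠ 0 →
      (∀ i, ∑ c, m (c, i) = μ (none, i)) ∧ ∀ c : Fin s × Fin r, ∑ i, m (c, i) = μ (some c.1, c.2) := by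
  rw [mem_jointWt]
  have h1 : ∀ i m, coeff m (polE r s (none, i) (none, i) f) = (∑ c, m (c, i) : ℕ) * coeff m f := by
    intro i m
    change coeff m (rowD (Fin s × Fin r) i i f) = _
    rw [rowD_apply, coeff_sum]
    simp_rw [coeff_X_mul_pderiv]
    rw [← Finset.sum_mul, Nat.cast_sum]
  have h2 : ∀ (c : Fin s × Fin r) m, coeff m (polE r s (some c.1, c.2) (some c.1, c.2) f)
      = (∑ i, m (c, i) : ℕ) * coeff m f := by
    intro c m
    change coeff m (colD (Fin r) c c f) = _
    rw [colD_apply, coeff_sum]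
    simp_rw [coeff_X_mul_pderiv]
    rw [← Finset.sum_mul, Nat.cast_sum]
  constructor
  · intro h m hm
    refine ⟨fun i => ?_, fun c => ?_⟩
    · have := congrArg (coeff m) (h (none, i))
      rw [h1, coeff_smul, smul_eq_mul] at this
      exact_mod_cast mul_right_cancel₀ hm this
    · have := congrArg (coeff m) (h (some c.1, c.2))
      rw [h2, coeff_smul, smul_eq_mul] at this
      exact_mod_cast mul_right_cancel₀ hm this
  · rintro h ⟨_ | t, a⟩
    · ext m
      rw [h1, coeff_smul, smul_eq_mul]
      by_cases hm : coeff m f = 0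
      · rw [hm, mul_zero, mul_zero]
      · rw [(h m hm).1]
    · ext m
      rw [h2 (t, a), coeff_smul, smul_eq_mul]
      by_cases hm : coeff m f = 0
      · rw [hm, mul_zero, mul_zero]
      · rw [(h m hm).2]

/-- Exponent matrices with prescribed row and column sums. -/
def matSet (r s : ℕ) (μ : Option (Fin s) × Fin r →₀ ℕ) : Set ((Fin s × Fin r) × Fin r →₀ ℕ) :=
  {m | (∀ i, ∑ c, m (c, i) = μ (none, i)) ∧ ∀ c : Fin s × Fin r, ∑ i, m (c, i) = μ (some c.1, c.2)}

theorem jointWt_polE (r s : ℕ) (μ : Option (Fin s) × Fin r →₀ ℕ) :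
    jointWt (polE r s) μ = restrictSupport ℝ (matSet r s μ) := by
  ext f
  rw [pos_of_mem_polWt, mem_restrictSupport_iff]
  exact forall_congr' fun m => by rw [Finset.mem_coe, MvPolynomial.mem_support_iff]; rfl

theorem matSet_finite (r s : ℕ) (μ : Option (Fin s) × Fin r →₀ ℕ) : (matSet r s μ).Finite := by
  apply Set.Finite.subset (Set.finite_Iic
    (Finsupp.equivFunOnFinite.symm fun x : (Fin s × Fin r) × Fin r => μ (none, x.2)))
  intro m hm x
  rw [Finsupp.equivFunOnFinite_symm_apply_apply, ← hm.1]
  exact Finset.single_le_sum (f := fun c => m (c, x.2)) (fun _ _ => Nat.zero_le _)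
    (Finset.mem_univ x.1)

theorem finrank_polWt (r s : ℕ) (μ : Option (Fin s) × Fin r →₀ ℕ) :
    finrank ℝ (jointWt (polE r s) μ) = (matSet r s μ).ncard := by
  rw [jointWt_polE]
  exact (finrank_eq_nat_card_basis (basisRestrictSupport ℝ (matSet r s μ)))

/-- The polarization representation. -/
def polRep (r s : ℕ) :
    GLRep (Option (Fin s)) r (MvPolynomial ((Fin s × Fin r) × Fin r) ℝ) where
  E := polE r s
  comm := by
    rintro ⟨_ | t, i⟩ ⟨_ | u, j⟩ ⟨_ | v, k⟩ ⟨_ | w, l⟩ h1 h2 <;> simp only [reduceCtorEq] at h1 h2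
    · refine LinearMap.ext fun f => ?_
      have h := DFunLike.congr_fun (rowD_comm (C := Fin s × Fin r) i j k l) f
      rw [Derivation.commutator_apply] at h
      simp only [Prod.mk.injEq, true_and]
      refine h.trans ?_
      split_ifs <;> rfl
    · refine LinearMap.ext fun f => ?_
      have h := DFunLike.congr_fun (rowD_colD_comm i j (v, k) (w, l)) f
      rw [Derivation.commutator_apply] at h
      simp only [Prod.mk.injEq, reduceCtorEq, false_and, if_false]
      exact h.trans (by simp)
    · refine LinearMap.ext fun f => ?_
      have h := DFunLike.congr_fun (rowD_colD_comm k l (t, i) (u, j)) f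
      rw [Derivation.commutator_apply] at h
      simp only [Prod.mk.injEq, reduceCtorEq, false_and, if_false]
      refine (neg_sub _ _).symm.trans ((congrArg Neg.neg h).trans (by simp))
    · refine LinearMap.ext fun f => ?_
      have h := DFunLike.congr_fun (colD_comm (A := Fin r) (t, i) (u, j) (v, k) (w, l)) f
      rw [Derivation.commutator_apply] at h
      simp only [Prod.mk.injEq, Option.some.injEq]
      refine h.trans ?_
      simp only [Prod.mk.injEq]
      split_ifs <;> rfl
  form := fischer _
  nonneg f := by
    rw [fischer_eq]
    apply Finset.sum_nonneg
    intro m _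
    have := (mfact_pos m).le
    have := mul_self_nonneg (coeff m f)
    nlinarith [mul_nonneg (mfact_pos m).le this]
  definite f h := by
    rw [fischer_eq, Finset.sum_eq_zero_iff_of_nonneg] at h
    · ext m
      by_contra hm
      have h1 := h m (MvPolynomial.mem_support_iff.2 hm)
      rw [mul_eq_zero, mul_eq_zero] at h1
      rcases h1 with h1 | h1 | h1
      · exact hm h1
      · exact (mfact_pos m).ne' h1
      · exact hm h1
    · intro m _
      have := mul_self_nonneg (coeff m f)
      nlinarith [mul_nonneg (mfact_pos m).le this]
  adj := by
    rintro ⟨_ | t, i⟩ ⟨_ | u, j⟩ h f g <;> simp only [reduceCtorEq] at h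
    · change fischer _ (rowD _ i j f) g = fischer _ f (rowD _ j i g)
      rw [rowD_apply, rowD_apply, map_sum, map_sum, LinearMap.sum_apply]
      exact Finset.sum_congr rfl fun c _ => fischer_X_pderiv _ _ _ _
    · change fischer _ (colD _ (t, i) (u, j) f) g = fischer _ f (colD _ (u, j) (t, i) g)
      rw [colD_apply, colD_apply, map_sum, map_sum, LinearMap.sum_apply]
      exact Finset.sum_congr rfl fun c _ => fischer_X_pderiv _ _ _ _
  fin μ := by
    rw [jointWt_polE]
    have := (matSet_finite r s μ).to_subtype
    exact Module.Finite.of_basis (basisRestrictSupport ℝ (matSet r s μ))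
  kill := by
    rintro ⟨_ | t, i⟩ ⟨_ | u, j⟩ h hne μ h0 f hf <;> simp only [reduceCtorEq] at h
    · change rowD _ i j f = 0
      rw [rowD_apply]
      apply Finset.sum_eq_zero
      intro c _
      convert mul_zero _
      ext m
      rw [coeff_pderiv, coeff_zero]
      by_contra hc
      have h1 := (pos_of_mem_polWt.1 hf _ (left_ne_zero_of_mul hc)).1 j
      rw [h0] at h1
      have := Finset.sum_eq_zero_iff.1 h1 c (Finset.mem_univ _)
      simp at this
    · change colD _ (t, i) (u, j) f = 0
      rw [colD_apply]
      apply Finset.sum_eq_zero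
      intro c _
      convert mul_zero _
      ext m
      rw [coeff_pderiv, coeff_zero]
      by_contra hc
      have h1 := (pos_of_mem_polWt.1 hf _ (left_ne_zero_of_mul hc)).2 (u, j)
      rw [h0] at h1
      have := Finset.sum_eq_zero_iff.1 h1 c (Finset.mem_univ _)
      simp at this

end PolRep

end

section

section Multiplicity
open MvPolynomial

theorem coeff_prod_hkZ {r s : ℕ} (α : Fin s × Fin r → ℤ) (μ : Option (Fin s) × Fin r →₀ ℕ)
    (hα : (∀ c, 0 ≤ α c) → ∀ c : Fin s × Fin r, α c = μ (some c.1, c.2)) :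
    coeff (expo fun i => μ (none, i)) (∏ c, hkZ r (α c))
      = if ∀ c, 0 ≤ α c then ((matSet r s μ).ncard : ℤ) else 0 := by
  classical
  split_ifs with h
  · have hα' := hα h
    have h1 : ∀ c, hkZ r (α c) = hsymm (Fin r) ℤ (μ (some c.1, c.2)) := by
      intro c
      rw [hα', hkZ_natCast]
    simp_rw [h1]
    rw [← coeff_coe]
    have h2 : ((∏ c : Fin s × Fin r, hsymm (Fin r) ℤ (μ (some c.1, c.2)) :
        MvPolynomial (Fin r) ℤ) : MvPowerSeries (Fin r) ℤ)
        = ∏ c : Fin s × Fin r, ((hsymm (Fin r) ℤ (μ (some c.1, c.2)) : MvPolynomial (Fin r) ℤ) :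
          MvPowerSeries (Fin r) ℤ) :=
      map_prod coeToMvPowerSeries.ringHom _ _
    rw [h2, MvPowerSeries.coeff_prod]
    simp_rw [coeff_coe, coeff_hsymm, Finset.prod_ite_zero, Finset.prod_const_one]
    rw [← Finset.sum_filter, Finset.sum_const, nsmul_eq_mul, mul_one, Nat.cast_inj,
      ← Set.ncard_coe_finset,
      ← Set.ncard_preimage_of_injective_subset_range (Finsupp.curryEquiv.injective)
        (fun x _ => Finsupp.curryEquiv.surjective x)]
    congr 1
    ext m
    simp only [Set.mem_preimage, Finset.coe_filter, Set.mem_ofPred_eq, Finset.mem_finsuppAntidiag,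
      Finset.subset_univ, and_true, matSet]
    apply and_congr
    · rw [Finsupp.ext_iff]
      apply forall_congr'
      intro i
      rw [Finsupp.finsetSum_apply]
      rfl
    · simp only [Finset.mem_univ, true_imp_iff, Finsupp.degree_eq_sum]
      rfl
  · push Not at h
    obtain ⟨c, hc⟩ := h
    rw [Finset.prod_eq_zero (Finset.mem_univ c) (hkZ_of_neg hc), coeff_zero]

/-- The highest weight attached to a family of partitions. -/
def hornWt {r s : ℕ} (q : ℕ) (L : Fin s → Fin r → ℕ) : Option (Fin s) × Fin r →₀ ℕ :=
  Finsupp.equivFunOnFinite.symm fun p => p.1.elim q fun j => L j p.2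

theorem schurI_eq_sum {n r : ℕ} (i : Fin r → Fin n) (L : Fin r → ℕ)
    (hL : ∀ a, (L a : ℤ) = (n : ℤ) - r + (a : ℕ) - (i a : ℕ)) :
    schurI i = ∑ σ : Equiv.Perm (Fin r), C (Equiv.Perm.sign σ : ℤ) *
      ∏ a, hkZ r ((L a : ℤ) - (a : ℕ) + (σ a : ℕ)) := by
  unfold schurI
  rw [← Matrix.det_transpose, Matrix.det_apply']
  refine Finset.sum_congr rfl fun σ _ => ?_
  congr 1
  refine Finset.prod_congr rfl fun a _ => ?_
  rw [Matrix.transpose_apply, Matrix.of_apply, hL]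
  congr 1
  ring

theorem interNum_eq {n r s : ℕ} (hrn : r ≤ n) (I : Fin s → Fin r → Fin n) (L : Fin s → Fin r → ℕ)
    (hL : ∀ j a, (L j a : ℤ) = (n : ℤ) - r + (a : ℕ) - (I j a : ℕ)) :
    (interNum I : ℝ) = ∑ w : Option (Fin s) → Equiv.Perm (Fin r),
      (∏ b, ((Equiv.Perm.sign (w b) : ℤ) : ℝ)) *
        if rhoW w ≤ hornWt (n - r) L + rhoW 1 then
          (finrank ℝ (jointWt (polE r s) (hornWt (n - r) L + rhoW 1 - rhoW w)) : ℝ) else 0 := by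
  classical
  have h1 : (∏ j, schurI (I j)) * alternant r
      = ∑ x : Equiv.Perm (Fin r) × (Fin s → Equiv.Perm (Fin r)),
        C ((Equiv.Perm.sign x.1 : ℤ) * ∏ j, (Equiv.Perm.sign (x.2 j) : ℤ)) *
          ((∏ c : Fin s × Fin r, hkZ r ((L c.1 c.2 : ℤ) - (c.2 : ℕ) + (x.2 c.1 c.2 : ℕ))) *
            monomial (expo fun i => r - 1 - (x.1 i : ℕ)) 1) := by
    rw [alternant_eq, altDet_eq_sum]
    simp_rw [fun j => schurI_eq_sum (I j) (L j) (hL j)]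
    rw [Finset.prod_univ_sum, Fintype.piFinset_univ, Finset.sum_mul_sum, Finset.sum_comm,
      Fintype.sum_prod_type]
    refine Finset.sum_congr rfl fun σ _ => Finset.sum_congr rfl fun τ _ => ?_
    rw [Finset.prod_mul_distrib, Fintype.prod_prod_type, map_mul, map_prod]
    rw [Units.smul_def, zsmul_eq_mul, ← map_intCast (C : ℤ →+* MvPolynomial (Fin r) ℤ)]
    simp only [Int.cast_id]
    ring
  rw [interNum, h1, coeff_sum, Int.cast_sum]
  refine (Fintype.sum_equiv (Equiv.piOptionEquivProd (β := fun _ => Equiv.Perm (Fin r)))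
    _ _ fun w => ?_).symm
  rw [coeff_C_mul, Int.cast_mul, Fintype.prod_option]
  congr 1
  · simp [Equiv.piOptionEquivProd]
  · change _ = ((coeff _ ((∏ c : Fin s × Fin r, hkZ r ((L c.1 c.2 : ℤ) - (c.2 : ℕ) +
      (w (some c.1) c.2 : ℕ))) * monomial (expo fun i => r - 1 - (w none i : ℕ)) 1) : ℤ) : ℝ)
    rw [coeff_mul_monomial', mul_one, finrank_polWt]
    set M : Option (Fin s) × Fin r →₀ ℕ := hornWt (n - r) L + rhoW 1
    have hval : ∀ (b : Option (Fin s)) (i : Fin r), M (b, i)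
        = (b.elim (n - r) fun j => L j i) + (r - 1 - (i : ℕ)) := by
      intro b i; rfl
    have hw : ∀ b i, rhoW w (b, i) = r - 1 - (w b i : ℕ) := fun b i => rfl
    have hn : ∀ i : Fin r, n - 1 - (i : ℕ) = (n - r) + (r - 1 - (i : ℕ)) := by
      intro i; have := i.2; omega
    have hexp : ((expo fun i : Fin r => r - 1 - (w none i : ℕ)) ≤ expo fun a => n - 1 - a) ↔
        ∀ i, rhoW w (none, i) ≤ M (none, i) := by
      rw [Finsupp.le_def]
      refine forall_congr' fun i => ?_
      rw [hval, hw, Finsupp.equivFunOnFinite_symm_apply_apply,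
        Finsupp.equivFunOnFinite_symm_apply_apply, hn]
      rfl
    have hsub : (expo fun a : Fin r => n - 1 - (a : ℕ)) - (expo fun i => r - 1 - (w none i : ℕ))
        = expo fun i => (M - rhoW w) (none, i) := by
      ext i
      rw [Finsupp.tsub_apply, Finsupp.equivFunOnFinite_symm_apply_apply,
        Finsupp.equivFunOnFinite_symm_apply_apply, Finsupp.equivFunOnFinite_symm_apply_apply,
        Finsupp.tsub_apply, hval, hw, hn]
      rfl
    have hpos : (∀ c : Fin s × Fin r,
        0 ≤ (L c.1 c.2 : ℤ) - (c.2 : ℕ) + (w (some c.1) c.2 : ℕ)) ↔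
        ∀ j i, rhoW w (some j, i) ≤ M (some j, i) := by
      rw [Prod.forall]
      refine forall_congr' fun j => forall_congr' fun i => ?_
      rw [hval, hw]
      have := i.2
      have := (w (some j) i).2
      simp only [Option.elim]
      omega
    have hle : rhoW w ≤ M ↔
        (∀ i, rhoW w (none, i) ≤ M (none, i)) ∧
        ∀ j i, rhoW w (some j, i) ≤ M (some j, i) := by
      rw [Finsupp.le_def, Prod.forall, Option.forall]
    by_cases h2 : ∀ i, rhoW w (none, i) ≤ M (none, i)
    · rw [if_pos (hexp.2 h2), hsub, coeff_prod_hkZ _ (M - rhoW w)]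
      · by_cases h3 : ∀ j i, rhoW w (some j, i) ≤ M (some j, i)
        · rw [if_pos (hle.2 ⟨h2, h3⟩), if_pos (hpos.2 h3), Int.cast_natCast]
        · rw [if_neg fun h => h3 (hle.1 h).2, if_neg fun h => h3 (hpos.1 h), Int.cast_zero]
      · intro hc c
        have h3 := hpos.1 hc c.1 c.2
        have h4 := hc c
        rw [hval, hw] at h3
        rw [Finsupp.tsub_apply, hval, hw]
        have := c.2.2
        have := (w (some c.1) c.2).2
        simp only [Option.elim] at h3 ⊢
        omega
    · rw [if_neg fun h => h2 (hle.1 h).1, if_neg fun h => h2 (hexp.1 h), Int.cast_zero]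

theorem interNum_eq_finrank {n r s : ℕ} (hrn : r ≤ n) (I : Fin s → Fin r → Fin n)
    (L : Fin s → Fin r → ℕ) (hanti : ∀ j, Antitone (L j))
    (hL : ∀ j a, (L j a : ℤ) = (n : ℤ) - r + (a : ℕ) - (I j a : ℕ)) :
    (interNum I : ℝ) = finrank ℝ ((polRep r s).HW (hornWt (n - r) L)) := by
  rw [interNum_eq hrn I L hL, GLRep.finrank_HW]
  · rfl
  · rintro (_ | j)
    · exact fun _ _ _ => le_rfl
    · exact hanti j

/-- Highest weight vectors of the polarization representation. -/
structure IsHighest {r s : ℕ} (q : ℕ) (L : Fin s → Fin r → ℕ)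
    (f : MvPolynomial ((Fin s × Fin r) × Fin r) ℝ) : Prop where
  row_sum : ∀ m, coeff m f ≠ 0 → ∀ i, ∑ c, m (c, i) = q
  col_sum : ∀ m, coeff m f ≠ 0 → ∀ c : Fin s × Fin r, ∑ i, m (c, i) = L c.1 c.2
  row_raise : ∀ i j, i < j → rowD (Fin s × Fin r) i j f = 0
  col_raise : ∀ t a b, a < b → colD (Fin r) (t, a) (t, b) f = 0

theorem interNum_ne_zero_iff {n r s : ℕ} (hrn : r ≤ n) (I : Fin s → Fin r → Fin n)
    (L : Fin s → Fin r → ℕ) (hanti : ∀ j, Antitone (L j))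
    (hL : ∀ j a, (L j a : ℤ) = (n : ℤ) - r + (a : ℕ) - (I j a : ℕ)) :
    interNum I ≠ 0 ↔ ∃ f, f ≠ 0 ∧ IsHighest (n - r) L f := by
  have hmem : ∀ f, f ∈ (polRep r s).HW (hornWt (n - r) L) ↔ IsHighest (n - r) L f := by
    intro f
    rw [GLRep.mem_HW]
    constructor
    · rintro ⟨h1, h2⟩
      have h3 := pos_of_mem_polWt.1 h1
      refine ⟨fun m hm => (h3 m hm).1, fun m hm => (h3 m hm).2, fun i j hij => ?_,
        fun t a b hab => ?_⟩
      · exact h2 ((none, i), (none, j)) (by simp [posPairs, hij])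
      · exact h2 ((some t, a), (some t, b)) (by simp [posPairs, hab])
    · intro h
      refine ⟨pos_of_mem_polWt.2 fun m hm => ⟨h.row_sum m hm, h.col_sum m hm⟩, ?_⟩
      rintro ⟨⟨_ | t, i⟩, ⟨_ | u, j⟩⟩ hx <;> simp [posPairs] at hx
      · exact h.row_raise i j hx
      · obtain ⟨rfl, hx⟩ := hx
        exact h.col_raise _ i j hx
  have : FiniteDimensional ℝ ((polRep r s).HW (hornWt (n - r) L)) :=
    Submodule.finiteDimensional_of_le inf_le_left
  rw [← Int.cast_ne_zero (α := ℝ), interNum_eq_finrank hrn I L hanti hL, Nat.cast_ne_zero, Ne,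
    Submodule.finrank_eq_zero, Submodule.eq_bot_iff]
  push Not
  exact exists_congr fun f => by rw [hmem, and_comm]

end Multiplicity

end

section

section LinePoly
variable {E F : Type*} [AddCommGroup E] [Module ℝ E] [AddCommGroup F] [Module ℝ F]

/-- Functions whose restriction to every line is polynomial. -/
def LinePoly (p : E → ℝ) : Prop :=
  ∀ x y : E, ∃ P : Polynomial ℝ, ∀ t : ℝ, p (x + t • y) = P.eval t

namespace LinePoly

theorem const (a : ℝ) : LinePoly (fun _ : E => a) := fun _ _ => ⟨Polynomial.C a, by simp⟩

theorem add {p q : E → ℝ} (hp : LinePoly p) (hq : LinePoly q) :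
    LinePoly (fun x => p x + q x) := fun x y => by
  obtain ⟨P, hP⟩ := hp x y
  obtain ⟨Q, hQ⟩ := hq x y
  exact ⟨P + Q, fun t => by simp [hP, hQ]⟩

theorem mul {p q : E → ℝ} (hp : LinePoly p) (hq : LinePoly q) :
    LinePoly (fun x => p x * q x) := fun x y => by
  obtain ⟨P, hP⟩ := hp x y
  obtain ⟨Q, hQ⟩ := hq x y
  exact ⟨P * Q, fun t => by simp [hP, hQ]⟩

theorem sum {ι : Type*} (s : Finset ι) {p : ι → E → ℝ} (hp : ∀ i ∈ s, LinePoly (p i)) :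
    LinePoly (fun x => ∑ i ∈ s, p i x) := by
  classical
  induction s using Finset.induction with
  | empty => simpa using const 0
  | insert a s ha ih =>
    simp_rw [Finset.sum_insert ha]
    exact (hp a (Finset.mem_insert_self _ _)).add
      (ih fun i hi => hp i (Finset.mem_insert_of_mem hi))

theorem prod {ι : Type*} (s : Finset ι) {p : ι → E → ℝ} (hp : ∀ i ∈ s, LinePoly (p i)) :
    LinePoly (fun x => ∏ i ∈ s, p i x) := by
  classical
  induction s using Finset.induction with
  | empty => simpa using const 1
  | insert a s ha ih =>
    simp_rw [Finset.prod_insert ha]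
    exact (hp a (Finset.mem_insert_self _ _)).mul
      (ih fun i hi => hp i (Finset.mem_insert_of_mem hi))

theorem linear (l : E →ₗ[ℝ] ℝ) : LinePoly l := fun x y =>
  ⟨Polynomial.C (l x) + Polynomial.X * Polynomial.C (l y), fun t => by simp [mul_comm t]⟩

theorem comp {p : F → ℝ} (hp : LinePoly p) (l : E →ₗ[ℝ] F) : LinePoly (fun x => p (l x)) :=
  fun x y => by
  obtain ⟨P, hP⟩ := hp (l x) (l y)
  exact ⟨P, fun t => by simp [hP]⟩

theorem comp_add_const {p : E → ℝ} (hp : LinePoly p) (c : E) : LinePoly (fun x => p (x + c)) :=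
  fun x y => by
  obtain ⟨P, hP⟩ := hp (x + c) y
  exact ⟨P, fun t => by rw [← hP, add_right_comm]⟩

theorem det {ι : Type*} [Fintype ι] [DecidableEq ι] {M : E → Matrix ι ι ℝ}
    (hM : ∀ i j, LinePoly (fun x => M x i j)) : LinePoly (fun x => (M x).det) := by
  simp_rw [Matrix.det_apply']
  exact sum _ fun σ _ => (const _).mul (prod _ fun i _ => hM _ _)

theorem mvPolynomial {σ : Type*} (f : MvPolynomial σ ℝ) :
    LinePoly (fun x : σ → ℝ => MvPolynomial.eval x f) := by
  induction f using MvPolynomial.induction_on with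
  | C a => simpa using const a
  | add p q hp hq => simpa using hp.add hq
  | mul_X p i hp => simpa using hp.mul (linear (LinearMap.proj i))

theorem exists_ne_zero {p q : E → ℝ} (hp : LinePoly p) (hq : LinePoly q) {x y : E} (hx : p x ≠ 0)
    (hy : q y ≠ 0) : ∃ z, p z ≠ 0 ∧ q z ≠ 0 := by
  obtain ⟨P, hP⟩ := hp x (y - x)
  obtain ⟨Q, hQ⟩ := hq x (y - x)
  have hP0 : P ≠ 0 := by
    rintro rfl
    exact hx (by simpa using hP 0)
  have hQ0 : Q ≠ 0 := by
    rintro rfl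
    exact hy (by simpa using hQ 1)
  by_contra! h
  refine mul_ne_zero hP0 hQ0 (Polynomial.funext fun t => ?_)
  rw [Polynomial.eval_mul, ← hP, ← hQ, Polynomial.eval_zero]
  by_cases h1 : p (x + t • (y - x)) = 0
  · rw [h1, zero_mul]
  · rw [h _ h1, mul_zero]

theorem exists_ne_zero_finset {ι : Type*} (s : Finset ι) {p : ι → E → ℝ}
    (hp : ∀ i ∈ s, LinePoly (p i)) (hx : ∀ i ∈ s, ∃ x, p i x ≠ 0) : ∃ z, ∀ i ∈ s, p i z ≠ 0 := by
  classical
  induction s using Finset.induction with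
  | empty => exact ⟨0, by simp⟩
  | insert a s ha ih =>
    obtain ⟨z, hz⟩ := ih (fun i hi => hp i (Finset.mem_insert_of_mem hi))
      fun i hi => hx i (Finset.mem_insert_of_mem hi)
    obtain ⟨x, hx⟩ := hx a (Finset.mem_insert_self _ _)
    obtain ⟨w, hw1, hw2⟩ := exists_ne_zero (hp a (Finset.mem_insert_self _ _))
      (prod s fun i hi => hp i (Finset.mem_insert_of_mem hi)) hx (Finset.prod_ne_zero_iff.2 hz)
    refine ⟨w, fun i hi => ?_⟩
    rcases Finset.mem_insert.1 hi with rfl | hi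
    · exact hw1
    · exact Finset.prod_ne_zero_iff.1 hw2 i hi

theorem rank {V W : Type*} [AddCommGroup V] [Module ℝ V] [AddCommGroup W] [Module ℝ W]
    [FiniteDimensional ℝ W] {M : E → V →ₗ[ℝ] W}
    (hM : ∀ v (ξ : W →ₗ[ℝ] ℝ), LinePoly (fun x => ξ (M x v))) (x : E) :
    ∃ p : E → ℝ, LinePoly p ∧ p x ≠ 0 ∧
      ∀ y, p y ≠ 0 → finrank ℝ (LinearMap.range (M x)) ≤ finrank ℝ (LinearMap.range (M y)) := by
  classical
  set R := LinearMap.range (M x) with hR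
  obtain ⟨P, hP⟩ := (M x).rangeRestrict.exists_rightInverse_of_surjective
    (LinearMap.range_rangeRestrict _)
  obtain ⟨L, hL⟩ := R.subtype.exists_leftInverse_of_injective R.ker_subtype
  let b := finBasis ℝ R
  have hx : L ∘ₗ M x ∘ₗ P = LinearMap.id := by
    refine LinearMap.ext fun v => ?_
    have h1 : M x (P v) = R.subtype v := congrArg Subtype.val (LinearMap.congr_fun hP v)
    rw [LinearMap.comp_apply, LinearMap.comp_apply, h1]
    exact LinearMap.congr_fun hL v
  refine ⟨fun y => (LinearMap.toMatrix b b (L ∘ₗ M y ∘ₗ P)).det, det fun i j => ?_, ?_, ?_⟩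
  · simp_rw [LinearMap.toMatrix_apply]
    exact hM (P (b j)) ((b.coord i) ∘ₗ L)
  · simp only [hx, LinearMap.toMatrix_id, Matrix.det_one]
    exact one_ne_zero
  · intro y hy
    dsimp only at hy
    rw [LinearMap.det_toMatrix] at hy
    have hs : Function.Surjective (L ∘ₗ M y ∘ₗ P) :=
      (LinearMap.equivOfDetNeZero _ hy).surjective
    calc finrank ℝ R = finrank ℝ (LinearMap.range (L ∘ₗ M y ∘ₗ P)) := by
          rw [LinearMap.range_eq_top.2 hs, finrank_top]
      _ ≤ finrank ℝ ((LinearMap.range (M y)).map L) := by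
          apply Submodule.finrank_mono
          rw [LinearMap.range_comp]
          exact Submodule.map_mono (LinearMap.range_comp_le_range _ _)
      _ ≤ _ := Submodule.finrank_map_le _ _

/-- Injectivity is an open condition in families which are polynomial along lines. -/
theorem injective {V W : Type*} [AddCommGroup V] [Module ℝ V] [AddCommGroup W] [Module ℝ W]
    [FiniteDimensional ℝ V] [FiniteDimensional ℝ W] {M : E → V →ₗ[ℝ] W}
    (hM : ∀ v (ξ : W →ₗ[ℝ] ℝ), LinePoly (fun x => ξ (M x v))) (x : E)
    (hx : Function.Injective (M x)) :
    ∃ p : E → ℝ, LinePoly p ∧ p x ≠ 0 ∧ ∀ y, p y ≠ 0 → Function.Injective (M y) := by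
  obtain ⟨p, hp, hpx, h⟩ := rank hM x
  refine ⟨p, hp, hpx, fun y hy => ?_⟩
  have h1 := h y hy
  rw [LinearMap.finrank_range_of_inj hx] at h1
  have h2 := LinearMap.finrank_range_add_finrank_ker (M y)
  rw [← LinearMap.ker_eq_bot, ← Submodule.finrank_eq_zero (R := ℝ)]
  omega

end LinePoly
end LinePoly

end

section

theorem sum_codimZ_of_interNum_ne_zero {n r s : ℕ} (hrn : r ≤ n) (I : Fin s → Fin r → Fin n)
    (h : interNum I ≠ 0) : ∑ j, codimZ n r (I j) = (r : ℤ) * ((n : ℤ) - r) := by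
  have h1 : HomogZ ((∏ j, schurI (I j)) * alternant r)
      (∑ j, codimZ n r (I j) + ∑ a : Fin r, ((r - 1 - (a : ℕ) : ℕ) : ℤ)) := by
    refine HomogZ.mul (HomogZ.prod _ fun j _ => homogZ_schurI _) ?_
    rw [alternant_eq]
    exact homogZ_altDet _
  have h2 := h1 _ h
  have h3 : (((expo fun a : Fin r => n - 1 - (a : ℕ)).degree : ℕ) : ℤ)
      = ∑ a : Fin r, ((n : ℤ) - r) + ∑ a : Fin r, ((r - 1 - (a : ℕ) : ℕ) : ℤ) := by
    rw [Finsupp.degree_eq_sum, ← Finset.sum_add_distrib]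
    push_cast
    refine Finset.sum_congr rfl fun a _ => ?_
    have := a.2
    change ((n - 1 - (a : ℕ) : ℕ) : ℤ) = _
    omega
  rw [h3] at h2
  simp at h2
  linarith

end

section

section Initial
open MvPolynomial
variable {σ : Type*}

theorem weight_sub_add_single (w : σ → ℕ) {m : σ →₀ ℕ} {u v : σ}
    (h : m u ≠ 0) : Finsupp.weight w (m - Finsupp.single u 1 + Finsupp.single v 1) + w u
      = Finsupp.weight w m + w v := by
  have h1 : m - Finsupp.single u 1 + Finsupp.single u 1 = m :=
    tsub_add_cancel_of_le (Finsupp.single_le_iff.2 (by omega))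
  conv_rhs => rw [← h1]
  simp only [map_add, Finsupp.weight_single, one_smul]
  ring

theorem component_X_mul_pderiv (w : σ → ℕ) {u v : σ} (huv : w u = w v) (k : ℕ)
    (f : MvPolynomial σ ℝ) : weightedHomogeneousComponent w k (X u * pderiv v f)
      = X u * pderiv v (weightedHomogeneousComponent w k f) := by
  classical
  ext m
  rw [coeff_weightedHomogeneousComponent, coeff_X_mul', coeff_X_mul']
  by_cases hu : u ∈ m.support
  · rw [if_pos hu, if_pos hu, coeff_pderiv, coeff_pderiv, coeff_weightedHomogeneousComponent]
    have h1 := weight_sub_add_single w (v := v) (Finsupp.mem_support_iff.1 hu)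
    have h2 : Finsupp.weight w m
        = Finsupp.weight w (m - Finsupp.single u 1 + Finsupp.single v 1) := by omega
    rw [h2, ite_mul, zero_mul]
  · rw [if_neg hu, if_neg hu, ite_self]

theorem component_X_mul_pderiv_of_lt (w : σ → ℕ) {u v : σ} (huv : w v < w u) (k : ℕ)
    (f : MvPolynomial σ ℝ) (hf : ∀ m, coeff m f ≠ 0 → k ≤ Finsupp.weight w m) :
    weightedHomogeneousComponent w k (X u * pderiv v f) = 0 := by
  classical
  ext m
  rw [coeff_weightedHomogeneousComponent, coeff_X_mul', coeff_zero]
  split_ifs with h1 h2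
  · rw [coeff_pderiv]
    have h3 := weight_sub_add_single w (v := v) (Finsupp.mem_support_iff.1 h2)
    have h4 : coeff (m - Finsupp.single u 1 + Finsupp.single v 1) f = 0 := by
      by_contra h
      have := hf _ h
      omega
    rw [h4, zero_mul]
  · rfl
  · rfl

theorem coeff_eq_zero_of_pderiv_eq_zero {f : MvPolynomial σ ℝ} {u : σ} (h : pderiv u f = 0)
    {m : σ →₀ ℕ} (hm : coeff m f ≠ 0) : m u = 0 := by
  classical
  have h1 := coeff_X_mul_pderiv u f m
  rw [h, mul_zero, coeff_zero, eq_comm, mul_eq_zero] at h1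
  exact_mod_cast h1.resolve_right hm

end Initial

theorem LinePoly.coord {ι : Type*} (i : ι) : LinePoly fun x : ι → ℝ => x i :=
  LinePoly.linear (LinearMap.proj (R := ℝ) (φ := fun _ => ℝ) i)

theorem LinePoly.injective_pi {E V ι : Type*} [AddCommGroup E] [Module ℝ E] [AddCommGroup V]
    [Module ℝ V] [Fintype ι] [FiniteDimensional ℝ V] {M : E → V →ₗ[ℝ] (ι → ℝ)}
    (hM : ∀ v i, LinePoly (fun x => M x v i)) (x : E) (hx : Function.Injective (M x)) :
    ∃ p : E → ℝ, LinePoly p ∧ p x ≠ 0 ∧ ∀ y, p y ≠ 0 → Function.Injective (M y) := by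
  classical
  refine LinePoly.injective (fun v ξ => ?_) x hx
  have h1 : (fun x => ξ (M x v)) = fun x => ∑ i, M x v i * ξ (fun j => if i = j then 1 else 0) := by
    funext x
    rw [LinearMap.pi_apply_eq_sum_univ]
    rfl
  rw [h1]
  exact LinePoly.sum _ fun i _ => (hM v i).mul (LinePoly.const _)

section Lowest
open MvPolynomial

/-- The linear system governing the lowest-order part of a highest weight vector. -/
def lowSystem {r s d : ℕ} (K : Fin s → Fin d → Fin r) (x : (Fin s × Fin r) × Fin r → ℝ) :
    (Fin s × Fin d × Fin r → ℝ) →ₗ[ℝ]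
      ((Fin r × Fin r) ⊕ (Fin s × Fin r × Fin d) ⊕ (Fin s × Fin d × Fin r) → ℝ) where
  toFun y := Sum.elim
    (fun pi => ∑ j, ∑ t, x ((j, K j t), pi.1) *
      (if (pi.1 : ℕ) < d ∧ d ≤ (pi.2 : ℕ) then y (j, t, pi.2) else 0))
    (Sum.elim
      (fun jbt => ∑ i : Fin r, x ((jbt.1, jbt.2.1), i) *
        (if d ≤ (i : ℕ) ∧ (∀ t, K jbt.1 t ≠ jbt.2.1) ∧ jbt.2.1 < K jbt.1 jbt.2.2
          then y (jbt.1, jbt.2.2, i) else 0))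
      (fun jti => if (jti.2.2 : ℕ) < d then y jti else 0))
  map_add' y z := by
    ext (u | u | u) <;> simp only [Sum.elim_inl, Sum.elim_inr, Pi.add_apply]
    · simp_rw [← Finset.sum_add_distrib, ← mul_add]
      refine Finset.sum_congr rfl fun j _ => Finset.sum_congr rfl fun t _ => ?_
      split_ifs <;> simp
    · simp_rw [← Finset.sum_add_distrib, ← mul_add]
      refine Finset.sum_congr rfl fun j _ => ?_
      split_ifs <;> simp
    · split_ifs <;> simp
  map_smul' c y := by
    ext (u | u | u) <;> simp only [Sum.elim_inl, Sum.elim_inr, Pi.smul_apply, smul_eq_mul,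
      RingHom.id_apply]
    · simp_rw [Finset.mul_sum]
      refine Finset.sum_congr rfl fun j _ => Finset.sum_congr rfl fun t _ => ?_
      split_ifs <;> ring
    · simp_rw [Finset.mul_sum]
      refine Finset.sum_congr rfl fun j _ => ?_
      split_ifs <;> ring
    · split_ifs <;> simp

theorem linePoly_lowSystem {r s d : ℕ} (K : Fin s → Fin d → Fin r)
    (y : Fin s × Fin d × Fin r → ℝ) (u) : LinePoly (fun x => lowSystem K x y u) := by
  rcases u with u | u | u
  · change LinePoly fun x : (Fin s × Fin r) × Fin r → ℝ => ∑ j, ∑ t, x ((j, K j t), u.1) *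
      (if (u.1 : ℕ) < d ∧ d ≤ (u.2 : ℕ) then y (j, t, u.2) else 0)
    exact LinePoly.sum _ fun j _ => LinePoly.sum _ fun t _ =>
      (LinePoly.coord ((j, K j t), u.1)).mul (LinePoly.const _)
  · change LinePoly fun x : (Fin s × Fin r) × Fin r → ℝ => ∑ i : Fin r, x ((u.1, u.2.1), i) *
        (if d ≤ (i : ℕ) ∧ (∀ t, K u.1 t ≠ u.2.1) ∧ u.2.1 < K u.1 u.2.2
          then y (u.1, u.2.2, i) else 0)
    exact LinePoly.sum _ fun i _ =>
      (LinePoly.coord ((u.1, u.2.1), i)).mul (LinePoly.const _)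
  · exact LinePoly.const _

theorem sum_le_of_isHighest {r s q d : ℕ} {L : Fin s → Fin r → ℕ} (hdr : d ≤ r)
    (K : Fin s → Fin d → Fin r) (hK : ∀ j, Function.Injective (K j))
    {f : MvPolynomial ((Fin s × Fin r) × Fin r) ℝ} (hf : f ≠ 0) (hH : IsHighest q L f)
    {x₀ : (Fin s × Fin r) × Fin r → ℝ} (hx₀ : Function.Injective (lowSystem K x₀)) :
    ∑ j, ∑ t, L j (K j t) ≤ d * q := by
  classical
  let w : (Fin s × Fin r) × Fin r → ℕ := fun u =>
    if (u.2 : ℕ) < d ∧ ∀ t, K u.1.1 t ≠ u.1.2 then 1 else 0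
  have hex : ∃ k, ∃ m, coeff m f ≠ 0 ∧ Finsupp.weight w m = k := by
    obtain ⟨m, hm⟩ := MvPolynomial.ne_zero_iff.1 hf
    exact ⟨_, m, hm, rfl⟩
  let k := Nat.find hex
  have hk : ∀ m, coeff m f ≠ 0 → k ≤ Finsupp.weight w m := fun m hm =>
    Nat.find_min' hex ⟨m, hm, rfl⟩
  obtain ⟨m₀, hm₀, hm₀k⟩ : ∃ m, coeff m f ≠ 0 ∧ Finsupp.weight w m = k := Nat.find_spec hex
  let g := weightedHomogeneousComponent w k f
  have hm₀g : coeff m₀ g ≠ 0 := by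
    have : coeff m₀ g = if Finsupp.weight w m₀ = k then coeff m₀ f else 0 :=
      coeff_weightedHomogeneousComponent _ _ _
    rw [this, if_pos hm₀k]
    exact hm₀
  -- the two families of first order equations
  have hrow : ∀ p i : Fin r, (p : ℕ) < d → d ≤ (i : ℕ) →
      ∑ j, ∑ t, X ((j, K j t), p) * pderiv ((j, K j t), i) g = 0 := by
    intro p i hp hi
    have h1 := hH.row_raise p i (by simp only [Fin.lt_def]; omega)
    have h2 : ∑ c : Fin s × Fin r, weightedHomogeneousComponent w k (X (c, p) * pderiv (c, i) f)
        = 0 := by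
      rw [← map_sum, ← rowD_apply, h1, map_zero]
    rw [← h2, Fintype.sum_prod_type]
    refine Finset.sum_congr rfl fun j _ => ?_
    rw [← Finset.sum_image (f := fun a => X ((j, a), p) * pderiv ((j, a), i) g)
      (fun _ _ _ _ h => hK j h)]
    refine Finset.sum_subset_zero_on_sdiff (Finset.subset_univ _) ?_ ?_
    · intro a ha
      have ha : ∀ t, K j t ≠ a := by simpa using ha
      refine component_X_mul_pderiv_of_lt w ?_ k f hk
      simp only [w]
      rw [if_neg (by simp; omega), if_pos ⟨hp, ha⟩]
      exact one_pos
    · intro a ha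
      obtain ⟨t, -, rfl⟩ := Finset.mem_image.1 ha
      refine (component_X_mul_pderiv w ?_ k f).symm
      simp only [w]
      rw [if_neg fun h => h.2 t rfl, if_neg fun h => h.2 t rfl]
  have hcol : ∀ j b t, (∀ t, K j t ≠ b) → b < K j t →
      ∑ i : Fin r, (if d ≤ (i : ℕ) then X ((j, b), i) * pderiv ((j, K j t), i) g else 0) = 0 := by
    intro j b t hb hbt
    have h1 := hH.col_raise j b (K j t) hbt
    have h2 : ∑ i : Fin r, weightedHomogeneousComponent w k (X ((j, b), i) *
        pderiv ((j, K j t), i) f) = 0 := by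
      rw [← map_sum, ← colD_apply, h1, map_zero]
    refine Eq.trans (Finset.sum_congr rfl fun i _ => ?_) h2
    split_ifs with hi
    · refine (component_X_mul_pderiv w ?_ k f).symm
      simp only [w]
      rw [if_neg (by omega), if_neg (by omega)]
    · refine (component_X_mul_pderiv_of_lt w ?_ k f hk).symm
      simp only [w]
      rw [if_neg (by simp), if_pos ⟨by omega, hb⟩]
      exact one_pos
  -- the derivatives in the lower left block vanish
  have hC : ∀ j t (i : Fin r), d ≤ (i : ℕ) → pderiv ((j, K j t), i) g = 0 := by
    intro j t i hi
    by_contra hne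
    obtain ⟨P, hP, hPx, hPi⟩ := LinePoly.injective_pi (linePoly_lowSystem K) x₀ hx₀
    obtain ⟨x, hx⟩ : ∃ x, eval x (pderiv ((j, K j t), i) g) ≠ 0 := by
      by_contra! h
      exact hne (MvPolynomial.funext fun x => by rw [h, map_zero])
    obtain ⟨z, hz1, hz2⟩ := LinePoly.exists_ne_zero hP
      (LinePoly.mvPolynomial (pderiv ((j, K j t), i) g)) hPx hx
    let y : Fin s × Fin d × Fin r → ℝ := fun u =>
      if d ≤ (u.2.2 : ℕ) then eval z (pderiv ((u.1, K u.1 u.2.1), u.2.2) g) else 0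
    have hy : lowSystem K z y = 0 := by
      ext (⟨p, i⟩ | ⟨j, b, t⟩ | ⟨j, t, i⟩)
      · change ∑ j, ∑ t, z ((j, K j t), p) *
          (if (p : ℕ) < d ∧ d ≤ (i : ℕ) then y (j, t, i) else 0) = 0
        by_cases h : (p : ℕ) < d ∧ d ≤ (i : ℕ)
        · have h1 := congrArg (eval z) (hrow p i h.1 h.2)
          simp only [map_sum, map_mul, eval_X, map_zero] at h1
          simp only [h, y, and_self, if_true]
          exact h1
        · simp [h]
      · change ∑ i : Fin r, z ((j, b), i) *
          (if d ≤ (i : ℕ) ∧ (∀ t, K j t ≠ b) ∧ b < K j t then y (j, t, i) else 0) = 0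
        by_cases h : (∀ t, K j t ≠ b) ∧ b < K j t
        · have h1 := congrArg (eval z) (hcol j b t h.1 h.2)
          rw [map_sum, map_zero] at h1
          refine Eq.trans (Finset.sum_congr rfl fun i _ => ?_) h1
          by_cases hi : d ≤ (i : ℕ)
          · simp [hi, h, y]
          · simp [hi]
        · refine Finset.sum_eq_zero fun i _ => ?_
          rw [if_neg fun h' => h h'.2, mul_zero]
      · change (if (i : ℕ) < d then y (j, t, i) else 0) = 0
        by_cases h : (i : ℕ) < d
        · simp [y, h]
        · simp [h]
    have h0 : y = 0 := hPi z hz1 (by rw [hy, map_zero])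
    have h1 := congrFun h0 (j, t, i)
    simp only [y, hi, if_true, Pi.zero_apply] at h1
    exact hz2 h1
  have hmC : ∀ j t (i : Fin r), d ≤ (i : ℕ) → m₀ ((j, K j t), i) = 0 := fun j t i hi =>
    coeff_eq_zero_of_pderiv_eq_zero (hC j t i hi) hm₀g
  calc ∑ j, ∑ t, L j (K j t)
      = ∑ j, ∑ t, ∑ i : Fin r, if (i : ℕ) < d then m₀ ((j, K j t), i) else 0 := by
        refine Finset.sum_congr rfl fun j _ => Finset.sum_congr rfl fun t _ => ?_
        rw [← hH.col_sum m₀ hm₀ (j, K j t)]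
        refine Finset.sum_congr rfl fun i _ => ?_
        split_ifs with h
        · rfl
        · exact hmC j t i (by omega)
    _ ≤ ∑ j, ∑ a : Fin r, ∑ i : Fin r, if (i : ℕ) < d then m₀ ((j, a), i) else 0 := by
        refine Finset.sum_le_sum fun j _ => ?_
        rw [← Finset.sum_image
          (f := fun a => ∑ i : Fin r, if (i : ℕ) < d then m₀ ((j, a), i) else 0)
          (fun _ _ _ _ h => hK j h)]
        exact Finset.sum_le_sum_of_subset (Finset.subset_univ _)
    _ = ∑ i : Fin r, if (i : ℕ) < d then q else 0 := by
        rw [← Fintype.sum_prod_type', Finset.sum_comm]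
        refine Finset.sum_congr rfl fun i _ => ?_
        split_ifs with h
        · exact hH.row_sum m₀ hm₀ i
        · simp
    _ = d * q := by
        rw [← Finset.sum_filter, Finset.sum_const, smul_eq_mul]
        congr 1
        rw [Fin.card_filter_val_lt]
        omega

end Lowest

end

section

theorem sum_sum_comm {α β γ δ M : Type*} [Fintype α] [Fintype β] [Fintype γ] [Fintype δ]
    [AddCommMonoid M] (F : α → β → γ → δ → M) :
    ∑ a, ∑ b, ∑ c, ∑ d, F a b c d = ∑ c, ∑ d, ∑ a, ∑ b, F a b c d := by
  have := Finset.sum_comm (s := (Finset.univ : Finset (α × β)))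
    (t := (Finset.univ : Finset (γ × δ))) (f := fun x y => F x.1 x.2 y.1 y.2)
  simpa only [Fintype.sum_prod_type] using this

section Rigid

/-- The linear conditions `ℓ_b (φ v_a) = 0` for `m_a ≤ b` on linear maps `φ`. -/
def condMap {s r q : ℕ} {V Q : Type*} [AddCommGroup V] [Module ℝ V] [AddCommGroup Q] [Module ℝ Q]
    (m : Fin s → Fin r → ℕ) (v : Fin s → Fin r → V) (l : Fin s → Fin q → Dual ℝ Q) :
    (V →ₗ[ℝ] Q) →ₗ[ℝ] ({x : Fin s × Fin r × Fin q // m x.1 x.2.1 ≤ (x.2.2 : ℕ)} → ℝ) :=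
  LinearMap.pi fun x => (l x.1.1 x.1.2.2) ∘ₗ LinearMap.applyₗ (v x.1.1 x.1.2.1)

variable {s r q : ℕ} {V Q : Type*} [AddCommGroup V] [Module ℝ V] [AddCommGroup Q] [Module ℝ Q]

theorem condMap_apply (m : Fin s → Fin r → ℕ) (v : Fin s → Fin r → V) (l : Fin s → Fin q → Dual ℝ Q)
    (φ : V →ₗ[ℝ] Q) (x) : condMap m v l φ x = l x.1.1 x.1.2.2 (φ (v x.1.1 x.1.2.1)) := rfl

theorem condMap_eq_zero {m : Fin s → Fin r → ℕ} {v : Fin s → Fin r → V}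
    {l : Fin s → Fin q → Dual ℝ Q} {φ : V →ₗ[ℝ] Q} : condMap m v l φ = 0 ↔
      ∀ j a (b : Fin q), m j a ≤ (b : ℕ) → l j b (φ (v j a)) = 0 :=
  ⟨fun h j a b hb => congrFun h ⟨(j, a, b), hb⟩, fun h => funext fun x => h _ _ _ x.2⟩

theorem card_filter_val_ge (q k : ℕ) :
    (Finset.univ.filter fun b : Fin q => k ≤ (b : ℕ)).card = q - k := by
  have h1 := Finset.card_filter_add_card_filter_not (s := (Finset.univ : Finset (Fin q)))
    (fun b => (b : ℕ) < k)
  rw [Fin.card_filter_val_lt, Finset.card_univ, Fintype.card_fin] at h1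
  simp only [not_lt] at h1
  omega

theorem card_cond (m : Fin s → Fin r → ℕ) :
    Fintype.card {x : Fin s × Fin r × Fin q // m x.1 x.2.1 ≤ (x.2.2 : ℕ)}
      = ∑ j, ∑ a, (q - m j a) := by
  classical
  rw [Fintype.card_subtype, Finset.card_filter, Fintype.sum_prod_type]
  refine Finset.sum_congr rfl fun j _ => ?_
  rw [Fintype.sum_prod_type]
  refine Finset.sum_congr rfl fun a _ => ?_
  rw [← Finset.card_filter]
  exact card_filter_val_ge q (m j a)

/-- The existence of flags for which no nonzero linear map satisfies the conditions. -/
def GenericallyRigid {s r : ℕ} (q : ℕ) (m : Fin s → Fin r → ℕ) : Prop :=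
  ∃ (v : Fin s → Fin r → Fin r → ℝ) (l : Fin s → Fin q → Dual ℝ (Fin q → ℝ)),
    Function.Injective (condMap m v l)

theorem GenericallyRigid.exists_dual {m : Fin s → Fin r → ℕ} (h : GenericallyRigid q m) :
    ∃ (v : Fin s → Fin r → Fin r → ℝ) (l : Fin s → Fin q → Dual ℝ (Fin q → ℝ))
      (D : Fin s → Fin q → Fin q → ℝ), Function.Injective (condMap m v l) ∧
      ∀ j (x : Fin q → ℝ), ∑ b, l j b x • D j b = x := by
  classical
  obtain ⟨v, l, hvl⟩ := h
  obtain ⟨p, hp, hpl, hpi⟩ := LinePoly.injective_pi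
    (E := Fin s → Fin q → Dual ℝ (Fin q → ℝ)) (M := fun l => condMap m v l)
    (fun φ x => LinePoly.linear (LinearMap.applyₗ (φ (v x.1.1 x.1.2.1)) ∘ₗ
      LinearMap.proj (R := ℝ) (φ := fun _ => Dual ℝ (Fin q → ℝ)) x.1.2.2 ∘ₗ
        LinearMap.proj (R := ℝ) (φ := fun _ => Fin q → Dual ℝ (Fin q → ℝ)) x.1.1)) l hvl
  let A : (Fin s → Fin q → Dual ℝ (Fin q → ℝ)) → Fin s → Matrix (Fin q) (Fin q) ℝ :=
    fun l j => Matrix.of fun b c => l j b (Pi.single c 1)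
  have hA : LinePoly fun l => ∏ j, (A l j).det := by
    refine LinePoly.prod _ fun j _ => LinePoly.det fun b c => ?_
    exact LinePoly.linear (LinearMap.applyₗ (Pi.single c 1) ∘ₗ
      LinearMap.proj (R := ℝ) (φ := fun _ => Dual ℝ (Fin q → ℝ)) b ∘ₗ
        LinearMap.proj (R := ℝ) (φ := fun _ => Fin q → Dual ℝ (Fin q → ℝ)) j)
  obtain ⟨l', h1, h2⟩ := LinePoly.exists_ne_zero hp hA hpl
    (y := fun _ b => LinearMap.proj (R := ℝ) (φ := fun _ => ℝ) b) (by
      refine Finset.prod_ne_zero_iff.2 fun j _ => ?_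
      have : A (fun _ b => LinearMap.proj (R := ℝ) (φ := fun _ => ℝ) b) j = 1 := by
        ext b c
        simp [A, Matrix.one_apply, Pi.single_apply]
      rw [this, Matrix.det_one]
      exact one_ne_zero)
  refine ⟨v, l', fun j b c => (A l' j)⁻¹ c b, hpi _ h1, fun j x => ?_⟩
  have h3 := Matrix.nonsing_inv_mul (A l' j)
    (isUnit_iff_ne_zero.2 (Finset.prod_ne_zero_iff.1 h2 j (Finset.mem_univ _)))
  have h4 : ∀ b, l' j b x = (A l' j).mulVec x b := by
    intro b
    rw [LinearMap.pi_apply_eq_sum_univ]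
    refine Finset.sum_congr rfl fun c _ => ?_
    rw [smul_eq_mul, mul_comm]
    change _ = l' j b (Pi.single c 1) * x c
    congr 2
    funext d
    simp [Pi.single_apply, eq_comm]
  have h5 : (A l' j)⁻¹.mulVec ((A l' j).mulVec x) = x := by
    rw [Matrix.mulVec_mulVec, h3, Matrix.one_mulVec]
  conv_rhs => rw [← h5]
  ext c
  rw [Finset.sum_apply]
  refine Finset.sum_congr rfl fun b _ => ?_
  rw [Pi.smul_apply, smul_eq_mul, h4, mul_comm]

theorem eq_zero_of_dual_conditions {m : Fin s → Fin r → ℕ} {v : Fin s → Fin r → Fin r → ℝ}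
    {l : Fin s → Fin q → Dual ℝ (Fin q → ℝ)} {D : Fin s → Fin q → Fin q → ℝ}
    (hs : Function.Surjective (condMap m v l)) (hD : ∀ j (x : Fin q → ℝ), ∑ b, l j b x • D j b = x)
    {y : Fin s → Fin r → Fin q → ℝ} (h1 : ∀ p i, ∑ j, ∑ a, v j a p * y j a i = 0)
    (h2 : ∀ j a (b : Fin q), (b : ℕ) < m j a → ∑ i, D j b i * y j a i = 0) : y = 0 := by
  classical
  obtain ⟨φ, hφ⟩ := hs fun x => ∑ i, D x.1.1 x.1.2.2 i * y x.1.1 x.1.2.1 i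
  have hφ' : ∀ j a (b : Fin q), m j a ≤ b → l j b (φ (v j a)) = ∑ i, D j b i * y j a i :=
    fun j a b hb => congrFun hφ ⟨(j, a, b), hb⟩
  have h3 : ∀ j a, ∑ i, φ (v j a) i * y j a i = ∑ b, (∑ i, D j b i * y j a i) ^ 2 := by
    intro j a
    conv_lhs => rw [← hD j (φ (v j a))]
    simp_rw [Finset.sum_apply, Finset.sum_mul]
    rw [Finset.sum_comm]
    refine Finset.sum_congr rfl fun b _ => ?_
    simp_rw [Pi.smul_apply, smul_eq_mul, mul_assoc]
    rw [← Finset.mul_sum, sq]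
    by_cases hb : m j a ≤ b
    · rw [hφ' j a b hb]
    · rw [h2 j a b (by omega), mul_zero, mul_zero]
  have h4 : ∑ j, ∑ a, ∑ i, φ (v j a) i * y j a i = 0 := by
    have h5 : ∀ j a i, φ (v j a) i = ∑ p, v j a p * φ (fun c => if p = c then 1 else 0) i := by
      intro j a i
      rw [LinearMap.pi_apply_eq_sum_univ φ (v j a), Finset.sum_apply]
      rfl
    simp_rw [h5, Finset.sum_mul]
    calc _ = ∑ i, ∑ p, φ (fun c => if p = c then 1 else 0) i * ∑ j, ∑ a, v j a p * y j a i := by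
          simp_rw [Finset.mul_sum]
          rw [sum_sum_comm]
          refine Finset.sum_congr rfl fun i _ => Finset.sum_congr rfl fun p _ =>
            Finset.sum_congr rfl fun j _ => Finset.sum_congr rfl fun a _ => ?_
          ring
      _ = 0 := by simp [h1]
  simp_rw [h3] at h4
  have h6 : ∀ j a b, ∑ i, D j b i * y j a i = 0 := by
    intro j a b
    have h7 := (Finset.sum_eq_zero_iff_of_nonneg (fun j _ => Finset.sum_nonneg fun a _ =>
      Finset.sum_nonneg fun b _ => sq_nonneg _)).1 h4 j (Finset.mem_univ _)
    have h8 := (Finset.sum_eq_zero_iff_of_nonneg (fun a _ =>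
      Finset.sum_nonneg fun b _ => sq_nonneg _)).1 h7 a (Finset.mem_univ _)
    have h9 := (Finset.sum_eq_zero_iff_of_nonneg (fun b _ => sq_nonneg _)).1 h8 b
      (Finset.mem_univ _)
    exact pow_eq_zero_iff (two_ne_zero) |>.1 h9
  ext j a i
  have h7 := hD j (Pi.single i 1)
  have h8 : y j a i = ∑ i', (Pi.single i 1 : Fin q → ℝ) i' * y j a i' := by
    simp [Pi.single_apply]
  rw [h8, ← h7]
  simp_rw [Finset.sum_apply, Finset.sum_mul]
  rw [Finset.sum_comm]
  refine Finset.sum_eq_zero fun b _ => ?_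
  simp_rw [Pi.smul_apply, smul_eq_mul, mul_assoc]
  rw [← Finset.mul_sum, h6, mul_zero]

end Rigid

theorem exists_complement {d r : ℕ} {K : Fin d → Fin r} (hK : StrictMono K) :
    ∃ c : Fin (r - d) → Fin r, StrictMono c ∧ (∀ t b, K t ≠ c b) ∧
      ∀ a, (∃ t, K t = a) ∨ ∃ b, c b = a := by
  classical
  have hcard : (Finset.univ.image K)ᶜ.card = r - d := by
    rw [Finset.card_compl, Finset.card_image_of_injective _ hK.injective]
    simp
  refine ⟨(Finset.univ.image K)ᶜ.orderEmbOfFin hcard, OrderEmbedding.strictMono _, ?_, ?_⟩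
  · intro t b h
    have := Finset.orderEmbOfFin_mem _ hcard b
    rw [← h] at this
    simp at this
  · intro a
    by_cases h : a ∈ (Finset.univ.image K)ᶜ
    · right
      have : a ∈ Set.range ((Finset.univ.image K)ᶜ.orderEmbOfFin hcard) := by
        rw [Finset.range_orderEmbOfFin]
        exact h
      exact this
    · left
      simpa using h

theorem complement_lt_iff {d r e : ℕ} {K : Fin d → Fin r} (hK : StrictMono K)
    {c : Fin e → Fin r} (hc : StrictMono c) (hd : ∀ t b, K t ≠ c b)
    (hcov : ∀ a, (∃ t, K t = a) ∨ ∃ b, c b = a) (t : Fin d) (b : Fin e) :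
    c b < K t ↔ (b : ℕ) < (K t : ℕ) - t := by
  classical
  have hIio : ∀ {n : ℕ} (a : Fin n), (Finset.univ.filter fun u => u < a) = Finset.Iio a :=
    fun a => by ext; simp
  have hIic : ∀ {n : ℕ} (a : Fin n), (Finset.univ.filter fun u => u ≤ a) = Finset.Iic a :=
    fun a => by ext; simp
  let S : Finset (Fin e) := Finset.univ.filter fun b => c b < K t
  have h1 : (Finset.univ.filter fun a => a < K t)
      = (Finset.univ.filter fun u => u < t).image K ∪ S.image c := by
    ext a
    simp only [Finset.mem_filter, Finset.mem_univ, true_and, Finset.mem_union, Finset.mem_image, S]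
    constructor
    · intro h
      rcases hcov a with ⟨u, rfl⟩ | ⟨b, rfl⟩
      · exact Or.inl ⟨u, hK.lt_iff_lt.1 h, rfl⟩
      · exact Or.inr ⟨b, h, rfl⟩
    · rintro (⟨u, h, rfl⟩ | ⟨b, h, rfl⟩)
      · exact hK h
      · exact h
  have h2 := congrArg Finset.card h1
  rw [Finset.card_union_of_disjoint, Finset.card_image_of_injective _ hK.injective,
    Finset.card_image_of_injective _ hc.injective] at h2
  · simp only [hIio, Fin.card_Iio] at h2
    have h3 : S.card = (K t : ℕ) - t := by omega
    rw [← h3]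
    constructor
    · intro h
      have h4 : (Finset.univ.filter fun b' => b' ≤ b) ⊆ S := by
        intro b' hb'
        simp only [Finset.mem_filter, Finset.mem_univ, true_and, S] at *
        exact (hc.monotone hb').trans_lt h
      have h5 := Finset.card_le_card h4
      simp only [hIic, Fin.card_Iic] at h5
      omega
    · intro h
      by_contra h'
      have h4 : S ⊆ (Finset.univ.filter fun b' => b' < b) := by
        intro b' hb'
        simp only [Finset.mem_filter, Finset.mem_univ, true_and, S] at *
        by_contra h6
        exact h' ((hc.monotone (not_lt.1 h6)).trans_lt hb')
      have h5 := Finset.card_le_card h4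
      simp only [hIio, Fin.card_Iio] at h5
      omega
  · rw [Finset.disjoint_left]
    intro a ha hb
    obtain ⟨u, -, rfl⟩ := Finset.mem_image.1 ha
    obtain ⟨b, -, h⟩ := Finset.mem_image.1 hb
    exact hd u b h.symm

theorem exists_lowSystem_injective {r s d : ℕ} (hdr : d < r) {K : Fin s → Fin d → Fin r}
    (hK : ∀ j, StrictMono (K j))
    (hrig : GenericallyRigid (r - d) fun j t => (K j t : ℕ) - (t : ℕ))
    (hdim : ∑ j, ∑ t, ((r - d) - ((K j t : ℕ) - (t : ℕ))) = d * (r - d)) :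
    ∃ x₀, Function.Injective (lowSystem K x₀) := by
  classical
  obtain ⟨v, l, D, hinj, hD⟩ := hrig.exists_dual
  have hs : Function.Surjective (condMap (fun j t => (K j t : ℕ) - (t : ℕ)) v l) := by
    refine (LinearMap.injective_iff_surjective_of_finrank_eq_finrank ?_).1 hinj
    rw [finrank_linearMap, finrank_pi, finrank_pi, finrank_pi,
      card_cond (q := r - d) fun j (t : Fin d) => (K j t : ℕ) - (t : ℕ), hdim]
    simp
  choose c hc hdis hcov using fun j => exists_complement (hK j)
  let x₀ : (Fin s × Fin r) × Fin r → ℝ := fun u =>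
    if h : (u.2 : ℕ) < d then
      if h' : ∃ t, K u.1.1 t = u.1.2 then v u.1.1 h'.choose ⟨u.2, h⟩ else 0
    else if h' : ∃ b, c u.1.1 b = u.1.2 then D u.1.1 h'.choose ⟨u.2 - d, by omega⟩ else 0
  have hx1 : ∀ j t (p : Fin r) (hp : (p : ℕ) < d), x₀ ((j, K j t), p) = v j t ⟨p, hp⟩ := by
    intro j t p hp
    have h' : ∃ t', K j t' = K j t := ⟨t, rfl⟩
    have : h'.choose = t := (hK j).injective h'.choose_spec
    simp only [x₀, hp, dite_true, h', this]
  have hx2 : ∀ j b (i : Fin (r - d)), x₀ ((j, c j b), ⟨d + i, by omega⟩) = D j b i := by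
    intro j b i
    have h' : ∃ b', c j b' = c j b := ⟨b, rfl⟩
    have : h'.choose = b := (hc j).injective h'.choose_spec
    simp [x₀, h', this]
  refine ⟨x₀, (injective_iff_map_eq_zero _).2 fun y hy => ?_⟩
  have hy0 : (fun j t (i : Fin (r - d)) => y (j, t, ⟨d + i, by omega⟩)) = 0 := by
    refine eq_zero_of_dual_conditions hs hD ?_ ?_
    · intro p i
      have h1 := congrFun hy (Sum.inl (⟨p, by omega⟩, ⟨d + i, by omega⟩))
      change ∑ j, ∑ t, x₀ ((j, K j t), ⟨p, by omega⟩) *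
        (if (p : ℕ) < d ∧ d ≤ d + (i : ℕ) then y (j, t, ⟨d + i, by omega⟩) else 0) = 0 at h1
      rw [← h1]
      refine Finset.sum_congr rfl fun j _ => Finset.sum_congr rfl fun t _ => ?_
      rw [hx1 j t ⟨p, by omega⟩ p.2, if_pos ⟨p.2, by omega⟩]
    · intro j t b hb
      have h1 := congrFun hy (Sum.inr (Sum.inl (j, c j b, t)))
      change ∑ i : Fin r, x₀ ((j, c j b), i) *
        (if d ≤ (i : ℕ) ∧ (∀ t, K j t ≠ c j b) ∧ c j b < K j t then y (j, t, i) else 0) = 0 at h1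
      have h2 := (complement_lt_iff (hK j) (hc j) (hdis j) (hcov j) t b).2 hb
      have h3 : ∑ i ∈ Finset.univ.filter (fun i : Fin r => d ≤ (i : ℕ)),
          x₀ ((j, c j b), i) * y (j, t, i) = 0 := by
        rw [Finset.sum_filter]
        refine Eq.trans (Finset.sum_congr rfl fun i _ => ?_) h1
        by_cases hi : d ≤ (i : ℕ)
        · rw [if_pos hi, if_pos ⟨hi, fun t => hdis j t b, h2⟩]
        · rw [if_neg hi, if_neg fun h => hi h.1, mul_zero]
      rw [← h3]
      refine Finset.sum_bij (fun i _ => ⟨d + i, by omega⟩) ?_ ?_ ?_ ?_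
      · intro i _
        simp
      · intro i _ i' _ h
        simpa [Fin.ext_iff] using h
      · intro i hi
        simp only [Finset.mem_filter, Finset.mem_univ, true_and] at hi
        exact ⟨⟨i - d, by omega⟩, Finset.mem_univ _, by simp [Fin.ext_iff]; omega⟩
      · intro i _
        rw [hx2]
  ext ⟨j, t, i⟩
  by_cases hi : (i : ℕ) < d
  · have h1 := congrFun hy (Sum.inr (Sum.inr (j, t, i)))
    change (if (i : ℕ) < d then y (j, t, i) else 0) = 0 at h1
    rwa [if_pos hi] at h1
  · have h1 := congrFun (congrFun (congrFun hy0 j) t) ⟨i - d, by omega⟩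
    simp only [Pi.zero_apply] at h1 ⊢
    rw [← h1]
    congr 3
    ext
    dsimp only
    omega

end

section

section DetDerivation
variable {R A : Type*} [CommRing R] [CommRing A] [Algebra R A]

theorem derivation_prod {ι : Type*} [DecidableEq ι] (D : Derivation R A A) (s : Finset ι)
    (f : ι → A) : D (∏ i ∈ s, f i) = ∑ i ∈ s, D (f i) * ∏ k ∈ s.erase i, f k := by
  induction s using Finset.induction with
  | empty => simp
  | insert a s ha ih =>
    rw [Finset.prod_insert ha, D.leibniz, ih, Finset.sum_insert ha, Finset.erase_insert ha,
      smul_eq_mul, smul_eq_mul, Finset.mul_sum, add_comm, mul_comm (∏ i ∈ s, f i)]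
    congr 1
    refine Finset.sum_congr rfl fun i hi => ?_
    have hia : a ≠ i := by rintro rfl; exact ha hi
    rw [Finset.erase_insert_of_ne hia, Finset.prod_insert fun h => ha (Finset.mem_of_mem_erase h)]
    ring

theorem derivation_det {ι : Type*} [DecidableEq ι] [Fintype ι] (D : Derivation R A A)
    (M : Matrix ι ι A) : D M.det = ∑ c, (M.updateCol c fun i => D (M i c)).det := by
  simp_rw [Matrix.det_apply, map_sum]
  rw [Finset.sum_comm]
  refine Finset.sum_congr rfl fun σ _ => ?_
  rw [Units.smul_def, map_zsmul, derivation_prod, Finset.smul_sum]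
  refine Finset.sum_congr rfl fun c _ => ?_
  rw [Units.smul_def, ← Finset.mul_prod_erase _ _ (Finset.mem_univ c), Matrix.updateCol_self]
  congr 2
  refine Finset.prod_congr rfl fun k hk => ?_
  rw [Matrix.updateCol_ne (Finset.ne_of_mem_erase hk)]

theorem derivation_det_eq_zero {ι : Type*} [DecidableEq ι] [Fintype ι] (D : Derivation R A A)
    (M : Matrix ι ι A)
    (h : ∀ c, (∀ i, D (M i c) = 0) ∨ ∃ c', c' ≠ c ∧ ∀ i, D (M i c) = M i c') : D M.det = 0 := by
  rw [derivation_det]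
  refine Finset.sum_eq_zero fun c _ => ?_
  rcases h c with h | ⟨c', hc, h⟩
  · refine Matrix.det_eq_zero_of_column_eq_zero c fun i => ?_
    rw [Matrix.updateCol_self, h]
  · refine Matrix.det_zero_of_column_eq hc fun i => ?_
    rw [Matrix.updateCol_self, Matrix.updateCol_ne hc, h]

end DetDerivation

section Alpha
open MvPolynomial

theorem isWeightedHomogeneous_det {σ ι : Type*} [DecidableEq ι] [Fintype ι] {w : σ → ℕ}
    {M : Matrix ι ι (MvPolynomial σ ℝ)} {n : ι → ℕ}
    (h : ∀ i c, IsWeightedHomogeneous w (M i c) (n c)) :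
    IsWeightedHomogeneous w M.det (∑ c, n c) := by
  rw [Matrix.det_apply]
  refine IsWeightedHomogeneous.sum _ _ _ fun τ _ => ?_
  rw [← mem_weightedHomogeneousSubmodule, Units.smul_def]
  exact zsmul_mem ((mem_weightedHomogeneousSubmodule ..).2
    (IsWeightedHomogeneous.prod _ _ _ fun i _ => h _ i)) _

theorem weight_indicator {σ : Type*} [Fintype σ] (P : σ → Prop) [DecidablePred P] (m : σ →₀ ℕ) :
    Finsupp.weight (fun u => if P u then 1 else 0) m = ∑ u, if P u then m u else 0 := by
  rw [Finsupp.weight_apply, Finsupp.sum_fintype _ _ (by simp)]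
  simp

theorem GenericallyRigid.exists_isHighest {r s q : ℕ} {m : Fin s → Fin r → ℕ}
    (hm : ∀ j, Monotone (m j)) (h : GenericallyRigid q m)
    (hdim : ∑ j, ∑ a, (q - m j a) = r * q) :
    ∃ f, f ≠ 0 ∧ IsHighest q (fun j a => q - m j a) f := by
  classical
  obtain ⟨v, l, hinj⟩ := h
  let R := {x : Fin s × Fin r × Fin q // m x.1 x.2.1 ≤ (x.2.2 : ℕ)}
  have hcard : Fintype.card R = Fintype.card (Fin r × Fin q) := by
    rw [card_cond, hdim]
    simp
  let e : (Fin r × Fin q) ≃ R := (Fintype.equivOfCardEq hcard).symm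
  let M : Matrix (Fin r × Fin q) (Fin r × Fin q) (MvPolynomial ((Fin s × Fin r) × Fin r) ℝ) :=
    Matrix.of fun i c => C (l (e i).1.1 (e i).1.2.2 (Pi.single c.2 1)) *
      X (((e i).1.1, (e i).1.2.1), c.1)
  have hM : ∀ i c, M i c = C (l (e i).1.1 (e i).1.2.2 (Pi.single c.2 1)) *
      X (((e i).1.1, (e i).1.2.1), c.1) := fun _ _ => rfl
  refine ⟨M.det, ?_, ?_, ?_, ?_, ?_⟩
  · intro h0
    have h1 : (M.map (eval fun u => v u.1.1 u.1.2 u.2)).det = 0 := by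
      rw [← RingHom.mapMatrix_apply, ← RingHom.map_det, h0, map_zero]
    obtain ⟨y, hy, hy0⟩ := Matrix.exists_mulVec_eq_zero_iff.2 h1
    let φ : (Fin r → ℝ) →ₗ[ℝ] (Fin q → ℝ) := Matrix.mulVecLin (Matrix.of fun c p => y (p, c))
    have hφ0 : φ ≠ 0 := by
      intro h
      apply hy
      funext ⟨p, c⟩
      have := congrFun (LinearMap.congr_fun h (Pi.single p 1)) c
      simpa [φ] using this
    apply hφ0
    apply hinj
    rw [map_zero]
    refine condMap_eq_zero.2 fun j a b hb => ?_
    obtain ⟨i, hi⟩ := e.surjective ⟨(j, a, b), hb⟩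
    have h2 := congrFun hy0 i
    rw [Pi.zero_apply, Matrix.mulVec, dotProduct, Fintype.sum_prod_type] at h2
    simp only [Matrix.map_apply, hM, hi, map_mul, eval_C, eval_X] at h2
    rw [LinearMap.pi_apply_eq_sum_univ]
    refine Eq.trans (Finset.sum_congr rfl fun c _ => ?_) (Finset.sum_comm.trans h2)
    simp only [φ, Matrix.mulVecLin_apply, Matrix.mulVec, dotProduct, Matrix.of_apply, smul_eq_mul,
      Finset.sum_mul]
    refine Finset.sum_congr rfl fun p _ => ?_
    have : (fun d => if c = d then (1 : ℝ) else 0) = Pi.single c 1 := by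
      funext d
      simp [Pi.single_apply, eq_comm]
    rw [this]
    ring
  · intro mm hmm p
    have h1 : IsWeightedHomogeneous (fun u : (Fin s × Fin r) × Fin r => if u.2 = p then 1 else 0)
        M.det (∑ c : Fin r × Fin q, if c.1 = p then 1 else 0) := by
      refine isWeightedHomogeneous_det fun i c => ?_
      rw [hM, ← zero_add (ite _ _ _)]
      exact (isWeightedHomogeneous_C _ _).mul (isWeightedHomogeneous_X _ _ _)
    have h2 := h1 hmm
    rw [weight_indicator (fun u : (Fin s × Fin r) × Fin r => u.2 = p)] at h2
    have h3 : ∑ c : Fin r × Fin q, (if c.1 = p then 1 else 0) = q := by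
      rw [Fintype.sum_prod_type, Finset.sum_comm]
      simp
    rw [h3, Fintype.sum_prod_type] at h2
    rw [← h2]
    simp [Fintype.sum_prod_type]
  · intro mm hmm c
    have h1 : IsWeightedHomogeneous (fun u : (Fin s × Fin r) × Fin r => if u.1 = c then 1 else 0)
        M.transpose.det (∑ i, if ((e i).1.1, (e i).1.2.1) = c then 1 else 0) := by
      refine isWeightedHomogeneous_det fun i c => ?_
      rw [Matrix.transpose_apply, hM, ← zero_add (ite _ _ _)]
      exact (isWeightedHomogeneous_C _ _).mul (isWeightedHomogeneous_X _ _ _)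
    rw [Matrix.det_transpose] at h1
    have h2 := h1 hmm
    rw [weight_indicator (fun u : (Fin s × Fin r) × Fin r => u.1 = c)] at h2
    have h3 : ∑ i, (if ((e i).1.1, (e i).1.2.1) = c then 1 else 0) = q - m c.1 c.2 := by
      rw [Equiv.sum_comp e (fun x => if (x.1.1, x.1.2.1) = c then 1 else 0),
        ← Finset.sum_subtype (Finset.univ.filter fun x : Fin s × Fin r × Fin q =>
          m x.1 x.2.1 ≤ (x.2.2 : ℕ)) (by simp) (fun x => if (x.1, x.2.1) = c then 1 else 0),
        Finset.sum_filter, Fintype.sum_prod_type, Finset.sum_eq_single c.1, Fintype.sum_prod_type,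
        Finset.sum_eq_single c.2]
      · rw [← card_filter_val_ge, Finset.card_filter]
        simp
      · intro a _ ha
        refine Finset.sum_eq_zero fun b _ => ?_
        rw [if_neg fun h => ha (congrArg Prod.snd h), ite_self]
      · simp
      · intro j _ hj
        refine Finset.sum_eq_zero fun x _ => ?_
        rw [if_neg fun h => hj (congrArg Prod.fst h), ite_self]
      · simp
    rw [h3, Fintype.sum_prod_type] at h2
    rw [← h2, Finset.sum_eq_single c]
    · simp
    · intro c' _ hc
      simp [hc]
    · simp
  · intro i j hij
    refine derivation_det_eq_zero _ _ fun c => ?_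
    have h1 : ∀ x, rowD (Fin s × Fin r) i j (M x c)
        = if c.1 = j then M x (i, c.2) else 0 := by
      intro x
      rw [hM, Derivation.leibniz, rowD_X, hM, ← algebraMap_eq, Derivation.map_algebraMap]
      split_ifs <;> simp
    by_cases hc : c.1 = j
    · refine Or.inr ⟨(i, c.2), fun h => hij.ne ?_, fun x => by rw [h1, if_pos hc]⟩
      rw [← hc, ← h]
    · exact Or.inl fun x => by rw [h1, if_neg hc]
  · intro t a b hab
    rw [← Matrix.det_transpose]
    refine derivation_det_eq_zero _ _ fun c => ?_
    have h1 : ∀ x, colD (Fin r) (t, a) (t, b) (M.transpose x c)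
        = if ((e c).1.1, (e c).1.2.1) = (t, b) then
          C (l (e c).1.1 (e c).1.2.2 (Pi.single x.2 1)) * X ((t, a), x.1) else 0 := by
      intro x
      rw [Matrix.transpose_apply, hM, Derivation.leibniz, colD_X, ← algebraMap_eq,
        Derivation.map_algebraMap]
      split_ifs <;> simp
    by_cases hc : ((e c).1.1, (e c).1.2.1) = (t, b)
    · obtain ⟨ht, hb⟩ := Prod.mk.inj hc
      have hle : m t a ≤ ((e c).1.2.2 : ℕ) := by
        have h2 := (e c).2
        rw [ht, hb] at h2
        exact (hm t hab.le).trans h2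
      refine Or.inr ⟨e.symm ⟨(t, a, (e c).1.2.2), hle⟩, ?_, fun x => ?_⟩
      · intro h
        rw [Equiv.symm_apply_eq] at h
        rw [← h] at hb
        exact hab.ne hb
      · rw [h1, if_pos hc, Matrix.transpose_apply, hM, Equiv.apply_symm_apply, ht]
    · exact Or.inl fun x => by rw [h1, if_neg hc]

end Alpha

end

section

section Echelon

variable {V W : Type*} [AddCommGroup V] [Module ℝ V] [AddCommGroup W] [Module ℝ W]

/-- The indices at which a family leaves the span of the earlier vectors. -/
def leaders {r : ℕ} (f : Fin r → W) : Set (Fin r) := {a | f a ∉ span ℝ (f '' Set.Iio a)}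

theorem mem_span_leaders {r : ℕ} (f : Fin r → W) (a : Fin r) :
    f a ∈ span ℝ (f '' (leaders f ∩ Set.Iic a)) := by
  induction a using WellFoundedLT.induction with
  | ind a ih =>
    by_cases ha : a ∈ leaders f
    · exact subset_span ⟨a, ⟨ha, Set.mem_Iic.2 le_rfl⟩, rfl⟩
    · have h : f a ∈ span ℝ (f '' Set.Iio a) := not_not.1 ha
      refine span_le.2 ?_ h
      rintro _ ⟨b, hb, rfl⟩
      refine span_mono (Set.image_mono fun x hx => ?_) (ih b hb)
      exact ⟨hx.1, Set.mem_Iic.2 (hx.2.trans (le_of_lt hb))⟩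

theorem mem_span_leaders_Iio {r : ℕ} (f : Fin r → W) {a : Fin r} (ha : a ∉ leaders f) :
    f a ∈ span ℝ (f '' (leaders f ∩ Set.Iio a)) := by
  have h := mem_span_leaders f a
  convert h using 3
  ext x
  refine ⟨fun hx => ⟨hx.1, Set.mem_Iic.2 (le_of_lt hx.2)⟩,
    fun hx => ⟨hx.1, Set.mem_Iio.2 (lt_of_le_of_ne hx.2 ?_)⟩⟩
  rintro rfl
  exact ha hx.1

theorem linearIndepOn_leaders {r : ℕ} (f : Fin r → W) : LinearIndepOn ℝ f (leaders f) := by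
  have h : ∀ n : ℕ, LinearIndepOn ℝ f (leaders f ∩ {a | (a : ℕ) < n}) := by
    intro n
    induction n with
    | zero => simp
    | succ n ih =>
      by_cases hn : ∃ a ∈ leaders f, (a : ℕ) = n
      · obtain ⟨a, ha, rfl⟩ := hn
        have h1 : leaders f ∩ {b | (b : ℕ) < a + 1} = insert a (leaders f ∩ {b | (b : ℕ) < a}) := by
          ext b
          simp only [Set.mem_inter_iff, Set.mem_ofPred_eq, Set.mem_insert_iff, Nat.lt_succ_iff_lt_or_eq]
          constructor
          · rintro ⟨h1, h2 | h2⟩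
            · exact Or.inr ⟨h1, h2⟩
            · exact Or.inl (Fin.ext h2)
          · rintro (rfl | ⟨h1, h2⟩)
            · exact ⟨ha, Or.inr rfl⟩
            · exact ⟨h1, Or.inl h2⟩
        rw [h1, linearIndepOn_insert (by simp)]
        exact ⟨ih, fun h => ha (span_mono (Set.image_mono fun b hb => hb.2) h)⟩
      · convert ih using 1
        ext b
        simp only [Set.mem_inter_iff, Set.mem_ofPred_eq, and_congr_right_iff]
        intro hb
        have : (b : ℕ) ≠ n := fun h => hn ⟨b, hb, h⟩
        omega
  convert h r using 1
  ext b
  simp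

/-- A reduced echelon form of a subspace with respect to a family of vectors. -/
structure Echelon {r d e : ℕ} (v : Fin r → V) (S : Submodule ℝ V) (K : Fin d → Fin r)
    (c : Fin e → Fin r) (β : Fin d → Fin e → ℝ) : Prop where
  strictMono : StrictMono K
  strictMono_compl : StrictMono c
  ne : ∀ t b, K t ≠ c b
  cover : ∀ a, (∃ t, K t = a) ∨ ∃ b, c b = a
  coeff : ∀ t b, K t < c b → β t b = 0
  mem : ∀ t, v (K t) + ∑ b, β t b • v (c b) ∈ S

theorem exists_echelon [FiniteDimensional ℝ V] {r d e : ℕ} {v : Fin r → V}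
    (hv : span ℝ (Set.range v) = ⊤) (hde : d + e = r) (hr : finrank ℝ V = r)
    {S : Submodule ℝ V} (hS : finrank ℝ S = d) :
    ∃ (K : Fin d → Fin r) (c : Fin e → Fin r) (β : Fin d → Fin e → ℝ), Echelon v S K c β := by
  classical
  set f : Fin r → V ⧸ S := fun a => S.mkQ (v a) with hf
  let C : Finset (Fin r) := Finset.univ.filter (· ∈ leaders f)
  have hC : ∀ a, a ∈ C ↔ a ∈ leaders f := fun a => by simp [C]
  have hcard : C.card = e := by
    have h1 := linearIndepOn_leaders f
    have h2 : span ℝ (f '' leaders f) = ⊤ := by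
      rw [eq_top_iff]
      have h3 : (⊤ : Submodule ℝ (V ⧸ S)) = span ℝ (Set.range f) := by
        have : Set.range f = S.mkQ '' Set.range v := by
          rw [← Set.range_comp]
          rfl
        rw [this, span_image, hv, Submodule.map_top, range_mkQ]
      rw [h3, span_le]
      rintro _ ⟨a, rfl⟩
      exact span_mono (Set.image_mono Set.inter_subset_left) (mem_span_leaders f a)
    have h4 : finrank ℝ (span ℝ (Set.range fun x : leaders f => f x)) = Fintype.card (leaders f) :=
      finrank_span_eq_card h1
    have h5 : (Set.range fun x : leaders f => f x) = f '' leaders f := by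
      rw [Set.image_eq_range]
    rw [h5, h2, finrank_top] at h4
    have h6 := S.finrank_quotient_add_finrank
    have h7 : Fintype.card (leaders f) = C.card := by
      rw [Fintype.card_subtype]
    omega
  have hcard' : Cᶜ.card = d := by
    rw [Finset.card_compl, Fintype.card_fin]
    omega
  let K := Cᶜ.orderEmbOfFin hcard'
  let c := C.orderEmbOfFin hcard
  have hK : ∀ t, K t ∉ C := fun t => Finset.mem_compl.1 (Finset.orderEmbOfFin_mem _ _ _)
  have hc : ∀ b, c b ∈ C := fun b => Finset.orderEmbOfFin_mem _ _ _
  have hcr : ∀ a ∈ C, ∃ b, c b = a := fun a ha => by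
    have := Finset.range_orderEmbOfFin C hcard
    exact (Set.ext_iff.1 this a).2 ha
  have hKr : ∀ a ∉ C, ∃ b, K b = a := fun a ha => by
    have := Finset.range_orderEmbOfFin Cᶜ hcard'
    exact (Set.ext_iff.1 this a).2 (Finset.mem_coe.2 (Finset.mem_compl.2 ha))
  have h1 : ∀ t, ∃ l : Fin r →₀ ℝ, (∀ a, l a ≠ 0 → a ∈ C ∧ a < K t) ∧
      ∑ a, l a • f a = f (K t) := by
    intro t
    obtain ⟨l, hl, hl'⟩ := (Finsupp.mem_span_image_iff_linearCombination ℝ).1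
      (mem_span_leaders_Iio f (a := K t) fun h => hK t ((hC _).2 h))
    refine ⟨l, fun a ha => ?_, ?_⟩
    · have := hl (Finsupp.mem_support_iff.2 ha)
      exact ⟨(hC a).2 this.1, this.2⟩
    · rw [← hl', Finsupp.linearCombination_apply, Finsupp.sum_fintype _ _ (by simp)]
  choose l hl hl' using h1
  refine ⟨K, c, fun t b => - l t (c b), K.strictMono, c.strictMono, ?_, ?_, ?_, ?_⟩
  · intro t b h
    exact hK t (h ▸ hc b)
  · intro a
    by_cases ha : a ∈ C
    · exact Or.inr (hcr a ha)
    · exact Or.inl (hKr a ha)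
  · intro t b hb
    rw [neg_eq_zero]
    by_contra h
    exact absurd (hl t _ h).2 (not_lt.2 hb.le)
  · intro t
    rw [← Submodule.ker_mkQ S, LinearMap.mem_ker, map_add, map_sum]
    have h2 : ∑ a, l t a • f a = ∑ b, l t (c b) • f (c b) := by
      rw [← Finset.sum_subset (Finset.subset_univ C), ← Finset.sum_coe_sort]
      · refine (Equiv.sum_comp (C.orderIsoOfFin hcard).toEquiv
          (fun a : C => l t a • f a)).symm.trans (Finset.sum_congr rfl fun b _ => ?_)
        rfl
      · intro a _ ha
        have : l t a = 0 := by
          by_contra h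
          exact ha (hl t a h).1
        rw [this, zero_smul]
    rw [hl' t] at h2
    simp only [neg_smul, map_neg, map_smul, Finset.sum_neg_distrib]
    rw [add_neg_eq_zero]
    exact h2

namespace Echelon

variable {r d e : ℕ} {B : Basis (Fin r) ℝ V} {S : Submodule ℝ V} {K : Fin d → Fin r}
  {c : Fin e → Fin r} {β : Fin d → Fin e → ℝ}

theorem coord_vec (h : Echelon B S K c β) (t t' : Fin d) :
    B.coord (K t) (B (K t') + ∑ b, β t' b • B (c b)) = if t = t' then 1 else 0 := by
  have h1 : ∀ b, B.coord (K t) (B (c b)) = 0 := fun b => by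
    rw [Basis.coord_apply, Basis.repr_self, Finsupp.single_eq_of_ne (h.ne t b)]
  rw [map_add, map_sum]
  simp only [map_smul, h1, smul_zero, Finset.sum_const_zero, add_zero]
  rw [Basis.coord_apply, Basis.repr_self, Finsupp.single_apply]
  simp only [h.strictMono.injective.eq_iff, eq_comm]

theorem linearIndependent (h : Echelon B S K c β) :
    LinearIndependent ℝ fun t => B (K t) + ∑ b, β t b • B (c b) := by
  rw [Fintype.linearIndependent_iff]
  intro g hg t
  have h1 := congrArg (B.coord (K t)) hg
  simp only [map_sum, map_smul, h.coord_vec, map_zero] at h1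
  simpa using h1

theorem eq_sum [FiniteDimensional ℝ V] (h : Echelon B S K c β) (hS : finrank ℝ S = d) {x : V}
    (hx : x ∈ S) : x = ∑ t, B.coord (K t) x • (B (K t) + ∑ b, β t b • B (c b)) := by
  have h1 : span ℝ (Set.range fun t => B (K t) + ∑ b, β t b • B (c b)) = S := by
    refine Submodule.eq_of_le_of_finrank_eq ?_ ?_
    · rw [span_le]
      rintro _ ⟨t, rfl⟩
      exact h.mem t
    · rw [finrank_span_eq_card h.linearIndependent, hS, Fintype.card_fin]
  rw [← h1, mem_span_range_iff_exists_fun] at hx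
  obtain ⟨g, rfl⟩ := hx
  refine Finset.sum_congr rfl fun t _ => ?_
  congr 1
  rw [map_sum]
  simp only [map_smul, h.coord_vec]
  simp

theorem eq_zero_of_sum_mem [FiniteDimensional ℝ V] (h : Echelon B S K c β) (hS : finrank ℝ S = d)
    (hc : Function.Injective c) {y : Fin e → ℝ} (hy : ∑ b, y b • B (c b) ∈ S) : y = 0 := by
  have h1 := h.eq_sum hS hy
  have h2 : ∀ t, B.coord (K t) (∑ b, y b • B (c b)) = 0 := by
    intro t
    rw [map_sum]
    refine Finset.sum_eq_zero fun b _ => ?_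
    rw [map_smul, Basis.coord_apply, Basis.repr_self, Finsupp.single_eq_of_ne (h.ne t b), smul_zero]
  simp only [h2, zero_smul, Finset.sum_const_zero] at h1
  funext b
  exact Fintype.linearIndependent_iff.1 (B.linearIndependent.comp c hc) y h1 b

theorem vec_mem_span {v : Fin r → V} (h : Echelon v S K c β) (t : Fin d) {n : ℕ} (ht : (K t : ℕ) < n) :
    v (K t) + ∑ b, β t b • v (c b) ∈ span ℝ (v '' {i | (i : ℕ) < n}) := by
  refine add_mem (subset_span ⟨_, ht, rfl⟩) (sum_mem fun b _ => ?_)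
  by_cases hb : K t < c b
  · rw [h.coeff t b hb, zero_smul]
    exact zero_mem _
  · exact smul_mem _ _ (subset_span ⟨_, lt_of_le_of_lt (Fin.le_def.1 (not_lt.1 hb)) ht, rfl⟩)

end Echelon

theorem coord_eq_zero_of_mem_span {r : ℕ} (B : Basis (Fin r) ℝ V) {n : ℕ} {x : V}
    (hx : x ∈ span ℝ (B '' {i | (i : ℕ) < n})) {i : Fin r} (hi : n ≤ i) : B.coord i x = 0 := by
  have h1 : span ℝ (B '' {i | (i : ℕ) < n}) ≤ LinearMap.ker (B.coord i) := by
    rw [span_le]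
    rintro _ ⟨k, hk, rfl⟩
    have : k ≠ i := by
      rintro rfl
      exact absurd hk (not_lt.2 hi)
    simp [this]
  exact h1 hx

theorem Echelon.finrank_inf [FiniteDimensional ℝ V] {r d e : ℕ} {B : Basis (Fin r) ℝ V}
    {S : Submodule ℝ V} {K : Fin d → Fin r} {c : Fin e → Fin r} {β : Fin d → Fin e → ℝ}
    (h : Echelon B S K c β) (hS : finrank ℝ S = d) (n : ℕ) :
    finrank ℝ (S ⊓ span ℝ (B '' {i | (i : ℕ) < n}) : Submodule ℝ V)
      = (Finset.univ.filter fun t => (K t : ℕ) < n).card := by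
  have h1 : S ⊓ span ℝ (B '' {i | (i : ℕ) < n})
      = span ℝ (Set.range fun t : {t // (K t : ℕ) < n} => B (K t) + ∑ b, β t b • B (c b)) := by
    apply le_antisymm
    · rintro x ⟨hx, hx'⟩
      rw [h.eq_sum hS hx]
      refine sum_mem fun t _ => ?_
      by_cases ht : (K t : ℕ) < n
      · exact smul_mem _ _ (subset_span ⟨⟨t, ht⟩, rfl⟩)
      · rw [coord_eq_zero_of_mem_span B hx' (not_lt.1 ht), zero_smul]
        exact zero_mem _
    · rw [span_le]
      rintro _ ⟨t, rfl⟩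
      exact ⟨h.mem t, h.vec_mem_span t t.2⟩
  rw [h1, ← Fintype.card_subtype]
  exact finrank_span_eq_card (h.linearIndependent.comp _ Subtype.val_injective)

end Echelon

end

section

namespace LinePoly

variable {E V Q : Type*} [AddCommGroup E] [Module ℝ E] [AddCommGroup V] [Module ℝ V]
  [AddCommGroup Q] [Module ℝ Q]

theorem pairing (l : E →ₗ[ℝ] Dual ℝ Q) (v : E →ₗ[ℝ] Q) (c : Q) :
    LinePoly fun x => l x (v x + c) := fun x y =>
  ⟨Polynomial.C (l x (v x + c)) + Polynomial.X * Polynomial.C (l y (v x + c) + l x (v y)) +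
    Polynomial.X ^ 2 * Polynomial.C (l y (v y)), fun t => by
      simp only [map_add, map_smul, LinearMap.add_apply, LinearMap.smul_apply, smul_eq_mul,
        Polynomial.eval_add, Polynomial.eval_mul, Polynomial.eval_C, Polynomial.eval_X,
        Polynomial.eval_pow]
      ring⟩

theorem rank_pi {ι : Type*} [Fintype ι] {M : E → V →ₗ[ℝ] (ι → ℝ)}
    (hM : ∀ v i, LinePoly (fun x => M x v i)) (x : E) :
    ∃ p : E → ℝ, LinePoly p ∧ p x ≠ 0 ∧
      ∀ y, p y ≠ 0 → finrank ℝ (LinearMap.range (M x)) ≤ finrank ℝ (LinearMap.range (M y)) := by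
  classical
  refine LinePoly.rank (fun v ξ => ?_) x
  have h1 : (fun x => ξ (M x v)) = fun x => ∑ i, M x v i * ξ (fun j => if i = j then 1 else 0) := by
    funext x
    rw [LinearMap.pi_apply_eq_sum_univ]
    rfl
  rw [h1]
  exact LinePoly.sum _ fun i _ => (hM v i).mul (LinePoly.const _)

theorem surjective_pi {ι : Type*} [Fintype ι] {M : E → V →ₗ[ℝ] (ι → ℝ)}
    (hM : ∀ v i, LinePoly (fun x => M x v i)) (x : E) (hx : Function.Surjective (M x)) :
    ∃ p : E → ℝ, LinePoly p ∧ p x ≠ 0 ∧ ∀ y, p y ≠ 0 → Function.Surjective (M y) := by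
  obtain ⟨p, hp, hpx, h⟩ := rank_pi hM x
  refine ⟨p, hp, hpx, fun y hy => ?_⟩
  have h1 := h y hy
  rw [LinearMap.range_eq_top.2 hx, finrank_top] at h1
  exact LinearMap.range_eq_top.1
    (Submodule.eq_top_of_finrank_eq (le_antisymm (Submodule.finrank_le _) h1))

end LinePoly

/-- If `A` has maximal rank on the line `A + t B`, then `B` maps `ker A` into `range A`. -/
theorem mem_range_of_rank_le {X Y : Type*} [AddCommGroup X] [Module ℝ X] [AddCommGroup Y]
    [Module ℝ Y] [FiniteDimensional ℝ Y] {A B : X →ₗ[ℝ] Y}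
    (h : ∀ t : ℝ, finrank ℝ (LinearMap.range (A + t • B)) ≤ finrank ℝ (LinearMap.range A))
    {φ : X} (hφ : A φ = 0) : B φ ∈ LinearMap.range A := by
  by_contra hB
  let M : ℝ → (X × ℝ) →ₗ[ℝ] Y := fun t => (A + t • B).coprod (LinearMap.toSpanSingleton ℝ Y (B φ))
  have hM : ∀ t, LinearMap.range (M t) = LinearMap.range (A + t • B) ⊔ span ℝ {B φ} := by
    intro t
    rw [LinearMap.range_coprod, LinearMap.range_toSpanSingleton]
  obtain ⟨p, hp, hp0, hle⟩ := LinePoly.rank (M := M) (fun x ξ => by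
    have : (fun t => ξ (M t x)) = fun t => ξ (A x.1) + t * ξ (B x.1) + x.2 * ξ (B φ) := by
      funext t
      simp [M]
    rw [this]
    exact ((LinePoly.const _).add ((LinePoly.linear LinearMap.id).mul (LinePoly.const _))).add
      (LinePoly.const _)) (0 : ℝ)
  obtain ⟨t, ht, ht0⟩ := LinePoly.exists_ne_zero hp (LinePoly.linear LinearMap.id) hp0
    (y := (1 : ℝ)) (by simp)
  have h1 := hle t ht
  have h2 : LinearMap.range (A + t • B) ⊔ span ℝ {B φ} = LinearMap.range (A + t • B) := by
    rw [sup_eq_left, span_singleton_le_iff_mem]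
    refine ⟨t⁻¹ • φ, ?_⟩
    rw [map_smul, LinearMap.add_apply, hφ, LinearMap.smul_apply, zero_add,
      inv_smul_smul₀ (by simpa using ht0)]
  rw [hM, hM, h2, zero_smul, add_zero] at h1
  have h3 : LinearMap.range A < LinearMap.range A ⊔ span ℝ {B φ} :=
    lt_of_le_of_ne le_sup_left fun h => hB (h ▸ mem_sup_right (mem_span_singleton_self _))
  have h4 := Submodule.finrank_lt_finrank_of_lt h3
  have h5 := h t
  omega

section Destabilize

variable {s r d e q : ℕ} {V Q : Type*} [AddCommGroup V] [Module ℝ V] [AddCommGroup Q] [Module ℝ Q]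

theorem condMap_add_smul (m : Fin s → Fin r → ℕ) (v : Fin s → Fin r → V)
    (l η : Fin s → Fin q → Dual ℝ Q) (t : ℝ) :
    condMap m v (l + t • η) = condMap m v l + t • condMap m v η := rfl

/-- A subspace whose slope with respect to the flags spanned by `v` is too large. -/
def Destabilized (q : ℕ) (m : Fin s → Fin r → ℕ) (v : Fin s → Fin r → V) : Prop :=
  ∃ (S : Submodule ℝ V) (K : Fin s → Finset (Fin r)),
    (∀ j, ∀ k ∈ K j, ∃ x ∈ S, x - v j k ∈ span ℝ (v j '' {i | (i : ℕ) < k})) ∧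
      q * finrank ℝ S < ∑ j, ∑ k ∈ K j, (q - m j k)

theorem surjective_of_restrict {m : Fin s → Fin r → ℕ} {S : Submodule ℝ V} {φ : V →ₗ[ℝ] Q} (hφ : LinearMap.ker φ = S)
    {K : Fin s → Fin d → Fin r} {c : Fin s → Fin e → Fin r} {β : Fin s → Fin d → Fin e → ℝ}
    (hcov : ∀ j a, (∃ t, K j t = a) ∨ ∃ b, c j b = a)
    {v : Fin s → Fin r → V} {l : Fin s → Fin q → Dual ℝ Q} {w : Fin s → Fin d → S}
    (hw : ∀ j t, v j (K j t) + ∑ b, β j t b • v j (c j b) = w j t)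
    (hind : ∀ j, LinearIndependent ℝ fun b => φ (v j (c j b)))
    (hker : condMap m v l φ = 0)
    (hmax : ∀ l' : Fin s → Fin q → Dual ℝ Q, finrank ℝ (LinearMap.range (condMap m v l'))
      ≤ finrank ℝ (LinearMap.range (condMap m v l)))
    (hsurj : Function.Surjective (condMap (V := S) (fun j t => m j (K j t)) w l)) :
    Function.Surjective (condMap m v l) := by
  classical
  intro y
  let Y : Fin s → Fin r → Fin q → ℝ := fun j a b => if h : m j a ≤ b then y ⟨(j, a, b), h⟩ else 0
  have hY : ∀ x, y x = Y x.1.1 x.1.2.1 x.1.2.2 := fun x => by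
    simp only [Y]
    rw [dif_pos x.2]
  obtain ⟨ψ₀, hψ₀⟩ := hsurj fun x => Y x.1.1 (K x.1.1 x.1.2.1) x.1.2.2 +
    ∑ b, β x.1.1 x.1.2.1 b * Y x.1.1 (c x.1.1 b) x.1.2.2
  have hψ₀' : ∀ j t (b : Fin q), m j (K j t) ≤ b → l j b (ψ₀ (w j t)) = Y j (K j t) b +
      ∑ b', β j t b' * Y j (c j b') b := fun j t b hb => congrFun hψ₀ ⟨(j, t, b), hb⟩
  obtain ⟨ψ, hψ⟩ := LinearMap.exists_extend ψ₀
  have hψ' : ∀ x : S, ψ x = ψ₀ x := fun x => LinearMap.congr_fun hψ x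
  let z : Fin s → Fin r → Fin q → ℝ := fun j a b => Y j a b - l j b (ψ (v j a))
  have hz : ∀ j t (b : Fin q), m j (K j t) ≤ b →
      z j (K j t) b + ∑ b', β j t b' * z j (c j b') b = 0 := by
    intro j t b hb
    have h1 := hψ₀' j t b hb
    rw [← hψ', ← hw] at h1
    simp only [map_add, map_sum, map_smul, smul_eq_mul] at h1
    simp only [z, mul_sub, Finset.sum_sub_distrib]
    linarith
  have hη : ∀ j (b : Fin q), ∃ η : Dual ℝ Q, ∀ b', η (φ (v j (c j b'))) = z j (c j b') b := by
    intro j b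
    let T : Basis (Fin e) ℝ _ := Basis.span (hind j)
    obtain ⟨η, hη⟩ := LinearMap.exists_extend (T.constr ℝ fun b' => z j (c j b') b)
    refine ⟨η, fun b' => ?_⟩
    have h1 := LinearMap.congr_fun hη (T b')
    rw [Basis.constr_basis] at h1
    rw [← h1, LinearMap.comp_apply, Submodule.subtype_apply, Basis.span_apply]
  choose η hη using hη
  have h1 : condMap m v η φ ∈ LinearMap.range (condMap m v l) :=
    mem_range_of_rank_le (fun t => by rw [← condMap_add_smul]; exact hmax _) hker
  have h2 : y = condMap m v l ψ + condMap m v η φ := by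
    funext x
    obtain ⟨⟨j, a, b⟩, hb⟩ := x
    rw [hY, Pi.add_apply, condMap_apply, condMap_apply]
    dsimp only at hb ⊢
    suffices h : η j b (φ (v j a)) = z j a b by
      rw [h]
      simp only [z]
      ring
    rcases hcov j a with ⟨t, rfl⟩ | ⟨b', rfl⟩
    · have h3 : φ (v j (K j t)) = - ∑ b, β j t b • φ (v j (c j b)) := by
        rw [eq_neg_iff_add_eq_zero]
        have h4 : φ (w j t) = 0 := by
          rw [← LinearMap.mem_ker, hφ]
          exact (w j t).2
        rw [← h4, ← hw]
        simp
      rw [h3, map_neg, map_sum]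
      simp only [map_smul, smul_eq_mul, hη]
      linarith [hz j t b hb]
    · exact hη j b b'
  rw [h2]
  exact add_mem (LinearMap.mem_range_self _ ψ) h1

theorem linePoly_condMap {E : Type*} [AddCommGroup E] [Module ℝ E] (m : Fin s → Fin r → ℕ)
    (v : E →ₗ[ℝ] Fin s → Fin r → V) (v₀ : Fin s → Fin r → V)
    (l : E →ₗ[ℝ] Fin s → Fin q → Dual ℝ Q) (φ : V →ₗ[ℝ] Q) (x) :
    LinePoly fun y => condMap m (v y + v₀) (l y) φ x := by
  have := LinePoly.pairing (LinearMap.proj (R := ℝ) (φ := fun _ => Dual ℝ Q) x.1.2.2 ∘ₗ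
    LinearMap.proj (R := ℝ) (φ := fun _ => Fin q → Dual ℝ Q) x.1.1 ∘ₗ l)
    (φ ∘ₗ LinearMap.proj (R := ℝ) (φ := fun _ => V) x.1.2.1 ∘ₗ
      LinearMap.proj (R := ℝ) (φ := fun _ => Fin r → V) x.1.1 ∘ₗ v) (φ (v₀ x.1.1 x.1.2.1))
  refine (congrArg LinePoly (funext fun y => ?_)).mp this
  rw [condMap_apply, Pi.add_apply, Pi.add_apply, φ.map_add]
  rfl

theorem exists_good_dual [FiniteDimensional ℝ Q] (m : Fin s → Fin r → ℕ) :
    ∃ G : (Fin s → Fin q → Dual ℝ Q) → ℝ, LinePoly G ∧ (∃ l, G l ≠ 0) ∧ ∀ l, G l ≠ 0 →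
      ∀ d ≤ r, ∀ (K : Fin s → Fin d → Fin r) (w : Fin s → Fin d → Fin d → ℝ)
        (l' : Fin s → Fin q → Dual ℝ Q),
        Function.Surjective (condMap (fun j t => m j (K j t)) w l') →
          ∃ w' : Fin s → Fin d → Fin d → ℝ,
            Function.Surjective (condMap (fun j t => m j (K j t)) w' l) := by
  classical
  have h : ∀ i : (Σ d : Fin (r + 1), Fin s → Fin d → Fin r),
      ∃ G : (Fin s → Fin q → Dual ℝ Q) → ℝ, LinePoly G ∧ (∃ l, G l ≠ 0) ∧ ∀ l, G l ≠ 0 →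
        ∀ (w : Fin s → Fin i.1 → Fin i.1 → ℝ) (l' : Fin s → Fin q → Dual ℝ Q),
        Function.Surjective (condMap (fun j t => m j (i.2 j t)) w l') →
          ∃ w' : Fin s → Fin i.1 → Fin i.1 → ℝ,
            Function.Surjective (condMap (fun j t => m j (i.2 j t)) w' l) := by
    intro i
    by_cases hi : ∃ (w : Fin s → Fin i.1 → Fin i.1 → ℝ) (l : Fin s → Fin q → Dual ℝ Q),
      Function.Surjective (condMap (fun j t => m j (i.2 j t)) w l)
    · obtain ⟨w, l, hwl⟩ := hi
      obtain ⟨p, hp, hpl, hps⟩ := LinePoly.surjective_pi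
        (M := fun l : Fin s → Fin q → Dual ℝ Q => condMap (fun j t => m j (i.2 j t)) w l)
        (fun φ x => by
          have := linePoly_condMap (fun j t => m j (i.2 j t))
            (0 : (Fin s → Fin q → Dual ℝ Q) →ₗ[ℝ] _) w LinearMap.id φ x
          simpa using this) l hwl
      exact ⟨p, hp, ⟨l, hpl⟩, fun l' hl' _ _ _ => ⟨w, hps l' hl'⟩⟩
    · exact ⟨fun _ => 1, LinePoly.const 1, ⟨0, one_ne_zero⟩,
        fun l _ w l' h => absurd ⟨w, l', h⟩ hi⟩
  choose G hG hG0 hG' using h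
  obtain ⟨l, hl⟩ := LinePoly.exists_ne_zero_finset Finset.univ (fun i _ => hG i) fun i _ => hG0 i
  refine ⟨fun l => ∏ i, G i l, LinePoly.prod _ fun i _ => hG i,
    ⟨l, Finset.prod_ne_zero_iff.2 hl⟩, fun l hl d hd K => ?_⟩
  exact hG' ⟨⟨d, by omega⟩, K⟩ l (Finset.prod_ne_zero_iff.1 hl _ (Finset.mem_univ _))

theorem surjective_condMap_equiv {V' : Type*} [AddCommGroup V'] [Module ℝ V'] (f : V ≃ₗ[ℝ] V')
    {m : Fin s → Fin r → ℕ} {v : Fin s → Fin r → V} {l : Fin s → Fin q → Dual ℝ Q}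
    (h : Function.Surjective (condMap m v l)) :
    Function.Surjective (condMap m (fun j a => f (v j a)) l) := by
  intro y
  obtain ⟨φ, rfl⟩ := h y
  refine ⟨φ ∘ₗ f.symm.toLinearMap, funext fun x => ?_⟩
  rw [condMap_apply, condMap_apply]
  simp

theorem exists_rank_maximal {E Y : Type*} [Nonempty E] [AddCommGroup Y] [Module ℝ Y]
    [FiniteDimensional ℝ Y] (M : E → V →ₗ[ℝ] Y) :
    ∃ x, ∀ y, finrank ℝ (LinearMap.range (M y)) ≤ finrank ℝ (LinearMap.range (M x)) := by
  refine ⟨Function.argmin fun x => finrank ℝ Y - finrank ℝ (LinearMap.range (M x)), fun y => ?_⟩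
  have h1 := Function.argmin_le (fun x => finrank ℝ Y - finrank ℝ (LinearMap.range (M x))) y
  have h2 := Submodule.finrank_le (LinearMap.range (M y))
  omega

theorem exists_linePoly_basis (s : ℕ) (B : Basis (Fin r) ℝ V) :
    ∃ D : (Fin s → Fin r → V) → ℝ, LinePoly D ∧ (∃ v, D v ≠ 0) ∧
      ∀ v, D v ≠ 0 → ∃ B' : Fin s → Basis (Fin r) ℝ V, ∀ j, ⇑(B' j) = v j := by
  classical
  refine ⟨fun v => ∏ j, B.det (v j), LinePoly.prod _ fun j _ => ?_, ⟨fun _ => B, ?_⟩,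
    fun v hv => ?_⟩
  · simp_rw [Basis.det_apply]
    refine LinePoly.det fun i a => ?_
    exact LinePoly.linear (B.coord i ∘ₗ LinearMap.proj (R := ℝ) (φ := fun _ => V) a ∘ₗ
      LinearMap.proj (R := ℝ) (φ := fun _ => Fin r → V) j)
  · simp [B.det_self]
  · have h1 : ∀ j, IsUnit (B.det (v j)) := fun j =>
      isUnit_iff_ne_zero.2 (Finset.prod_ne_zero_iff.1 hv j (Finset.mem_univ _))
    refine ⟨fun j => Basis.mk ((Basis.is_basis_iff_det B).2 (h1 j)).1
      ((Basis.is_basis_iff_det B).2 (h1 j)).2.ge, fun j => ?_⟩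
    exact Basis.coe_mk _ _

end Destabilize

end

section

section Destabilize

variable {s q : ℕ} {Q : Type*} [AddCommGroup Q] [Module ℝ Q] [FiniteDimensional ℝ Q]

/-- If the conditions never become independent, then almost all flags are destabilized. -/
theorem exists_destabilized (hQ : finrank ℝ Q = q) (r : ℕ) :
    ∀ {V : Type*} [AddCommGroup V] [Module ℝ V] [FiniteDimensional ℝ V], finrank ℝ V = r →
      ∀ m : Fin s → Fin r → ℕ,
      (∀ (v : Fin s → Fin r → V) (l : Fin s → Fin q → Dual ℝ Q),
        ¬ Function.Surjective (condMap m v l)) →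
      ∀ p : (Fin s → Fin r → V) → ℝ, LinePoly p → ∀ v₀, p v₀ ≠ 0 →
        ∃ v, p v ≠ 0 ∧ Destabilized q m v := by
  induction r using Nat.strong_induction_on with
  | _ r ih =>
  intro V _ _ _ hV m hns p hp v₁ hpv₁
  classical
  let B₀ : Basis (Fin r) ℝ V := finBasisOfFinrankEq ℝ V hV
  obtain ⟨D, hD, ⟨v₂, hv₂⟩, hDb⟩ := exists_linePoly_basis s B₀
  obtain ⟨G, hG, ⟨l₁, hl₁⟩, hGg⟩ := exists_good_dual (q := q) (Q := Q) m
  let M : ((Fin s → Fin r → V) × (Fin s → Fin q → Dual ℝ Q)) → _ := fun x => condMap m x.1 x.2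
  obtain ⟨x₀, hx₀⟩ := exists_rank_maximal M
  obtain ⟨P, hP, hPx, hPr⟩ := LinePoly.rank_pi (M := M) (fun φ x => by
    simpa using linePoly_condMap m
      (LinearMap.fst ℝ (Fin s → Fin r → V) (Fin s → Fin q → Dual ℝ Q)) 0
      (LinearMap.snd ℝ (Fin s → Fin r → V) (Fin s → Fin q → Dual ℝ Q)) φ x) x₀
  obtain ⟨v₃, h3, h3'⟩ := LinePoly.exists_ne_zero hp hD hpv₁ hv₂
  obtain ⟨⟨v, l⟩, h4, h5⟩ := LinePoly.exists_ne_zero hP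
    (((hp.mul hD).comp (LinearMap.fst ℝ (Fin s → Fin r → V) (Fin s → Fin q → Dual ℝ Q))).mul
      (hG.comp (LinearMap.snd ℝ (Fin s → Fin r → V) (Fin s → Fin q → Dual ℝ Q)))) hPx
    (y := (v₃, l₁)) (mul_ne_zero (mul_ne_zero h3 h3') hl₁)
  have hmax : ∀ y, finrank ℝ (LinearMap.range (M y)) ≤ finrank ℝ (LinearMap.range (M (v, l))) :=
    fun y => (hx₀ y).trans (hPr _ h4)
  have hGl : G l ≠ 0 := right_ne_zero_of_mul h5
  have hpv : p v ≠ 0 := left_ne_zero_of_mul (left_ne_zero_of_mul h5)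
  obtain ⟨B, hB⟩ := hDb v (right_ne_zero_of_mul (left_ne_zero_of_mul h5))
  clear hPx hx₀ h4 h5 h3 h3' hDb hv₂ hl₁
  by_cases hinj : Function.Injective (condMap m v l)
  · refine ⟨v, hpv, ⊤, fun _ => Finset.univ, fun j k _ => ⟨v j k, trivial, ?_⟩, ?_⟩
    · rw [sub_self]
      exact zero_mem _
    · have h1 : LinearMap.range (condMap m v l) ≠ ⊤ :=
        fun h => hns v l (LinearMap.range_eq_top.1 h)
      have h2 := Submodule.finrank_lt h1
      rw [LinearMap.finrank_range_of_inj hinj, finrank_linearMap, hV, hQ, finrank_fintype_fun_eq_card,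
        card_cond] at h2
      rw [finrank_top, hV, mul_comm]
      exact h2
  · obtain ⟨φ, hφ, hφ0⟩ : ∃ φ, condMap m v l φ = 0 ∧ φ ≠ 0 := by
      by_contra! h
      exact hinj ((injective_iff_map_eq_zero _).2 h)
    obtain ⟨S, hS⟩ : ∃ S, LinearMap.ker φ = S := ⟨_, rfl⟩
    obtain ⟨d, hd⟩ : ∃ d, finrank ℝ S = d := ⟨_, rfl⟩
    have hdr : d < r := by
      rw [← hd, ← hV]
      refine Submodule.finrank_lt fun h => hφ0 ?_
      rw [← hS] at h
      exact LinearMap.ker_eq_top.1 h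
    have hE : ∀ j, ∃ (K : Fin d → Fin r) (c : Fin (r - d) → Fin r) (β : Fin d → Fin (r - d) → ℝ),
        Echelon (B j) S K c β :=
      fun j => exists_echelon (B j).span_eq (by omega) hV hd
    choose K c β hE using hE
    let u : Fin s → Fin d → S := fun j t => ⟨_, (hE j).mem t⟩
    have hu : ∀ j t, (u j t : V) = v j (K j t) + ∑ b, β j t b • v j (c j b) := fun j t => by
      simp only [u, hB]
    let T : (Fin s → Fin d → S) →ₗ[ℝ] (Fin s → Fin r → V) :=
      LinearMap.pi fun j => LinearMap.pi fun a => ∑ t, if K j t = a then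
        S.subtype ∘ₗ LinearMap.proj (R := ℝ) (φ := fun _ => S) t ∘ₗ
          LinearMap.proj (R := ℝ) (φ := fun _ => Fin d → S) j else 0
    have hT : ∀ x j a, T x j a = ∑ t, if K j t = a then (x j t : V) else 0 := by
      intro x j a
      simp only [T, LinearMap.pi_apply, LinearMap.sum_apply]
      refine Finset.sum_congr rfl fun t _ => ?_
      split_ifs <;> rfl
    have hTK : ∀ x j t, T x j (K j t) = x j t := by
      intro x j t
      rw [hT]
      simp [(hE j).strictMono.injective.eq_iff]
    have hTc : ∀ x j b, T x j (c j b) = 0 := by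
      intro x j b
      rw [hT]
      exact Finset.sum_eq_zero fun t _ => if_neg ((hE j).ne t b)
    have hTS : ∀ x j a, T x j a ∈ S := by
      intro x j a
      rw [hT]
      refine sum_mem fun t _ => ?_
      split_ifs
      · exact (x j t).2
      · exact zero_mem _
    obtain ⟨v₀, hv₀⟩ : ∃ v₀, v₀ = v - T u := ⟨_, rfl⟩
    have huv : T u + v₀ = v := by rw [hv₀, add_sub_cancel]
    have hvc : ∀ w j b, (T w + v₀) j (c j b) = v j (c j b) := by
      intro w j b
      simp [hv₀, hTc]
    have hvK : ∀ w j t, (T w + v₀) j (K j t) + ∑ b, β j t b • (T w + v₀) j (c j b) = w j t := by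
      intro w j t
      simp only [hvc]
      simp only [hv₀, Pi.add_apply, Pi.sub_apply, hTK, hu]
      abel
    have hvφ : ∀ w j a, φ ((T w + v₀) j a) = φ (v j a) := by
      intro w j a
      have h1 : ∀ x, φ (T x j a) = 0 := fun x => by
        rw [← LinearMap.mem_ker, hS]
        exact hTS x j a
      simp [hv₀, h1]
    have hns' : ∀ (w : Fin s → Fin d → S) (l' : Fin s → Fin q → Dual ℝ Q),
        ¬ Function.Surjective (condMap (V := S) (fun j t => m j (K j t)) w l') := by
      intro w l' hw
      let f : S ≃ₗ[ℝ] (Fin d → ℝ) := (finBasisOfFinrankEq ℝ S hd).equivFun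
      obtain ⟨w', hw'⟩ := hGg l hGl d hdr.le K _ l' (surjective_condMap_equiv f hw)
      have hw₁ := surjective_condMap_equiv f.symm hw'
      obtain ⟨p₁, hp₁, hp₁w, hp₁s⟩ := LinePoly.surjective_pi
        (M := fun w : Fin s → Fin d → S => condMap (V := S) (fun j t => m j (K j t)) w l)
        (fun ψ x => by
          have := LinePoly.linear (l x.1.1 x.1.2.2 ∘ₗ ψ ∘ₗ
            LinearMap.proj (R := ℝ) (φ := fun _ => S) x.1.2.1 ∘ₗ
              LinearMap.proj (R := ℝ) (φ := fun _ => Fin d → S) x.1.1)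
          exact this) _ hw₁
      obtain ⟨p₂, hp₂, hp₂u, hp₂r⟩ := LinePoly.rank_pi
        (M := fun w : Fin s → Fin d → S => condMap m (T w + v₀) l)
        (fun ψ x => by
          have := (LinePoly.linear (l x.1.1 x.1.2.2 ∘ₗ ψ ∘ₗ
            LinearMap.proj (R := ℝ) (φ := fun _ => V) x.1.2.1 ∘ₗ
              LinearMap.proj (R := ℝ) (φ := fun _ => Fin r → V) x.1.1 ∘ₗ T)).add
            (LinePoly.const (l x.1.1 x.1.2.2 (ψ (v₀ x.1.1 x.1.2.1))))
          refine (congrArg LinePoly (funext fun w => ?_)).mp this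
          rw [condMap_apply, Pi.add_apply, Pi.add_apply, map_add, map_add]
          rfl) u
      obtain ⟨w₂, h1, h2⟩ := LinePoly.exists_ne_zero hp₁ hp₂ hp₁w hp₂u
      refine hns (T w₂ + v₀) l (surjective_of_restrict hS (fun j => (hE j).cover) (hvK w₂) ?_ ?_ ?_
        (hp₁s _ h1))
      · intro j
        rw [Fintype.linearIndependent_iff]
        intro g hg
        simp only [hvφ, ← map_smul, ← map_sum] at hg
        rw [← LinearMap.mem_ker, hS, ← hB] at hg
        exact congrFun ((hE j).eq_zero_of_sum_mem hd (hE j).strictMono_compl.injective hg)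
      · rw [condMap_eq_zero] at hφ ⊢
        intro j a b hb
        rw [hvφ]
        exact hφ j a b hb
      · intro l'
        refine (hmax (T w₂ + v₀, l')).trans ?_
        have h3 := hp₂r _ h2
        rw [huv] at h3
        exact h3
    obtain ⟨w, hpw, S', K', hS', hlt⟩ := ih d hdr hd _ hns' (fun w => p (T w + v₀))
      ((hp.comp_add_const v₀).comp T) u (by rwa [huv])
    refine ⟨_, hpw, S'.map S.subtype, fun j => (K' j).image (K j), fun j k hk => ?_, ?_⟩
    · obtain ⟨t, ht, rfl⟩ := Finset.mem_image.1 hk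
      obtain ⟨x, hx, hxt⟩ := hS' j t ht
      refine ⟨x, ⟨x, hx, rfl⟩, ?_⟩
      have hc : ∀ t', ∀ n : ℕ, (K j t' : ℕ) < n → ∑ b, β j t' b • (T w + v₀) j (c j b) ∈
          span ℝ ((T w + v₀) j '' {i | (i : ℕ) < n}) := by
        intro t' n hn
        refine sum_mem fun b _ => ?_
        by_cases hb : K j t' < c j b
        · rw [(hE j).coeff t' b hb, zero_smul]
          exact zero_mem _
        · exact smul_mem _ _ (subset_span ⟨_, lt_of_le_of_lt (Fin.le_def.1 (not_lt.1 hb)) hn, rfl⟩)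
      have hw : ∀ t' < t, (w j t' : V) ∈ span ℝ ((T w + v₀) j '' {i | (i : ℕ) < K j t}) := by
        intro t' ht'
        have h1 : (K j t' : ℕ) < K j t := (hE j).strictMono ht'
        rw [← hvK w j t']
        exact add_mem (subset_span ⟨_, h1, rfl⟩) (hc t' _ h1)
      have h1 : (x : V) - w j t ∈ span ℝ ((T w + v₀) j '' {i | (i : ℕ) < K j t}) := by
        have h2 : S.subtype (x - w j t) ∈ (span ℝ (w j '' {i | (i : ℕ) < t})).map S.subtype :=
          mem_map_of_mem hxt
        rw [map_span] at h2
        refine span_le.2 ?_ h2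
        rintro _ ⟨_, ⟨t', ht', rfl⟩, rfl⟩
        exact hw t' ht'
      have h2 : (x : V) - (T w + v₀) j (K j t)
          = ((x : V) - w j t) + ∑ b, β j t b • (T w + v₀) j (c j b) := by
        rw [← hvK w j t]
        abel
      rw [h2]
      refine add_mem h1 (sum_mem fun b _ => ?_)
      by_cases hb : K j t < c j b
      · rw [(hE j).coeff t b hb, zero_smul]
        exact zero_mem _
      · exact smul_mem _ _ (subset_span
          ⟨_, Fin.lt_def.1 (lt_of_le_of_ne (not_lt.1 hb) ((hE j).ne t b).symm), rfl⟩)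
    · rw [finrank_map_subtype_eq]
      refine hlt.trans_eq (Finset.sum_congr rfl fun j _ => ?_)
      rw [Finset.sum_image fun _ _ _ _ h => (hE j).strictMono.injective h]

end Destabilize

end

section

section Generic
open MvPolynomial

theorem exists_polynomial_relation {σ τ : Type} [Fintype σ] [Fintype τ]
    (Ψ : σ → MvPolynomial τ ℝ) (h : Fintype.card τ < Fintype.card σ) :
    ∃ f : MvPolynomial σ ℝ, f ≠ 0 ∧ ∀ ρ : τ → ℝ, eval (fun i => eval ρ (Ψ i)) f = 0 := by
  have h1 : ¬ AlgebraicIndependent ℝ Ψ := by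
    intro h1
    have h2 := h1.cardinalMk_le_trdeg
    rw [MvPolynomial.trdeg_of_isDomain, Cardinal.lift_id, Cardinal.mk_fintype, Cardinal.mk_fintype,
      Nat.cast_le] at h2
    omega
  rw [algebraicIndependent_iff] at h1
  push Not at h1
  obtain ⟨f, hf, hf0⟩ := h1
  refine ⟨f, hf0, fun ρ => ?_⟩
  have h2 := congrArg (eval ρ) hf
  rw [map_zero, aeval_def, eval_eval₂] at h2
  rw [← h2, eval, eval₂Hom]
  simp only [RingHom.coe_mk, MonoidHom.coe_mk, OneHom.coe_mk]
  congr 1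
  ext x
  simp

variable {s d e r : ℕ}

theorem exists_linePoly_echelon (hde : d + e = r) (T : Fin d → Fin r) (T' : Fin e → Fin r)
    (K : Fin s → Fin d → Fin r) (c : Fin s → Fin e → Fin r)
    (hlt : d * e < ∑ j, ∑ t, (e - ((K j t : ℕ) - (t : ℕ)))) :
    ∃ p : (Fin s → Fin r → Fin r → ℝ) → ℝ, LinePoly p ∧ (∃ v, p v ≠ 0) ∧
      ∀ (v : Fin s → Basis (Fin r) ℝ (Fin r → ℝ)) (S : Submodule ℝ (Fin r → ℝ))
        (βT : Fin d → Fin e → ℝ) (β : Fin s → Fin d → Fin e → ℝ), finrank ℝ S = d →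
          Echelon (Pi.basisFun ℝ (Fin r)) S T T' βT →
          (∀ j, Echelon (v j) S (K j) (c j) (β j)) → p (fun j => v j) = 0 := by
  classical
  by_cases hex : ∃ (v : Fin s → Basis (Fin r) ℝ (Fin r → ℝ)) (S : Submodule ℝ (Fin r → ℝ))
    (βT : Fin d → Fin e → ℝ) (β : Fin s → Fin d → Fin e → ℝ), Echelon (Pi.basisFun ℝ (Fin r)) S T T' βT ∧
      ∀ j, Echelon (v j) S (K j) (c j) (β j)
  swap
  · exact ⟨fun _ => 1, LinePoly.const 1, ⟨0, one_ne_zero⟩,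
      fun v S βT β _ h1 h2 => absurd ⟨v, S, βT, β, h1, h2⟩ hex⟩
  obtain ⟨v₁, S₁, βT₁, β₁, hT₁, hK₁⟩ := hex
  have hbij : ∀ {v : Fin r → Fin r → ℝ} {T : Fin d → Fin r} {T' : Fin e → Fin r} {β},
      Echelon v S₁ T T' β → Function.Bijective (Sum.elim T T') := by
    intro v T T' β h
    refine ⟨h.strictMono.injective.sumElim h.strictMono_compl.injective h.ne, fun a => ?_⟩
    rcases h.cover a with ⟨t, ht⟩ | ⟨b, hb⟩
    · exact ⟨Sum.inl t, ht⟩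
    · exact ⟨Sum.inr b, hb⟩
  let ET := Equiv.ofBijective _ (hbij hT₁)
  let EK := fun j => Equiv.ofBijective _ (hbij (hK₁ j))
  let F := {x : Fin s × Fin d × Fin e // ¬ ((K x.1 x.2.1 : ℕ) - (x.2.1 : ℕ) ≤ (x.2.2 : ℕ))}
  let τ := (Fin s × Fin e × Fin r) ⊕ (Fin s × Fin d × Fin d) ⊕ (Fin e × Fin d) ⊕ F
  let σ := Fin s × (Fin d ⊕ Fin e) × (Fin d ⊕ Fin e)
  let Dp : Fin s → Fin e → Fin r → MvPolynomial τ ℝ := fun j b i => X (Sum.inl (j, b, i))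
  let Ap : Fin s → Fin d → Fin d → MvPolynomial τ ℝ := fun j t t' => X (Sum.inr (Sum.inl (j, t, t')))
  let Np : Fin e → Fin d → MvPolynomial τ ℝ := fun b t => X (Sum.inr (Sum.inr (Sum.inl (b, t))))
  let Bp : Fin s → Fin d → Fin e → MvPolynomial τ ℝ := fun j t b =>
    if h : (K j t : ℕ) - (t : ℕ) ≤ b then 0 else X (Sum.inr (Sum.inr (Sum.inr ⟨(j, t, b), h⟩)))
  let Ψ : σ → MvPolynomial τ ℝ := fun x => match x with
    | (j, Sum.inr b, y) => Dp j b (ET y)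
    | (j, Sum.inl t, Sum.inl t') => Ap j t t'
    | (j, Sum.inl t, Sum.inr b) => ∑ t', Np b t' * (Ap j t t' + ∑ b', Bp j t b' * Dp j b' (T t'))
        - ∑ b', Bp j t b' * Dp j b' (T' b)
  have hcard : Fintype.card τ < Fintype.card σ := by
    have h1 : Fintype.card F = s * (d * e) - ∑ j, ∑ t, (e - ((K j t : ℕ) - (t : ℕ))) := by
      rw [Fintype.card_subtype_compl, card_cond fun j t => (K j t : ℕ) - (t : ℕ)]
      simp
    have h2 : ∑ j, ∑ t, (e - ((K j t : ℕ) - (t : ℕ))) ≤ s * (d * e) := by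
      calc _ ≤ ∑ j : Fin s, ∑ t : Fin d, e :=
            Finset.sum_le_sum fun j _ => Finset.sum_le_sum fun t _ => Nat.sub_le _ _
        _ = s * (d * e) := by simp
    simp only [τ, σ, Fintype.card_sum, Fintype.card_prod, Fintype.card_fin, h1]
    subst hde
    have h3 : s * ((d + e) * (d + e)) = s * (e * (d + e)) + s * (d * d) + s * (d * e) := by ring
    rw [h3, mul_comm e d]
    omega
  obtain ⟨f, hf0, hf⟩ := exists_polynomial_relation Ψ hcard
  let R : (Fin s → Fin r → Fin r → ℝ) →ₗ[ℝ] (σ → ℝ) := LinearMap.pi fun x =>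
    LinearMap.proj (R := ℝ) (φ := fun _ => ℝ) (ET x.2.2) ∘ₗ
      LinearMap.proj (R := ℝ) (φ := fun _ => Fin r → ℝ) (EK x.1 x.2.1) ∘ₗ
        LinearMap.proj (R := ℝ) (φ := fun _ => Fin r → Fin r → ℝ) x.1
  refine ⟨fun v => eval (R v) f, (LinePoly.mvPolynomial f).comp R, ?_, ?_⟩
  · obtain ⟨x, hx⟩ : ∃ x, eval x f ≠ 0 := by
      by_contra! h
      exact hf0 (MvPolynomial.funext fun x => by rw [h, map_zero])
    refine ⟨fun j a i => x (j, (EK j).symm a, ET.symm i), ?_⟩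
    convert hx using 3
    funext ⟨j, a, i⟩
    simp [R]
  · intro v S βT β hS hT hK
    let ρ : τ → ℝ := Sum.elim (fun x => v x.1 (c x.1 x.2.1) x.2.2)
      (Sum.elim (fun x => v x.1 (K x.1 x.2.1) (T x.2.2)) (Sum.elim (fun x => βT x.2 x.1)
        fun x => β x.1.1 x.1.2.1 x.1.2.2))
    dsimp only
    rw [← hf ρ]
    congr 2
    funext x
    have hB : ∀ j t b, eval ρ (Bp j t b) = β j t b := by
      intro j t b
      simp only [Bp]
      split_ifs with h
      · rw [map_zero]
        refine ((hK j).coeff t b (lt_of_le_of_ne (not_lt.1 fun h' => ?_) ((hK j).ne t b))).symm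
        have := (complement_lt_iff (hK j).strictMono (hK j).strictMono_compl (hK j).ne (hK j).cover
          t b).1 h'
        omega
      · rw [eval_X]
        rfl
    have hD : ∀ j b i, eval ρ (Dp j b i) = v j (c j b) i := fun j b i => by
      simp only [Dp, eval_X]
      rfl
    have hA : ∀ j t t', eval ρ (Ap j t t') = v j (K j t) (T t') := fun j t t' => by
      simp only [Ap, eval_X]
      rfl
    have hN : ∀ b t, eval ρ (Np b t) = βT t b := fun b t => by
      simp only [Np, eval_X]
      rfl
    obtain ⟨j, t | b, y⟩ := x
    · rcases y with t' | b
      · change v j (K j t) (T t') = eval ρ (Ap j t t')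
        rw [hA]
      · change v j (K j t) (T' b) = eval ρ (∑ t', Np b t' * (Ap j t t' + ∑ b', Bp j t b' * Dp j b' (T t'))
          - ∑ b', Bp j t b' * Dp j b' (T' b))
        simp only [map_sub, map_sum, map_mul, map_add, hN, hA, hB, hD]
        have h1 := congrFun (hT.eq_sum hS ((hK j).mem t)) (T' b)
        have h2 : ∀ t', ((Pi.basisFun ℝ (Fin r)) (T t') + ∑ b, βT t' b • (Pi.basisFun ℝ (Fin r)) (T' b) :
            Fin r → ℝ) (T' b) = βT t' b := by
          intro t'
          simp [Pi.single_apply, (hT.ne t' b).symm, hT.strictMono_compl.injective.eq_iff]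
        simp only [Finset.sum_apply, Pi.smul_apply, h2, Pi.add_apply, smul_eq_mul, Basis.coord_apply,
          Pi.basisFun_repr] at h1
        rw [eq_sub_iff_add_eq, h1]
        exact Finset.sum_congr rfl fun t' _ => mul_comm _ _
    · change v j (c j b) (ET y) = eval ρ (Dp j b (ET y))
      rw [hD]

end Generic

end

section

theorem sum_mul_sub_nonneg {r : ℕ} {L : Fin r → ℕ} (hL : Antitone L) {f : ℕ → ℤ} (hf : ∀ n, 0 ≤ f n)
    (hf0 : f 0 = 0) : 0 ≤ ∑ a : Fin r, (L a : ℤ) * (f (a + 1) - f a) := by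
  let l : ℕ → ℤ := fun n => if h : n < r then L ⟨n, h⟩ else 0
  have hl : ∀ n, l (n + 1) ≤ l n := by
    intro n
    simp only [l]
    split_ifs with h1 h2
    · exact_mod_cast hL (Fin.mk_le_mk.2 (Nat.le_succ n))
    · omega
    · positivity
    · exact le_rfl
  have hl0 : ∀ n, 0 ≤ l n := by
    intro n
    simp only [l]
    split_ifs <;> positivity
  have h1 : ∀ n, l n * f n ≤ ∑ a ∈ Finset.range n, l a * (f (a + 1) - f a) := by
    intro n
    induction n with
    | zero => simp [hf0]
    | succ n ih =>
      rw [Finset.sum_range_succ]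
      nlinarith [mul_le_mul_of_nonneg_right (hl n) (hf (n + 1))]
  refine (mul_nonneg (hl0 r) (hf r)).trans ((h1 r).trans_eq ?_)
  rw [← Fin.sum_univ_eq_sum_range fun a => l a * (f (a + 1) - f a)]
  refine Finset.sum_congr rfl fun a _ => ?_
  simp [l]

section Slope

variable {V : Type*} [AddCommGroup V] [Module ℝ V] {s r : ℕ}

/-- The standard flag of a family of vectors. -/
def flagOf (v : Fin r → V) (n : ℕ) : Submodule ℝ V := span ℝ (v '' {i | (i : ℕ) < n})

/-- The degree of a subspace, normalised so that stability means nonpositivity. -/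
def stabilityDegree (q : ℕ) (L : Fin s → Fin r → ℕ) (v : Fin s → Fin r → V) (S : Submodule ℝ V) : ℤ :=
  ∑ j, ∑ a : Fin r, (L j a : ℤ) * ((finrank ℝ (S ⊓ flagOf (v j) (a + 1) : Submodule ℝ V) : ℤ) -
    finrank ℝ (S ⊓ flagOf (v j) a : Submodule ℝ V)) - q * finrank ℝ S

theorem flagOf_zero (v : Fin r → V) : flagOf v 0 = ⊥ := by simp [flagOf]

theorem flagOf_mono (v : Fin r → V) : Monotone (flagOf v) := fun _ _ h =>
  span_mono (Set.image_mono fun _ hi => lt_of_lt_of_le hi h)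

variable [FiniteDimensional ℝ V]

theorem stabilityDegree_echelon {d e q : ℕ} {L : Fin s → Fin r → ℕ} {B : Fin s → Basis (Fin r) ℝ V}
    {S : Submodule ℝ V} {K : Fin s → Fin d → Fin r} {c : Fin s → Fin e → Fin r}
    {β : Fin s → Fin d → Fin e → ℝ} (h : ∀ j, Echelon (B j) S (K j) (c j) (β j))
    (hS : finrank ℝ S = d) :
    stabilityDegree q L (fun j => B j) S = ∑ j, ∑ t, (L j (K j t) : ℤ) - q * d := by
  classical
  rw [stabilityDegree, hS]
  congr 1
  refine Finset.sum_congr rfl fun j _ => ?_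
  have h1 : ∀ a : Fin r, ((finrank ℝ (S ⊓ flagOf (B j) (a + 1) : Submodule ℝ V) : ℤ) -
      finrank ℝ (S ⊓ flagOf (B j) a : Submodule ℝ V)) = ∑ t, if K j t = a then 1 else 0 := by
    intro a
    rw [flagOf, flagOf, (h j).finrank_inf hS, (h j).finrank_inf hS, Finset.card_filter,
      Finset.card_filter]
    push_cast
    rw [← Finset.sum_sub_distrib]
    refine Finset.sum_congr rfl fun t _ => ?_
    simp only [Fin.ext_iff]
    split_ifs <;> first | rfl | omega
  simp only [h1, Finset.mul_sum]
  rw [Finset.sum_comm]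
  refine Finset.sum_congr rfl fun t _ => ?_
  simp

theorem Destabilized.exists_stabilityDegree_pos {q : ℕ} {m : Fin s → Fin r → ℕ}
    {B : Fin s → Basis (Fin r) ℝ V} (h : Destabilized q m fun j => B j) :
    ∃ S, 0 < stabilityDegree q (fun j a => q - m j a) (fun j => B j) S := by
  classical
  obtain ⟨S, K, hK, hlt⟩ := h
  refine ⟨S, ?_⟩
  rw [stabilityDegree, sub_pos]
  refine lt_of_lt_of_le (b := ((∑ j, ∑ k ∈ K j, (q - m j k) : ℕ) : ℤ)) (by exact_mod_cast hlt) ?_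
  rw [Nat.cast_sum]
  refine Finset.sum_le_sum fun j _ => ?_
  rw [Nat.cast_sum]
  have hmono : ∀ a : Fin r, S ⊓ flagOf (B j) a ≤ S ⊓ flagOf (B j) (a + 1) := fun a =>
    inf_le_inf_left _ (flagOf_mono _ (Nat.le_succ _))
  have hnonneg : ∀ a : Fin r, (0 : ℤ) ≤ ((q - m j a : ℕ) : ℤ) *
      ((finrank ℝ (S ⊓ flagOf (B j) (a + 1) : Submodule ℝ V) : ℤ) -
        finrank ℝ (S ⊓ flagOf (B j) a : Submodule ℝ V)) := fun a =>
    mul_nonneg (Nat.cast_nonneg _) (sub_nonneg.2 (Nat.cast_le.2 (Submodule.finrank_mono (hmono a))))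
  refine le_trans ?_ (Finset.sum_le_sum_of_subset_of_nonneg (Finset.subset_univ (K j))
    fun a _ _ => hnonneg a)
  refine Finset.sum_le_sum fun k hk => ?_
  refine le_mul_of_one_le_right (Nat.cast_nonneg _) ?_
  obtain ⟨x, hx, hxk⟩ := hK j k hk
  have h1 : B j k ∉ flagOf (B j) k := fun h => by
    have := coord_eq_zero_of_mem_span (B j) h le_rfl
    simp at this
  have h2 : x ∉ flagOf (B j) k := fun h => h1 (by
    have := sub_mem h hxk
    rwa [sub_sub_cancel] at this)
  have h3 : x ∈ flagOf (B j) (k + 1) := by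
    have h4 : B j k ∈ flagOf (B j) (k + 1) := subset_span ⟨k, Nat.lt_succ_self _, rfl⟩
    have := add_mem (flagOf_mono _ (Nat.le_succ _) hxk) h4
    rwa [sub_add_cancel] at this
  have h4 : S ⊓ flagOf (B j) k < S ⊓ flagOf (B j) (k + 1) :=
    lt_of_le_of_ne (hmono k) fun h => h2 (h.ge ⟨hx, h3⟩).2
  have := Submodule.finrank_lt_finrank_of_lt h4
  omega

theorem stabilityDegree_le (q : ℕ) (L : Fin s → Fin r → ℕ) (v : Fin s → Fin r → V)
    (S : Submodule ℝ V) :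
    stabilityDegree q L v S ≤ ∑ j, ∑ a : Fin r, (L j a : ℤ) * finrank ℝ V := by
  rw [stabilityDegree]
  refine (sub_le_self _ (by positivity)).trans ?_
  refine Finset.sum_le_sum fun j _ => Finset.sum_le_sum fun a _ => ?_
  refine mul_le_mul_of_nonneg_left ?_ (Nat.cast_nonneg _)
  have := Submodule.finrank_le (S ⊓ flagOf (v j) (a + 1))
  omega

/-- A subspace of maximal degree, of minimal dimension among those. -/
theorem exists_stabilityDegree_maximal (q : ℕ) (L : Fin s → Fin r → ℕ) (v : Fin s → Fin r → V) :
    ∃ S, ∀ S', stabilityDegree q L v S' ≤ stabilityDegree q L v S ∧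
      (stabilityDegree q L v S' = stabilityDegree q L v S → finrank ℝ S ≤ finrank ℝ S') := by
  obtain ⟨C, hC⟩ : ∃ C : ℤ, C = ∑ j, ∑ a : Fin r, (L j a : ℤ) * finrank ℝ V := ⟨_, rfl⟩
  let g : Submodule ℝ V → ℕ := fun S =>
    (C - stabilityDegree q L v S).toNat * (finrank ℝ V + 1) + finrank ℝ S
  have hg : ∀ S, (g S : ℤ) = (C - stabilityDegree q L v S) * (finrank ℝ V + 1) + finrank ℝ S := by
    intro S
    have := stabilityDegree_le q L v S
    simp only [g]
    push_cast
    rw [Int.toNat_of_nonneg (by omega)]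
  refine ⟨Function.argmin g, fun S' => ?_⟩
  have h1 : (g (Function.argmin g) : ℤ) ≤ g S' := Nat.cast_le.2 (Function.argmin_le g S')
  rw [hg, hg] at h1
  have h2 : (finrank ℝ S' : ℤ) ≤ finrank ℝ V := Nat.cast_le.2 (Submodule.finrank_le S')
  constructor
  · by_contra! h
    have h3 : (0 : ℤ) ≤ finrank ℝ V + 1 := by positivity
    nlinarith [mul_le_mul_of_nonneg_right (Int.add_one_le_iff.2 h) h3]
  · intro h
    rw [h] at h1
    omega

theorem finrank_inf_add_le {S R R' F : Submodule ℝ V} {N : S →ₗ[ℝ] V ⧸ S}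
    (hR : (LinearMap.ker N).map S.subtype = R) (hR' : (LinearMap.range N).comap S.mkQ = R')
    (hN : ∀ x : S, (x : V) ∈ F → N x ∈ F.map S.mkQ) :
    2 * finrank ℝ (S ⊓ F : Submodule ℝ V)
      ≤ finrank ℝ (R ⊓ F : Submodule ℝ V) + finrank ℝ (R' ⊓ F : Submodule ℝ V) := by
  let f : (S ⊓ F : Submodule ℝ V) →ₗ[ℝ] V ⧸ S := N ∘ₗ inclusion inf_le_left
  let g : (R' ⊓ F : Submodule ℝ V) →ₗ[ℝ] V ⧸ S := S.mkQ ∘ₗ (R' ⊓ F).subtype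
  have hf := f.finrank_range_add_finrank_ker
  have hg := g.finrank_range_add_finrank_ker
  have h1 : LinearMap.range f ≤ LinearMap.range g := by
    rintro _ ⟨x, rfl⟩
    obtain ⟨y, hy, hy'⟩ := hN (inclusion inf_le_left x) x.2.2
    have hyR : y ∈ R' := by
      rw [← hR', mem_comap, hy']
      exact LinearMap.mem_range_self _ _
    exact ⟨⟨y, hyR, hy⟩, hy'⟩
  have h2 : (LinearMap.ker f).map (S ⊓ F).subtype ≤ R ⊓ F := by
    rintro _ ⟨x, hx, rfl⟩
    refine ⟨?_, x.2.2⟩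
    rw [← hR]
    exact ⟨inclusion inf_le_left x, hx, rfl⟩
  have h3 : S ⊓ F ≤ (LinearMap.ker g).map (R' ⊓ F).subtype := by
    rintro x ⟨hx, hx'⟩
    have h4 : S.mkQ x = 0 := (Submodule.Quotient.mk_eq_zero S).2 hx
    have hxR : x ∈ R' := by
      rw [← hR', mem_comap, h4]
      exact zero_mem _
    exact ⟨⟨x, hxR, hx'⟩, h4, rfl⟩
  have h1' := Submodule.finrank_mono h1
  have h2' := Submodule.finrank_mono h2
  have h3' := Submodule.finrank_mono h3
  rw [finrank_map_subtype_eq] at h2' h3'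
  omega

/-- A subspace of maximal degree and minimal dimension has no nonzero map to the quotient that
respects the flags. -/
theorem eq_zero_of_stabilityDegree_maximal {q : ℕ} {L : Fin s → Fin r → ℕ} (hL : ∀ j, Antitone (L j))
    {v : Fin s → Fin r → V} {S : Submodule ℝ V}
    (hS : ∀ S', stabilityDegree q L v S' ≤ stabilityDegree q L v S ∧
      (stabilityDegree q L v S' = stabilityDegree q L v S → finrank ℝ S ≤ finrank ℝ S'))
    {N : S →ₗ[ℝ] V ⧸ S}
    (hN : ∀ j n (x : S), (x : V) ∈ flagOf (v j) n → N x ∈ (flagOf (v j) n).map S.mkQ) : N = 0 := by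
  obtain ⟨R, hR⟩ : ∃ R, (LinearMap.ker N).map S.subtype = R := ⟨_, rfl⟩
  obtain ⟨R', hR'⟩ : ∃ R', (LinearMap.range N).comap S.mkQ = R' := ⟨_, rfl⟩
  have hRS : finrank ℝ R = finrank ℝ (LinearMap.ker N) := by rw [← hR, finrank_map_subtype_eq]
  have hRS' : finrank ℝ R' ≤ finrank ℝ (LinearMap.range N) + finrank ℝ S := by
    let g : R' →ₗ[ℝ] V ⧸ S := S.mkQ ∘ₗ R'.subtype
    have hg := g.finrank_range_add_finrank_ker
    have h1 : LinearMap.range g ≤ LinearMap.range N := by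
      rintro _ ⟨x, rfl⟩
      exact hR'.ge x.2
    have h2 : (LinearMap.ker g).map R'.subtype ≤ S := by
      rintro _ ⟨x, hx, rfl⟩
      exact (Submodule.Quotient.mk_eq_zero S).1 hx
    have h1' := Submodule.finrank_mono h1
    have h2' := Submodule.finrank_mono h2
    rw [finrank_map_subtype_eq] at h2'
    omega
  have hNrk := N.finrank_range_add_finrank_ker
  have hdeg : 2 * stabilityDegree q L v S ≤ stabilityDegree q L v R + stabilityDegree q L v R' := by
    have h1 : (q : ℤ) * (finrank ℝ R + finrank ℝ R') ≤ q * (2 * finrank ℝ S) :=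
      mul_le_mul_of_nonneg_left (by omega) (Nat.cast_nonneg _)
    have h2 : 0 ≤ ∑ j, ∑ a : Fin r, (L j a : ℤ) *
        (((finrank ℝ (R ⊓ flagOf (v j) (a + 1) : Submodule ℝ V) : ℤ) +
          finrank ℝ (R' ⊓ flagOf (v j) (a + 1) : Submodule ℝ V) -
          2 * finrank ℝ (S ⊓ flagOf (v j) (a + 1) : Submodule ℝ V)) -
        ((finrank ℝ (R ⊓ flagOf (v j) a : Submodule ℝ V) : ℤ) +
          finrank ℝ (R' ⊓ flagOf (v j) a : Submodule ℝ V) -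
          2 * finrank ℝ (S ⊓ flagOf (v j) a : Submodule ℝ V))) := by
      refine Finset.sum_nonneg fun j _ => ?_
      refine sum_mul_sub_nonneg (hL j) (f := fun n =>
        (finrank ℝ (R ⊓ flagOf (v j) n : Submodule ℝ V) : ℤ) +
          finrank ℝ (R' ⊓ flagOf (v j) n : Submodule ℝ V) -
          2 * finrank ℝ (S ⊓ flagOf (v j) n : Submodule ℝ V)) (fun n => ?_) ?_
      · have := finrank_inf_add_le hR hR' (hN j n)
        omega
      · have h0 : ∀ T : Submodule ℝ V, finrank ℝ (T ⊓ flagOf (v j) 0 : Submodule ℝ V) = 0 := fun T => by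
          rw [flagOf_zero, inf_bot_eq, finrank_bot]
        simp [h0]
    simp only [mul_sub, mul_add, Finset.sum_sub_distrib, Finset.sum_add_distrib,
      mul_left_comm _ (2 : ℤ), ← Finset.mul_sum] at h2
    simp only [stabilityDegree, mul_sub, Finset.sum_sub_distrib]
    linarith
  have h1 := hS R
  have h2 := hS R'
  have h3 := h1.2 (by omega)
  have h4 : finrank ℝ (LinearMap.range N) = 0 := by omega
  exact LinearMap.range_eq_bot.1 (Submodule.finrank_eq_zero.1 h4)

end Slope

end

section

theorem genericallyRigid_of_injective {s r q : ℕ} {V Q : Type*} [AddCommGroup V] [Module ℝ V]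
    [AddCommGroup Q] [Module ℝ Q] [FiniteDimensional ℝ V] [FiniteDimensional ℝ Q]
    (hV : finrank ℝ V = r) (hQ : finrank ℝ Q = q) {m : Fin s → Fin r → ℕ} {v : Fin s → Fin r → V}
    {l : Fin s → Fin q → Dual ℝ Q} (h : Function.Injective (condMap m v l)) :
    GenericallyRigid q m := by
  let f : V ≃ₗ[ℝ] (Fin r → ℝ) := LinearEquiv.ofFinrankEq _ _ (by simp [hV])
  let g : Q ≃ₗ[ℝ] (Fin q → ℝ) := LinearEquiv.ofFinrankEq _ _ (by simp [hQ])
  refine ⟨fun j a => f (v j a), fun j b => l j b ∘ₗ g.symm.toLinearMap,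
    (injective_iff_map_eq_zero _).2 fun φ hφ => ?_⟩
  have h1 : g.symm.toLinearMap ∘ₗ φ ∘ₗ f.toLinearMap = 0 :=
    (injective_iff_map_eq_zero _).1 h _
      (condMap_eq_zero.2 fun j a b hab => condMap_eq_zero.1 hφ j a b hab)
  ext1 x
  have h2 := LinearMap.congr_fun h1 (f.symm (Pi.single x 1))
  ext y
  simpa using congrFun (congrArg g h2) y

section

variable {V : Type*} [AddCommGroup V] [Module ℝ V] [FiniteDimensional ℝ V] {s r d q : ℕ}

/-- The problem induced on a destabilizing subspace of maximal degree and minimal dimension is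
generically rigid, and not underdetermined. -/
theorem exists_injective_of_stabilityDegree_maximal (hV : finrank ℝ V = r)
    {L : Fin s → Fin r → ℕ} (hL : ∀ j, Antitone (L j)) {B : Fin s → Basis (Fin r) ℝ V}
    {S : Submodule ℝ V} (hd : finrank ℝ S = d) (hdr : d < r)
    (hS : ∀ S', stabilityDegree q L (fun j => B j) S' ≤ stabilityDegree q L (fun j => B j) S ∧
      (stabilityDegree q L (fun j => B j) S' = stabilityDegree q L (fun j => B j) S →
        finrank ℝ S ≤ finrank ℝ S'))
    {K : Fin s → Fin d → Fin r} {c : Fin s → Fin (r - d) → Fin r}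
    {β : Fin s → Fin d → Fin (r - d) → ℝ} (h : ∀ j, Echelon (B j) S (K j) (c j) (β j)) :
    GenericallyRigid (r - d) (fun j t => (K j t : ℕ) - (t : ℕ)) ∧
      d * (r - d) ≤ ∑ j, ∑ t, ((r - d) - ((K j t : ℕ) - (t : ℕ))) := by
  classical
  have hQ : finrank ℝ (V ⧸ S) = r - d := by
    have := S.finrank_quotient_add_finrank
    omega
  have hli : ∀ j, LinearIndependent ℝ fun b => S.mkQ (B j (c j b)) := by
    intro j
    rw [Fintype.linearIndependent_iff]
    intro y hy b
    have h1 : ∑ b, y b • B j (c j b) ∈ S := by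
      rw [← Submodule.Quotient.mk_eq_zero, ← Submodule.mkQ_apply, map_sum]
      simpa only [map_smul] using hy
    exact congrFun ((h j).eq_zero_of_sum_mem hd (h j).strictMono_compl.injective h1) b
  have : Nonempty (Fin (r - d)) := ⟨⟨0, by omega⟩⟩
  let C : ∀ j, Basis (Fin (r - d)) ℝ (V ⧸ S) := fun j =>
    basisOfLinearIndependentOfCardEqFinrank (hli j) (by rw [hQ, Fintype.card_fin])
  have hC : ∀ j b, C j b = S.mkQ (B j (c j b)) := fun j b => by
    simp [C]
  let u : Fin s → Fin d → S := fun j t => ⟨_, (h j).mem t⟩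
  have hinj : Function.Injective (condMap (fun j t => (K j t : ℕ) - (t : ℕ)) u
      fun j b => (C j).coord b) := by
    refine (injective_iff_map_eq_zero _).2 fun N hN => ?_
    rw [condMap_eq_zero] at hN
    refine eq_zero_of_stabilityDegree_maximal hL hS fun j n x hx => ?_
    have h1 : ∀ t, (K j t : ℕ) < n → N (u j t) ∈ (flagOf (B j) n).map S.mkQ := by
      intro t ht
      rw [← (C j).sum_repr (N (u j t))]
      refine sum_mem fun b _ => ?_
      by_cases hb : (K j t : ℕ) - t ≤ b
      · have : (C j).repr (N (u j t)) b = 0 := hN j t b hb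
        rw [this, zero_smul]
        exact zero_mem _
      · have hlt := (complement_lt_iff (h j).strictMono (h j).strictMono_compl (h j).ne (h j).cover
          t b).2 (not_le.1 hb)
        refine smul_mem _ _ ?_
        rw [hC]
        exact mem_map_of_mem (subset_span ⟨_, (Fin.lt_def.1 hlt).trans ht, rfl⟩)
    have h2 : x = ∑ t, (B j).coord (K j t) (x : V) • u j t := by
      refine Subtype.ext (((h j).eq_sum hd x.2).trans ?_)
      rw [AddSubmonoidClass.coe_finsetSum]
      rfl
    rw [h2, map_sum]
    refine sum_mem fun t _ => ?_
    rw [map_smul]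
    by_cases ht : (K j t : ℕ) < n
    · exact smul_mem _ _ (h1 t ht)
    · rw [coord_eq_zero_of_mem_span (B j) hx (not_lt.1 ht), zero_smul]
      exact zero_mem _
  refine ⟨genericallyRigid_of_injective hd hQ hinj, ?_⟩
  have h1 := LinearMap.finrank_le_finrank_of_injective hinj
  rw [finrank_linearMap, hd, hQ, finrank_fintype_fun_eq_card,
    card_cond (q := r - d) fun j (t : Fin d) => (K j t : ℕ) - (t : ℕ)] at h1
  exact h1

end

/-- The generic Horn problem is rigid as soon as all generically rigid subproblems satisfy the
semistability inequality. -/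
theorem genericallyRigid_of_forall {s r q : ℕ} {m : Fin s → Fin r → ℕ} (hm : ∀ j, Monotone (m j))
    (hdim : ∑ j, ∑ a, (q - m j a) = r * q)
    (h : ∀ d, 1 ≤ d → d < r → ∀ K : Fin s → Fin d → Fin r, (∀ j, StrictMono (K j)) →
      GenericallyRigid (r - d) (fun j t => (K j t : ℕ) - (t : ℕ)) →
      ∑ j, ∑ t, ((r - d) - ((K j t : ℕ) - (t : ℕ))) = d * (r - d) →
      ∑ j, ∑ t, (q - m j (K j t)) ≤ d * q) : GenericallyRigid q m := by
  classical
  by_contra hrig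
  have hns : ∀ (v : Fin s → Fin r → Fin r → ℝ) (l : Fin s → Fin q → Dual ℝ (Fin q → ℝ)),
      ¬ Function.Surjective (condMap m v l) := by
    intro v l hsur
    refine hrig ⟨v, l, (LinearMap.injective_iff_surjective_of_finrank_eq_finrank ?_).2 hsur⟩
    rw [finrank_linearMap, finrank_fintype_fun_eq_card, finrank_fintype_fun_eq_card,
      finrank_fintype_fun_eq_card, card_cond, hdim, Fintype.card_fin, Fintype.card_fin]
  obtain ⟨D, hD, ⟨v₁, hv₁⟩, hDb⟩ := exists_linePoly_basis s (Pi.basisFun ℝ (Fin r))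
  let ι := Σ d : Fin (r + 1), (Fin d → Fin r) × (Fin (r - d) → Fin r) × (Fin s → Fin d → Fin r) ×
    (Fin s → Fin (r - d) → Fin r)
  have hex : ∀ i : ι, ∃ p : (Fin s → Fin r → Fin r → ℝ) → ℝ, LinePoly p ∧ (∃ v, p v ≠ 0) ∧
      ∀ (v : Fin s → Basis (Fin r) ℝ (Fin r → ℝ)) (S : Submodule ℝ (Fin r → ℝ))
        (βT : Fin i.1 → Fin (r - i.1) → ℝ) (β : Fin s → Fin i.1 → Fin (r - i.1) → ℝ),
        finrank ℝ S = i.1 → Echelon (Pi.basisFun ℝ (Fin r)) S i.2.1 i.2.2.1 βT →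
        (∀ j, Echelon (v j) S (i.2.2.2.1 j) (i.2.2.2.2 j) (β j)) →
        (i.1 : ℕ) * (r - i.1) < ∑ j, ∑ t, ((r - i.1) - ((i.2.2.2.1 j t : ℕ) - (t : ℕ))) →
        p (fun j => v j) = 0 := by
    intro i
    by_cases hlt : (i.1 : ℕ) * (r - i.1) < ∑ j, ∑ t, ((r - i.1) - ((i.2.2.2.1 j t : ℕ) - (t : ℕ)))
    · obtain ⟨p, hp, hpv, hp0⟩ := exists_linePoly_echelon (Nat.add_sub_of_le (Nat.lt_succ_iff.1 i.1.2))
        i.2.1 i.2.2.1 i.2.2.2.1 i.2.2.2.2 hlt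
      exact ⟨p, hp, hpv, fun v S βT β h1 h2 h3 _ => hp0 v S βT β h1 h2 h3⟩
    · exact ⟨fun _ => 1, LinePoly.const 1, ⟨0, one_ne_zero⟩, fun _ _ _ _ _ _ _ h => absurd h hlt⟩
  choose p hp hpv hp0 using hex
  have hP : LinePoly fun x => ∏ i, p i x := LinePoly.prod _ fun i _ => hp i
  obtain ⟨v₂, hv₂⟩ := LinePoly.exists_ne_zero_finset Finset.univ (fun i _ => hp i) fun i _ => hpv i
  obtain ⟨v₀, h₀, h₀'⟩ := LinePoly.exists_ne_zero hD hP hv₁ (Finset.prod_ne_zero_iff.2 hv₂)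
  obtain ⟨v, hv, hdes⟩ := exists_destabilized (Module.finrank_fin_fun ℝ) r
    (Module.finrank_fin_fun ℝ) m hns _ (hD.mul hP) v₀ (mul_ne_zero h₀ h₀')
  obtain ⟨B, hB⟩ := hDb v (left_ne_zero_of_mul hv)
  obtain rfl : (fun j => ⇑(B j)) = v := funext hB
  have hpB := Finset.prod_ne_zero_iff.1 (right_ne_zero_of_mul hv)
  obtain ⟨S', hS'⟩ := hdes.exists_stabilityDegree_pos
  obtain ⟨S, hS⟩ := exists_stabilityDegree_maximal q (fun j a => q - m j a) fun j => ⇑(B j)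
  have hpos := hS'.trans_le (hS S').1
  obtain ⟨d, hd⟩ : ∃ d, finrank ℝ S = d := ⟨_, rfl⟩
  have hdr : d ≤ r := by
    have := Submodule.finrank_le S
    rwa [hd, Module.finrank_fin_fun] at this
  have hex : ∀ j, ∃ (K : Fin d → Fin r) (c : Fin (r - d) → Fin r) (β : Fin d → Fin (r - d) → ℝ),
      Echelon (B j) S K c β := fun j =>
    exists_echelon (B j).span_eq (Nat.add_sub_of_le hdr) (Module.finrank_fin_fun ℝ) hd
  choose K c β hE using hex
  obtain ⟨T, T', βT, hT⟩ := exists_echelon (Pi.basisFun ℝ (Fin r)).span_eq (Nat.add_sub_of_le hdr)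
    (Module.finrank_fin_fun ℝ) hd
  rw [stabilityDegree_echelon hE hd, sub_pos] at hpos
  have hpos' : q * d < ∑ j, ∑ t, (q - m j (K j t)) := by
    have h1 : ((∑ j, ∑ t, (q - m j (K j t)) : ℕ) : ℤ) = ∑ j, ∑ t, ((q - m j (K j t) : ℕ) : ℤ) := by
      simp only [Nat.cast_sum]
    rw [← h1] at hpos
    exact_mod_cast hpos
  rcases Nat.eq_zero_or_pos d with rfl | hd0
  · simp at hpos'
  rcases hdr.eq_or_lt with rfl | hdr'
  · have h1 : ∀ j, ∑ t, (q - m j (K j t)) = ∑ a, (q - m j a) := fun j =>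
      (Finite.injective_iff_bijective.1 (hE j).strictMono.injective).sum_comp fun a => q - m j a
    simp only [h1] at hpos'
    rw [hdim, mul_comm] at hpos'
    exact lt_irrefl _ hpos'
  · obtain ⟨hrigK, hle⟩ := exists_injective_of_stabilityDegree_maximal (Module.finrank_fin_fun ℝ)
      (fun j _ _ hab => Nat.sub_le_sub_left (hm j hab) q) hd hdr' hS hE
    have hge : ¬ d * (r - d) < ∑ j, ∑ t, ((r - d) - ((K j t : ℕ) - (t : ℕ))) := fun hlt =>
      hpB ⟨⟨d, Nat.lt_succ_of_le hdr⟩, T, T', K, c⟩ (Finset.mem_univ _)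
        (hp0 ⟨⟨d, Nat.lt_succ_of_le hdr⟩, T, T', K, c⟩ B S βT β hd hT hE hlt)
    have := h d hd0 hdr' K (fun j => (hE j).strictMono) hrigK (le_antisymm (not_lt.1 hge) hle)
    rw [mul_comm] at this
    omega

section Shape

variable {n r : ℕ} {i : Fin r → Fin n}

theorem StrictMono.le_val (hi : StrictMono i) (a : Fin r) : (a : ℕ) ≤ i a := by
  obtain ⟨a, ha⟩ := a
  induction a with
  | zero => exact Nat.zero_le _
  | succ a ih =>
    have h1 := ih (by omega)
    have h2 : i ⟨a, by omega⟩ < i ⟨a + 1, ha⟩ := hi (Fin.mk_lt_mk.2 (Nat.lt_succ_self a))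
    rw [Fin.lt_def] at h2
    simp only at h1 ⊢
    omega

theorem StrictMono.monotone_val_sub (hi : StrictMono i) :
    Monotone fun a => (i a : ℕ) - (a : ℕ) := by
  have key : ∀ (k a : ℕ) (h : a + k < r),
      (i ⟨a, by omega⟩ : ℕ) + k ≤ i ⟨a + k, h⟩ := by
    intro k
    induction k with
    | zero => intro a h; exact le_rfl
    | succ k ih =>
      intro a h
      have h1 := ih a (by omega)
      have h2 : i ⟨a + k, by omega⟩ < i ⟨a + (k + 1), h⟩ := hi (Fin.mk_lt_mk.2 (by omega))
      rw [Fin.lt_def] at h2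
      omega
  intro a b hab
  have h1 := key (b - a) a (by have := b.2; have := Fin.le_def.1 hab; omega)
  have h2 : (⟨a + (b - a), by have := b.2; have := Fin.le_def.1 hab; omega⟩ : Fin r) = b :=
    Fin.ext (by have := Fin.le_def.1 hab; simp only; omega)
  rw [h2] at h1
  have := Fin.le_def.1 hab
  simp only [Fin.eta] at h1 ⊢
  omega

theorem StrictMono.val_sub_le (hi : StrictMono i) (a : Fin r) :
    (i a : ℕ) - (a : ℕ) ≤ n - r := by
  have hr := a.2
  have h1 : (i a : ℕ) - (a : ℕ) ≤ (i ⟨r - 1, by omega⟩ : ℕ) - (r - 1) :=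
    hi.monotone_val_sub (Fin.le_def.2 (by simp only; omega))
  have h2 := (i ⟨r - 1, by omega⟩).2
  omega

theorem StrictMono.cast_sub_val_sub (hi : StrictMono i) (hrn : r ≤ n) (a : Fin r) :
    ((n - r - ((i a : ℕ) - (a : ℕ)) : ℕ) : ℤ) = (n : ℤ) - r + (a : ℕ) - (i a : ℕ) := by
  have h1 := hi.le_val a
  have h2 := hi.val_sub_le a
  omega

theorem sum_codimZ_eq_iff {s : ℕ} {I : Fin s → Fin r → Fin n} (hI : ∀ j, StrictMono (I j))
    (hrn : r ≤ n) : ∑ j, codimZ n r (I j) = (r : ℤ) * ((n : ℤ) - r) ↔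
      ∑ j, ∑ a, (n - r - ((I j a : ℕ) - (a : ℕ))) = r * (n - r) := by
  rw [← Nat.cast_inj (R := ℤ), Nat.cast_mul, Nat.cast_sub hrn, Nat.cast_sum]
  have : ∀ j, codimZ n r (I j) = ((∑ a, (n - r - ((I j a : ℕ) - (a : ℕ))) : ℕ) : ℤ) := fun j => by
    rw [codimZ, Nat.cast_sum]
    exact Finset.sum_congr rfl fun a _ => ((hI j).cast_sub_val_sub hrn a).symm
  simp only [this]

end Shape

section Horn

variable {n r s : ℕ} {I : Fin s → Fin r → Fin n}

theorem interNum_ne_zero_iff_isHighest (hrn : r ≤ n) (hI : ∀ j, StrictMono (I j)) :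
    interNum I ≠ 0 ↔
      ∃ f, f ≠ 0 ∧ IsHighest (n - r) (fun j a => n - r - ((I j a : ℕ) - (a : ℕ))) f :=
  interNum_ne_zero_iff hrn I _
    (fun j _ _ hab => Nat.sub_le_sub_left ((hI j).monotone_val_sub hab) (n - r))
    fun j a => (hI j).cast_sub_val_sub hrn a

theorem GenericallyRigid.interNum_ne_zero (hrn : r ≤ n) (hI : ∀ j, StrictMono (I j))
    (h : GenericallyRigid (n - r) fun j a => (I j a : ℕ) - (a : ℕ))
    (hdim : ∑ j, ∑ a, (n - r - ((I j a : ℕ) - (a : ℕ))) = r * (n - r)) : interNum I ≠ 0 :=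
  (interNum_ne_zero_iff_isHighest hrn hI).2
    (h.exists_isHighest (fun j => (hI j).monotone_val_sub) hdim)

/-- The Horn inequalities of an intersection problem. -/
def HornInequalities (I : Fin s → Fin r → Fin n) : Prop :=
  ∀ d, 1 ≤ d → d < r → ∀ K : Fin s → Fin d → Fin r, (∀ j, StrictMono (K j)) → interNum K ≠ 0 →
    ∑ j, ∑ t, (n - r - ((I j (K j t) : ℕ) - (K j t : ℕ))) ≤ d * (n - r)

theorem HornInequalities.genericallyRigid (hI : ∀ j, StrictMono (I j))
    (hdim : ∑ j, ∑ a, (n - r - ((I j a : ℕ) - (a : ℕ))) = r * (n - r)) (h : HornInequalities I) :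
    GenericallyRigid (n - r) fun j a => (I j a : ℕ) - (a : ℕ) :=
  genericallyRigid_of_forall (fun j => (hI j).monotone_val_sub) hdim fun d hd hdr K hK hrig hdimK =>
    h d hd hdr K hK (hrig.interNum_ne_zero hdr.le hK hdimK)

theorem hornInequalities_of_interNum_ne_zero (hrn : r ≤ n) (hI : ∀ j, StrictMono (I j))
    (h : interNum I ≠ 0) : HornInequalities I := by
  induction r using Nat.strong_induction_on generalizing n with
  | _ r ih =>
  intro d _ hdr K hK hKn
  have hdimK := (sum_codimZ_eq_iff hK hdr.le).1 (sum_codimZ_of_interNum_ne_zero hdr.le K hKn)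
  obtain ⟨x₀, hx₀⟩ := exists_lowSystem_injective hdr hK
    ((ih d hdr hdr.le hK hKn).genericallyRigid hK hdimK) hdimK
  obtain ⟨f, hf, hH⟩ := (interNum_ne_zero_iff_isHighest hrn hI).1 h
  exact sum_le_of_isHighest hdr.le K (fun j => (hK j).injective) hf hH hx₀

end Horn

end

/-- Geometric Horn, top-degree form.  Given positive `n, r, s` with
`r ≤ n` and subsets `I^1, …, I^s ⊆ [n]` of cardinality `r` (recorded by the strictly
increasing `0`-indexed tuples `I j : Fin r → Fin n`) whose total codimension is
`r(n-r)`, the product `∏_j ω_{I^j}` is a nonzero multiple of the class of a point in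
`H^*(Gr(r,n))` iff for all `1 ≤ d < r` and all subsets `K^1, …, K^s ⊆ [r]` of
cardinality `d` with `∏_j ω_{K^j}` a nonzero multiple of the class of a point in
`H^*(Gr(d,r))`, one has `∑_j ∑_{a ∈ K^j} (n - r + a - i^j_a) ≤ d(n-r)`. -/
theorem stmt0 (n r s : ℕ) (hr : 0 < r) (hs : 0 < s) (hrn : r ≤ n)
    (I : Fin s → Fin r → Fin n) (hI : ∀ j, StrictMono (I j))
    (hcodim : ∑ j : Fin s, codimZ n r (I j) = (r : ℤ) * ((n : ℤ) - (r : ℤ))) :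
    (∃ c : ℤ, c ≠ 0 ∧ (∏ j : Fin s, omegaCls (I j)) = c • pointCls r n hrn) ↔
      (∀ d : ℕ, 1 ≤ d → ∀ hdr : d < r, ∀ K : Fin s → Fin d → Fin r,
        (∀ j, StrictMono (K j)) →
        (∃ c : ℤ, c ≠ 0 ∧ (∏ j : Fin s, omegaCls (K j)) = c • pointCls d r hdr.le) →
        ∑ j : Fin s, ∑ t : Fin d,
            ((n : ℤ) - (r : ℤ) + ((K j t : ℕ) : ℤ) - ((I j (K j t) : ℕ) : ℤ))
          ≤ (d : ℤ) * ((n : ℤ) - (r : ℤ))) := by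
  have hdim := (sum_codimZ_eq_iff hI hrn).1 hcodim
  have hcast : ∀ (d : ℕ) (K : Fin s → Fin d → Fin r), (∑ j, ∑ t, ((n : ℤ) - (r : ℤ) + ((K j t : ℕ) : ℤ)
      - ((I j (K j t) : ℕ) : ℤ)) ≤ (d : ℤ) * ((n : ℤ) - (r : ℤ))) ↔
        ∑ j, ∑ t, (n - r - ((I j (K j t) : ℕ) - (K j t : ℕ))) ≤ d * (n - r) := by
    intro d K
    rw [← Nat.cast_le (α := ℤ), Nat.cast_mul, Nat.cast_sub hrn, Nat.cast_sum]
    simp only [Nat.cast_sum, fun j t => (hI j).cast_sub_val_sub hrn (K j t)]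
  rw [prod_omegaCls_iff hr hrn I hcodim]
  constructor
  · intro h d hd hdr K hK hKp
    exact (hcast d K).2 (hornInequalities_of_interNum_ne_zero hrn hI h d hd hdr K hK
      (interNum_ne_zero_of_prod hd hdr.le K hKp))
  · intro h
    refine GenericallyRigid.interNum_ne_zero hrn hI
      (HornInequalities.genericallyRigid hI hdim fun d hd hdr K hK hKn => ?_) hdim
    refine (hcast d K).1 (h d hd hdr K hK ?_)
    exact (prod_omegaCls_iff hd hdr.le K (sum_codimZ_of_interNum_ne_zero hdr.le K hKn)).2 hKn

end
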